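/- arXiv:2512.23164 — 2 statements merged into one kernel-verified Lean document; each statement's English description precedes it below -/
import Mathlib

section
/- For every real α with 1 < α ≤ 6/5 and every t ≥ 0, the three-parametric Mittag-Leffler function satisfies E^2_{α, 2+α}(−t) ≥ 0. -/
/-- The three-parametric Mittag-Leffler function
`E^γ_{ρ,μ}(z) = Σ_{n≥0} Γ(γ+n)/(Γ(γ)Γ(1+n)Γ(μ+ρn)) · z^n`. -/
noncomputable def mittagLeffler3 (ρ μ γ : ℝ) (z : ℝ) : ℝ :=
  ∑' n : ℕ,
    Real.Gamma (γ + n) / (Real.Gamma γ * Real.Gamma (1 + n) * Real.Gamma (μ + ρ * n)) * z ^ n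

open Filter Topology MeasureTheory

/-- The leading terms of `3 - 3 * x + x ^ 2 / 2` minus two Kummer series, with denominators cleared,
where `U` stands for `x ^ b / Γ (1 + b)` and `V` for `x ^ (2 * b) / Γ (1 + 2 * b)`. -/
noncomputable def lowOrder (b x U V : ℝ) : ℝ :=
  2 * (1 + b) * (2 + b) * (1 + 2 * b) * (3 - 2 * U - 3 * x + x ^ 2 / 2)
    + U * (4 * (2 - b) * (2 + b) * (1 + 2 * b) * x - 2 * (2 - b) * (1 - b) * (1 + 2 * b) * x ^ 2)
    + V * ((1 - 2 * b) * (2 + b) * x ^ 2 - 2 * (1 + b) * (2 + b) * x)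

lemma bernsteinBasis_nonneg {b x u v : ℝ} (hb : 0 ≤ b) (hb' : b ≤ 1 / 5) (hx : u ≤ x) (hx' : x ≤ v)
    (i j k l : ℕ) : 0 ≤ b ^ i * (1 / 5 - b) ^ j * ((x - u) ^ k * (v - x) ^ l) := by
  have h1 := sub_nonneg.2 hb'
  have h2 := sub_nonneg.2 hx
  have h3 := sub_nonneg.2 hx'
  positivity

lemma lowOrder_upper_le_one {b x : ℝ} (hb : 0 ≤ b) (hb' : b ≤ 1 / 5) (hx : (0:ℝ) ≤ x)
    (hx' : x ≤ 1) :
    b * x ^ 3 / 7 * (2 * (1 + b) * (2 + b) * (1 + 2 * b)) ≤ lowOrder b x (1 + 41 / 50 * b)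
        ((1 + 41 / 50 * b) ^ 2) := by
  have h := bernsteinBasis_nonneg hb hb' hx hx'
  unfold lowOrder
  linarith [h 0 4 0 3, h 0 4 1 2, h 0 4 2 1, h 0 4 3 0, h 1 3 0 3, h 1 3 1 2, h 1 3 2 1,
    h 1 3 3 0, h 2 2 0 3, h 2 2 1 2, h 2 2 2 1, h 2 2 3 0, h 3 1 0 3, h 3 1 1 2, h 3 1 2 1,
    h 3 1 3 0, h 4 0 0 3, h 4 0 1 2, h 4 0 2 1, h 4 0 3 0]

lemma lowOrder_one_le_three_halves {b x : ℝ} (hb : 0 ≤ b) (hb' : b ≤ 1 / 5) (hx : 1 ≤ x)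
    (hx' : x ≤ 3 / 2) :
    b * x ^ 3 / 7 * (2 * (1 + b) * (2 + b) * (1 + 2 * b)) ≤ lowOrder b x 1 1 := by
  have h := bernsteinBasis_nonneg hb hb' hx hx'
  unfold lowOrder
  linarith [h 0 4 0 3, h 0 4 1 2, h 0 4 2 1, h 0 4 3 0, h 1 3 0 3, h 1 3 1 2, h 1 3 2 1,
    h 1 3 3 0, h 2 2 0 3, h 2 2 1 2, h 2 2 2 1, h 2 2 3 0, h 3 1 0 3, h 3 1 1 2, h 3 1 2 1,
    h 3 1 3 0, h 4 0 0 3, h 4 0 1 2, h 4 0 2 1, h 4 0 3 0]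

lemma lowOrder_one_le_five_halves {b x : ℝ} (hb : 0 ≤ b) (hb' : b ≤ 1 / 5) (hx : 3 / 2 ≤ x)
    (hx' : x ≤ 5 / 2) :
    0 ≤ lowOrder b x 1 1 := by
  have h := bernsteinBasis_nonneg hb hb' hx hx'
  unfold lowOrder
  linarith [h 0 3 0 2, h 0 3 1 1, h 0 3 2 0, h 1 2 0 2, h 1 2 1 1, h 1 2 2 0, h 2 1 0 2,
    h 2 1 1 1, h 2 1 2 0, h 3 0 0 2, h 3 0 1 1, h 3 0 2 0]

lemma lowOrder_one_le_four {b x : ℝ} (hb : 0 ≤ b) (hb' : b ≤ 1 / 5) (hx : 5 / 2 ≤ x) (hx' : x ≤ 4) :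
    0 ≤ lowOrder b x 1 1 := by
  have h := bernsteinBasis_nonneg hb hb' hx hx'
  unfold lowOrder
  linarith [h 0 3 0 2, h 0 3 1 1, h 0 3 2 0, h 1 2 0 2, h 1 2 1 1, h 1 2 2 0, h 2 1 0 2,
    h 2 1 1 1, h 2 1 2 0, h 3 0 0 2, h 3 0 1 1, h 3 0 2 0]

lemma lowOrder_tangent_le_three_halves {b x : ℝ} (hb : 0 ≤ b) (hb' : b ≤ 1 / 5) (hx : 1 ≤ x)
    (hx' : x ≤ 3 / 2) :
    b * x ^ 3 / 7 * (2 * (1 + b) * (2 + b) * (1 + 2 * b)) ≤ lowOrder b x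
        (1 + b * (7 / 6 * x - 1 / 3)) ((1 + b * (7 / 6 * x - 1 / 3)) ^ 2) := by
  have h := bernsteinBasis_nonneg hb hb' hx hx'
  unfold lowOrder
  linarith [h 0 4 0 4, h 0 4 1 3, h 0 4 2 2, h 0 4 3 1, h 0 4 4 0, h 1 3 0 4, h 1 3 1 3,
    h 1 3 2 2, h 1 3 3 1, h 1 3 4 0, h 2 2 0 4, h 2 2 1 3, h 2 2 2 2, h 2 2 3 1, h 2 2 4 0,
    h 3 1 0 4, h 3 1 1 3, h 3 1 2 2, h 3 1 3 1, h 3 1 4 0, h 4 0 0 4, h 4 0 1 3, h 4 0 2 2,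
    h 4 0 3 1, h 4 0 4 0]

lemma lowOrder_tangent_le_four {b x : ℝ} (hb : 0 ≤ b) (hb' : b ≤ 1 / 5) (hx : 3 / 2 ≤ x)
    (hx' : x ≤ 4) :
    0 ≤ lowOrder b x (1 + b * (7 / 6 * x - 1 / 3)) ((1 + b * (7 / 6 * x - 1 / 3)) ^ 2) := by
  have h := bernsteinBasis_nonneg hb hb' hx hx'
  unfold lowOrder
  linarith [h 0 4 0 4, h 0 4 1 3, h 0 4 2 2, h 0 4 3 1, h 0 4 4 0, h 1 3 0 4, h 1 3 1 3,
    h 1 3 2 2, h 1 3 3 1, h 1 3 4 0, h 2 2 0 4, h 2 2 1 3, h 2 2 2 2, h 2 2 3 1, h 2 2 4 0,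
    h 3 1 0 4, h 3 1 1 3, h 3 1 2 2, h 3 1 3 1, h 3 1 4 0, h 4 0 0 4, h 4 0 1 3, h 4 0 2 2,
    h 4 0 3 1, h 4 0 4 0]

lemma pow_mul_one_fifth_sub_pow_nonneg {b : ℝ} (hb : 0 ≤ b) (hb' : b ≤ 1 / 5) (i j : ℕ) :
    0 ≤ b ^ i * (1 / 5 - b) ^ j := by
  have h1 := sub_nonneg.2 hb'
  positivity

lemma lowOrder_large_quadratic_coeff {b U : ℝ} (hb : 0 ≤ b) (hb' : b ≤ 1 / 5) :
    7 / 25 * b * (2 * (1 + b) * (2 + b) * (1 + 2 * b)) * (1 + 2 * b) ≤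
    (1 + 2 * b) * ((1 + b) * (2 + b) * (1 + 2 * b) - 2 * (2 - b) * (1 - b) * (1 + 2 * b) * U)
      + (1 - 2 * b) * (2 + b) * (1 + 2 * b - 2 * b ^ 2) * U ^ 2 := by
  have h := pow_mul_one_fifth_sub_pow_nonneg hb hb'
  have ha : 0 < (1 - 2 * b) * (2 + b) * (1 + 2 * b - 2 * b ^ 2) := by
    have : 0 < 1 - 2 * b := by linarith
    have : 0 < 1 + 2 * b - 2 * b ^ 2 := by nlinarith
    positivity
  have hs := sq_nonneg (((1 - 2 * b) * (2 + b) * (1 + 2 * b - 2 * b ^ 2)) * U -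
    (1 + 2 * b) * ((2 - b) * (1 - b) * (1 + 2 * b)))
  have hu : ((1 + 2 * b) * ((2 - b) * (1 - b) * (1 + 2 * b))) ^ 2 ≤
      ((1 - 2 * b) * (2 + b) * (1 + 2 * b - 2 * b ^ 2)) *
          ((1 + 2 * b) * ((1 + b) * (2 + b) * (1 + 2 * b)) -
      7 / 25 * b * (2 * (1 + b) * (2 + b) * (1 + 2 * b)) * (1 + 2 * b)) := by
    linarith [h 0 9, h 1 8, h 2 7, h 3 6, h 4 5, h 5 4, h 6 3, h 7 2, h 8 1, h 9 0]
  nlinarith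

lemma lowOrder_large_linear_coeff {b U : ℝ} (hb : 0 ≤ b) (hb' : b ≤ 1 / 5) (hU : 1 ≤ U) :
    - (2 * b * (1 - 5 * b)) * ((1 - 2 * b) * (1 + 2 * b) * (2 * (1 + b) * (2 + b) * (1 + 2 * b))) ≤
    (1 + 2 * b) * ((2 * (1 + b) * (2 + b) * (1 + 2 * b)) * (8 * b - 1)
      + U * (4 * (2 - b) * (2 + b) * (1 + 2 * b) * (1 - 2 * b)
        - 8 * (1 + b) * (2 - b) * (1 - b) * (1 + 2 * b)))
      + 2 * (1 + b) * (2 + b) * (1 - 2 * b) * (1 + 2 * b - 2 * b ^ 2) * U ^ 2 := by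
  have h := pow_mul_one_fifth_sub_pow_nonneg hb hb'
  obtain ⟨e, he, rfl⟩ : ∃ e, 0 ≤ e ∧ U = 1 + e := ⟨U - 1, by linarith, by ring⟩
  have h0 : 4 * b ^ 2 ≤ 2 * b * (1 - 5 * b) * ((1 - 2 * b) * (1 + 2 * b) *
      (2 * (1 + b) * (2 + b) * (1 + 2 * b))) +
    (1 + 2 * b) * ((2 * (1 + b) * (2 + b) * (1 + 2 * b)) * (8 * b - 1)
      + (4 * (2 - b) * (2 + b) * (1 + 2 * b) * (1 - 2 * b)
        - 8 * (1 + b) * (2 - b) * (1 - b) * (1 + 2 * b)))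
      + 2 * (1 + b) * (2 + b) * (1 - 2 * b) * (1 + 2 * b - 2 * b ^ 2) := by
    linarith [h 0 7, h 1 6, h 2 5, h 3 4, h 4 3, h 5 2, h 6 1, h 7 0]
  have h1 : -(4 * b ^ 2) ≤ (1 + 2 * b) * (4 * (2 - b) * (2 + b) * (1 + 2 * b) * (1 - 2 * b)
        - 8 * (1 + b) * (2 - b) * (1 - b) * (1 + 2 * b))
      + 2 * (2 * (1 + b) * (2 + b) * (1 - 2 * b) * (1 + 2 * b - 2 * b ^ 2)) := by
    linarith [h 0 7, h 1 6, h 2 5, h 3 4, h 4 3, h 5 2, h 6 1, h 7 0]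
  have h2 : 4 * b ^ 2 ≤ 2 * (1 + b) * (2 + b) * (1 - 2 * b) * (1 + 2 * b - 2 * b ^ 2) := by
    linarith [h 0 7, h 1 6, h 2 5, h 3 4, h 4 3, h 5 2, h 6 1, h 7 0]
  nlinarith [mul_le_mul_of_nonneg_left h1 he, mul_le_mul_of_nonneg_left h2 (sq_nonneg e),
    mul_nonneg (sq_nonneg b) (sq_nonneg (e - 1)), mul_nonneg (sq_nonneg b) he]

lemma lowOrder_large_constant_coeff {b U : ℝ} (hb : 0 ≤ b) (hb' : b ≤ 1 / 5) (hU : 1 ≤ U) :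
    3 / 20 * ((1 - 2 * b) ^ 2 * (2 * (1 + b) * (2 + b) * (1 + 2 * b))) ≤
    2 * (1 + b) * (2 + b) * (1 + 2 * b) * ((3 - 2 * U) * (1 - 2 * b) ^ 2 - 6 * (1 + b) * (1 - 2 * b)
        + 2 * (1 + b) ^ 2)
      + U * (8 * (1 + b) * (2 - b) * (2 + b) * (1 + 2 * b) * (1 - 2 * b)
        - 8 * (1 + b) ^ 2 * (2 - b) * (1 - b) * (1 + 2 * b)) := by
  have h := pow_mul_one_fifth_sub_pow_nonneg hb hb'
  obtain ⟨e, he, rfl⟩ : ∃ e, 0 ≤ e ∧ U = 1 + e := ⟨U - 1, by linarith, by ring⟩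
  have h1 : 0 ≤ 2 * (1 + b) * (2 + b) * (1 + 2 * b) * (- 2 * (1 - 2 * b) ^ 2)
      + (8 * (1 + b) * (2 - b) * (2 + b) * (1 + 2 * b) * (1 - 2 * b)
        - 8 * (1 + b) ^ 2 * (2 - b) * (1 - b) * (1 + 2 * b)) := by
    linarith [h 0 7, h 1 6, h 2 5, h 3 4, h 4 3, h 5 2, h 6 1, h 7 0]
  have h0 : 3 / 20 * ((1 - 2 * b) ^ 2 * (2 * (1 + b) * (2 + b) * (1 + 2 * b))) ≤
    2 * (1 + b) * (2 + b) * (1 + 2 * b) * ((1 - 2 * b) ^ 2 - 6 * (1 + b) * (1 - 2 * b)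
        + 2 * (1 + b) ^ 2)
      + (8 * (1 + b) * (2 - b) * (2 + b) * (1 + 2 * b) * (1 - 2 * b)
        - 8 * (1 + b) ^ 2 * (2 - b) * (1 - b) * (1 + 2 * b)) := by
    linarith [h 0 7, h 1 6, h 2 5, h 3 4, h 4 3, h 5 2, h 6 1, h 7 0]
  linarith [mul_nonneg h1 he]

lemma lowOrder_nonneg_large {b x U V : ℝ} (hb : 0 ≤ b) (hb' : b ≤ 1 / 5)
    (hx : 2 + 2 * b ≤ (1 - 2 * b) * x) (hU : 1 ≤ U)
    (hV : (1 + 2 * b - 2 * b ^ 2) * U ^ 2 ≤ (1 + 2 * b) * V) : 0 ≤ lowOrder b x U V := by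
  have hb2 : 0 < 1 - 2 * b := by linarith
  obtain ⟨y, rfl⟩ : ∃ y, x = (2 + 2 * b) / (1 - 2 * b) + y := ⟨_, (add_sub_cancel _ _).symm⟩
  have hy : 0 ≤ y := by
    have : (1 - 2 * b) * ((2 + 2 * b) / (1 - 2 * b) + y) = 2 + 2 * b + (1 - 2 * b) * y := by
      field_simp
    rw [this] at hx
    exact nonneg_of_mul_nonneg_right (by linarith) hb2
  have key : (1 - 2 * b) ^ 2 * (1 + 2 * b) * lowOrder b ((2 + 2 * b) / (1 - 2 * b) + y) U V =
      (1 + 2 * b) * (2 * (1 + b) * (2 + b) * (1 + 2 * b) *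
          ((3 - 2 * U) * (1 - 2 * b) ^ 2 - 6 * (1 + b) * (1 - 2 * b)
        + 2 * (1 + b) ^ 2)
      + U * (8 * (1 + b) * (2 - b) * (2 + b) * (1 + 2 * b) * (1 - 2 * b)
        - 8 * (1 + b) ^ 2 * (2 - b) * (1 - b) * (1 + 2 * b)))
      + (1 - 2 * b) * y * ((1 + 2 * b) * ((2 * (1 + b) * (2 + b) * (1 + 2 * b)) * (8 * b - 1)
      + U * (4 * (2 - b) * (2 + b) * (1 + 2 * b) * (1 - 2 * b)
        - 8 * (1 + b) * (2 - b) * (1 - b) * (1 + 2 * b)))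
      + 2 * (1 + b) * (2 + b) * (1 - 2 * b) * (1 + 2 * b - 2 * b ^ 2) * U ^ 2)
      + (1 - 2 * b) ^ 2 * y ^ 2 * ((1 + 2 * b) * ((1 + b) * (2 + b) * (1 + 2 * b) - 2 * (2 - b) *
          (1 - b) * (1 + 2 * b) * U)
      + (1 - 2 * b) * (2 + b) * (1 + 2 * b - 2 * b ^ 2) * U ^ 2)
      + ((1 + 2 * b) * V - (1 + 2 * b - 2 * b ^ 2) * U ^ 2) * ((1 - 2 * b) ^ 2 * (2 + b) * y *
        (2 + 2 * b + (1 - 2 * b) * y)) := by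
    unfold lowOrder
    field_simp
    ring
  have hq : 0 ≤ 3 / 20 - 2 * b * (1 - 5 * b) * y + 7 / 25 * b * y ^ 2 := by
    have h3 : b * (1 - 5 * b) ^ 2 ≤ 21 / 500 := by
      nlinarith [mul_nonneg hb (sq_nonneg (15 * b - 1)), sq_nonneg (15 * b - 1)]
    nlinarith [mul_nonneg hb (sq_nonneg (7 / 25 * y - (1 - 5 * b)))]
  have h0 := mul_le_mul_of_nonneg_left (lowOrder_large_constant_coeff hb hb' hU)
      (by linarith : 0 ≤ 1 + 2 * b)
  have h1 := mul_le_mul_of_nonneg_left (lowOrder_large_linear_coeff hb hb' hU)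
      (by positivity : 0 ≤ (1 - 2 * b) * y)
  have h2 := mul_le_mul_of_nonneg_left (lowOrder_large_quadratic_coeff (U := U) hb hb')
    (by positivity : 0 ≤ (1 - 2 * b) ^ 2 * y ^ 2)
  have h4 : 0 ≤ ((1 + 2 * b) * V - (1 + 2 * b - 2 * b ^ 2) * U ^ 2) *
      ((1 - 2 * b) ^ 2 * (2 + b) * y *
        (2 + 2 * b + (1 - 2 * b) * y)) := mul_nonneg (by linarith) (by positivity)
  have h5 := mul_nonneg (by positivity : 0 ≤ (1 - 2 * b) ^ 2 * (1 + 2 * b) *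
    (2 * (1 + b) * (2 + b) * (1 + 2 * b))) hq
  refine nonneg_of_mul_nonneg_right (b := lowOrder b _ U V) ?_
    (by positivity : 0 < (1 - 2 * b) ^ 2 * (1 + 2 * b))
  rw [key]
  linarith

lemma le_quadratic_of_le_endpoints {a₀ a₁ a₂ m u v w : ℝ} (h : a₂ ≤ 0) (huw : u ≤ w) (hwv : w ≤ v)
    (hu : m ≤ a₀ + a₁ * u + a₂ * u ^ 2) (hv : m ≤ a₀ + a₁ * v + a₂ * v ^ 2) :
    m ≤ a₀ + a₁ * w + a₂ * w ^ 2 := by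
  rcases (huw.trans hwv).eq_or_lt with rfl | huv
  · rwa [← le_antisymm huw hwv]
  · have h1 := mul_nonneg (sub_nonneg.2 hwv) (sub_nonneg.2 hu)
    have h2 := mul_nonneg (sub_nonneg.2 huw) (sub_nonneg.2 hv)
    have h3 := mul_nonneg (mul_nonneg (sub_nonneg.2 huw) (sub_nonneg.2 hwv))
      (mul_nonneg (neg_nonneg.2 h) (sub_pos.2 huv).le)
    refine sub_nonneg.1 (nonneg_of_mul_nonneg_right (a := v - u) ?_ (sub_pos.2 huv))
    linarith

lemma le_lowOrder_of_le_endpoints {b x u v U V m : ℝ} (hb : 0 ≤ b) (hx : 0 ≤ x)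
    (hbx : (1 - 2 * b) * x ≤ 2 + 2 * b) (huU : u ≤ U) (hUv : U ≤ v) (hV : V ≤ U ^ 2)
    (hu : m ≤ lowOrder b x u (u ^ 2)) (hv : m ≤ lowOrder b x v (v ^ 2)) : m ≤ lowOrder b x U V := by
  have hc : (1 - 2 * b) * (2 + b) * x ^ 2 - 2 * (1 + b) * (2 + b) * x ≤ 0 := by
    have := mul_nonneg (mul_nonneg (by linarith : 0 ≤ 2 + b) hx) (sub_nonneg.2 hbx)
    linarith
  have h := le_quadratic_of_le_endpoints (m := m)
    (a₀ := 2 * (1 + b) * (2 + b) * (1 + 2 * b) * (3 - 3 * x + x ^ 2 / 2))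
    (a₁ := 4 * (2 - b) * (2 + b) * (1 + 2 * b) * x - 2 * (2 - b) * (1 - b) * (1 + 2 * b) * x ^ 2
      - 4 * (1 + b) * (2 + b) * (1 + 2 * b)) hc huU hUv
    (by unfold lowOrder at hu; linarith) (by unfold lowOrder at hv; linarith)
  unfold lowOrder
  linarith [mul_le_mul_of_nonpos_left hV hc]

lemma le_lowOrder {b x U V : ℝ} (hb : 0 ≤ b) (hb' : b ≤ 1 / 5) (hx : 0 ≤ x) (hU : 0 ≤ U)
    (hV : V ≤ U ^ 2) (hV' : (1 + 2 * b - 2 * b ^ 2) * U ^ 2 ≤ (1 + 2 * b) * V)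
    (hU1 : x ≤ 1 → U ≤ 1 + 41 / 50 * b) (hU2 : 1 ≤ x → 1 ≤ U)
    (hU3 : 1 ≤ x → U ≤ 1 + b * (7 / 6 * x - 1 / 3)) :
    (x ≤ 3 / 2 → b * x ^ 3 / 7 * (2 * (1 + b) * (2 + b) * (1 + 2 * b)) ≤ lowOrder b x U V) ∧
      (3 / 2 ≤ x → 0 ≤ lowOrder b x U V) := by
  have key (hx : x ≤ 2) : (1 - 2 * b) * x ≤ 2 + 2 * b := by nlinarith
  constructor
  · intro hx'
    rcases le_total x 1 with h1 | h1
    · refine le_lowOrder_of_le_endpoints hb hx (key (by linarith)) hU (hU1 h1) hV ?_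
        (lowOrder_upper_le_one hb hb' hx h1)
      have h3 : x ^ 3 ≤ 1 := pow_le_one₀ hx h1
      have h4 : b * x ^ 3 ≤ 1 / 5 * 1 := by gcongr
      have h5 : 0 ≤ (3 - 3 * x + x ^ 2 / 2 - b * x ^ 3 / 7) * (2 * (1 + b) * (2 + b) * (1 + 2 * b))
          :=
        mul_nonneg (by nlinarith) (by positivity)
      unfold lowOrder
      linarith
    · exact le_lowOrder_of_le_endpoints hb hx (key (by linarith)) (hU2 h1) (hU3 h1) hV
        (by simpa using lowOrder_one_le_three_halves hb hb' h1 hx')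
        (lowOrder_tangent_le_three_halves hb hb' h1 hx')
  · intro hx'
    have h1 : 1 ≤ x := by linarith
    rcases le_total (2 + 2 * b) ((1 - 2 * b) * x) with h2 | h2
    · exact lowOrder_nonneg_large hb hb' h2 (hU2 h1) hV'
    · have h4 : x ≤ 4 := by nlinarith
      refine le_lowOrder_of_le_endpoints hb hx h2 (hU2 h1) (hU3 h1) hV ?_
        (lowOrder_tangent_le_four hb hb' hx' h4)
      rw [one_pow]
      rcases le_total x (5 / 2) with h5 | h5
      · exact lowOrder_one_le_five_halves hb hb' hx' h5
      · exact lowOrder_one_le_four hb hb' h5 h4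

lemma Real.Gamma_one_add_le_one {b : ℝ} (hb : 0 ≤ b) (hb' : b ≤ 1) : Real.Gamma (1 + b) ≤ 1 := by
  have h := Real.convexOn_Gamma.2 (x := 1) (y := 2) (by simp) (by simp) (sub_nonneg.2 hb') hb
    (sub_add_cancel 1 b)
  simp only [smul_eq_mul, Real.Gamma_one, Real.Gamma_two] at h
  rw [show (1 - b) * 1 + b * 2 = 1 + b by ring] at h
  linarith

lemma Real.one_le_mul_Gamma_one_add {b : ℝ} (hb : 0 < b) :
    1 ≤ (1 + 41 / 50 * b) * Real.Gamma (1 + b) := by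
  have hG : Real.Gamma (3 + b) = (2 + b) * ((1 + b) * Real.Gamma (1 + b)) := by
    rw [show 3 + b = (2 + b) + 1 by ring, Real.Gamma_add_one (by positivity),
      show 2 + b = (1 + b) + 1 by ring, Real.Gamma_add_one (by positivity)]
  have h := Real.BohrMollerup.f_add_nat_ge (f := Real.log ∘ Real.Gamma) (n := 3) (x := b)
    Real.convexOn_log_Gamma (fun {y} hy => by
      simp only [Function.comp]
      rw [Real.Gamma_add_one hy.ne', Real.log_mul hy.ne' (Real.Gamma_pos_of_pos hy).ne', add_comm])
    (by norm_num) hb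
  have h3 : Real.Gamma 3 = 2 := by
    rw [show (3 : ℝ) = 2 + 1 by norm_num, Real.Gamma_add_one two_ne_zero, Real.Gamma_two, mul_one]
  simp only [Function.comp, Nat.cast_ofNat, h3] at h
  norm_num at h
  have h4 := Real.log_two_gt_d9
  have h5 : Real.exp (Real.log 2 + b * Real.log 2) ≤ Real.Gamma (3 + b) := by
    rwa [← Real.le_log_iff_exp_le (Real.Gamma_pos_of_pos (by positivity))]
  rw [Real.exp_add, Real.exp_log two_pos] at h5
  have h6 := Real.add_one_le_exp (b * Real.log 2)
  have h7 : 2 * (1 + 69 / 100 * b) ≤ (2 + b) * ((1 + b) * Real.Gamma (1 + b)) := by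
    rw [← hG]
    nlinarith
  have h8 := mul_le_mul_of_nonneg_left h7 (by positivity : 0 ≤ 1 + 41 / 50 * b)
  refine le_of_mul_le_mul_left ?_ (by positivity : 0 < (2 + b) * (1 + b))
  nlinarith

lemma Real.Gamma_one_add_sq_le {b : ℝ} (hb : 0 ≤ b) :
    Real.Gamma (1 + b) ^ 2 ≤ Real.Gamma (1 + 2 * b) := by
  have h := Real.Gamma_mul_add_mul_le_rpow_Gamma_mul_rpow_Gamma (s := 1) (t := 1 + 2 * b)
    (a := 1 / 2) (b := 1 / 2) one_pos (by positivity) (by norm_num) (by norm_num) (by norm_num)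
  rw [show 1 / 2 * 1 + 1 / 2 * (1 + 2 * b) = 1 + b by ring, Real.Gamma_one, Real.one_rpow,
    one_mul, ← Real.sqrt_eq_rpow] at h
  have h0 : 0 ≤ Real.Gamma (1 + b) := (Real.Gamma_pos_of_pos (by positivity)).le
  exact (Real.le_sqrt h0 (Real.Gamma_pos_of_pos (by positivity)).le).1 h

lemma prod_sq_mul_le {b : ℝ} (hb : 0 ≤ b) (n : ℕ) :
    (1 - b ^ 2 * (1 / (b + 1 / 2) - 1 / (b + n + 1 / 2))) * (∏ j ∈ Finset.range n, (1 + b + j)) ^ 2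
        ≤
      (∏ j ∈ Finset.range n, (1 + j : ℝ)) * ∏ j ∈ Finset.range n, (1 + 2 * b + j) := by
  induction n with
  | zero => simp
  | succ n ih =>
    simp only [Finset.prod_range_succ]
    have hq : (1 - b ^ 2 * (1 / (b + 1 / 2) - 1 / (b + (n + 1 : ℕ) + 1 / 2))) * (1 + b + n) ^ 2 ≤
        (1 - b ^ 2 * (1 / (b + 1 / 2) - 1 / (b + n + 1 / 2))) * ((1 + n) * (1 + 2 * b + n)) := by
      have h1 : 1 / (b + n + 1 / 2) ≤ 1 / (b + 1 / 2) := by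
        apply one_div_le_one_div_of_le (by positivity)
        linarith [(Nat.cast_nonneg n : (0:ℝ) ≤ n)]
      have h2 : b ^ 2 * (1 / (b + n + 1 / 2) - 1 / (b + (n + 1 : ℕ) + 1 / 2)) * (1 + b + n) ^ 2 =
          b ^ 2 * ((1 + b + n) ^ 2 / ((1 + b + n) ^ 2 - 1 / 4)) := by
        have h3 : b + n + 1 / 2 ≠ 0 := by positivity
        have h4 : b + (n + 1 : ℕ) + 1 / 2 ≠ 0 := by positivity
        have h5 : (1 + b + n) ^ 2 - 1 / 4 = (b + n + 1 / 2) * (b + (n + 1 : ℕ) + 1 / 2) := by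
          push_cast; ring
        rw [h5]
        field_simp
        push_cast
        ring
      have h6 : 1 ≤ (1 + b + n) ^ 2 / ((1 + b + n) ^ 2 - 1 / 4) := by
        rw [one_le_div]
        · linarith
        · nlinarith [(Nat.cast_nonneg n : (0:ℝ) ≤ n)]
      have h7 := mul_le_mul_of_nonneg_left h6 (sq_nonneg b)
      have h8 := mul_nonneg (sq_nonneg b) (mul_nonneg (sq_nonneg b) (sub_nonneg.2 h1))
      nlinarith
    have hP : 0 ≤ (∏ j ∈ Finset.range n, (1 + b + j)) ^ 2 := sq_nonneg _
    calc _ = ((1 - b ^ 2 * (1 / (b + 1 / 2) - 1 / (b + (n + 1 : ℕ) + 1 / 2))) * (1 + b + n) ^ 2) *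
          (∏ j ∈ Finset.range n, (1 + b + j)) ^ 2 := by ring
      _ ≤ ((1 - b ^ 2 * (1 / (b + 1 / 2) - 1 / (b + n + 1 / 2))) * ((1 + n) * (1 + 2 * b + n))) *
          (∏ j ∈ Finset.range n, (1 + b + j)) ^ 2 := mul_le_mul_of_nonneg_right hq hP
      _ = ((1 + n) * (1 + 2 * b + n)) * ((1 - b ^ 2 * (1 / (b + 1 / 2) - 1 / (b + n + 1 / 2))) *
          (∏ j ∈ Finset.range n, (1 + b + j)) ^ 2) := by ring
      _ ≤ ((1 + n) * (1 + 2 * b + n)) * ((∏ j ∈ Finset.range n, (1 + j : ℝ)) *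
          ∏ j ∈ Finset.range n, (1 + 2 * b + j)) := mul_le_mul_of_nonneg_left ih (by positivity)
      _ = _ := by ring

lemma Real.Gamma_one_add_two_mul_le {b : ℝ} (hb : 0 ≤ b) :
    (1 + 2 * b - 2 * b ^ 2) * Real.Gamma (1 + 2 * b) ≤ (1 + 2 * b) * Real.Gamma (1 + b) ^ 2 := by
  have h1 := ((Real.GammaSeq_tendsto_Gamma 1).mul (Real.GammaSeq_tendsto_Gamma
      (1 + 2 * b))).const_mul
    (1 + 2 * b - 2 * b ^ 2)
  have h2 := ((Real.GammaSeq_tendsto_Gamma (1 + b)).pow 2).const_mul (1 + 2 * b)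
  rw [Real.Gamma_one, one_mul] at h1
  refine le_of_tendsto_of_tendsto h1 h2 ?_
  filter_upwards [eventually_gt_atTop 0] with n hn
  have h := prod_sq_mul_le hb (n + 1)
  have hp : 0 < ∏ j ∈ Finset.range (n + 1), (1 + b + j) := Finset.prod_pos fun _ _ => by positivity
  have hp1 : 0 < ∏ j ∈ Finset.range (n + 1), (1 + j : ℝ) := Finset.prod_pos fun _ _ => by positivity
  have hp2 : 0 < ∏ j ∈ Finset.range (n + 1), (1 + 2 * b + j) :=
    Finset.prod_pos fun _ _ => by positivity
  have hq : 1 + 2 * b - 2 * b ^ 2 ≤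
      (1 + 2 * b) * (1 - b ^ 2 * (1 / (b + 1 / 2) - 1 / (b + (n + 1 : ℕ) + 1 / 2))) := by
    have : (1 + 2 * b) * (b ^ 2 * (1 / (b + 1 / 2))) = 2 * b ^ 2 := by field_simp; ring
    have : 0 ≤ (1 + 2 * b) * (b ^ 2 * (1 / (b + (n + 1 : ℕ) + 1 / 2))) := by positivity
    linarith
  have hn' : (0:ℝ) < n := by exact_mod_cast hn
  have hpow : (n:ℝ) ^ (1:ℝ) * (n:ℝ) ^ (1 + 2 * b) = ((n:ℝ) ^ (1 + b)) ^ 2 := by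
    rw [← Real.rpow_add hn', ← Real.rpow_natCast, ← Real.rpow_mul hn'.le]
    congr 1
    push_cast
    ring
  unfold Real.GammaSeq
  rw [div_mul_div_comm, div_pow, ← mul_div_assoc, ← mul_div_assoc,
    div_le_div_iff₀ (mul_pos hp1 hp2) (by positivity)]
  have hN : 0 ≤ ((n:ℝ) ^ (1 + b)) ^ 2 * (n.factorial : ℝ) ^ 2 := by positivity
  have h3 := (mul_le_mul_of_nonneg_right hq (sq_nonneg
      (∏ j ∈ Finset.range (n + 1), (1 + b + j)))).trans
    ((mul_assoc _ _ _).trans_le (mul_le_mul_of_nonneg_left h (by positivity)))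
  calc _ = (n:ℝ) ^ (1:ℝ) * (n:ℝ) ^ (1 + 2 * b) * (n.factorial : ℝ) ^ 2 * ((1 + 2 * b - 2 * b ^ 2) *
        (∏ j ∈ Finset.range (n + 1), (1 + b + j)) ^ 2) := by ring
    _ ≤ (n:ℝ) ^ (1:ℝ) * (n:ℝ) ^ (1 + 2 * b) * (n.factorial : ℝ) ^ 2 * ((1 + 2 * b) *
        ((∏ j ∈ Finset.range (n + 1), (1 + j : ℝ)) *
          ∏ j ∈ Finset.range (n + 1), (1 + 2 * b + j))) := by
      rw [hpow]; exact mul_le_mul_of_nonneg_left h3 hN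
    _ = _ := by rw [hpow]; ring

lemma Real.Gamma_add_le_mul_rpow {s b : ℝ} (hs : 0 < s) (hb : 0 < b) (hb' : b < 1) :
    Real.Gamma (s + b) ≤ Real.Gamma s * s ^ b := by
  have h := Real.Gamma_mul_add_mul_le_rpow_Gamma_mul_rpow_Gamma (s := s) (t := s + 1)
    (a := 1 - b) (b := b) hs (by positivity) (sub_pos.2 hb') hb (by ring)
  have hG := Real.Gamma_pos_of_pos hs
  rw [Real.Gamma_add_one hs.ne', Real.mul_rpow hs.le hG.le, mul_left_comm,
    ← Real.rpow_add hG, sub_add_cancel, Real.rpow_one, mul_comm (s ^ b)] at h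
  convert h using 2
  ring

/-- The `n`-th term of the Kummer-type series `∑ (c - 3)ₙ x ^ (n + c - 1) / (Γ (c + n) n!)`. -/
noncomputable def kummerTerm (c x : ℝ) (n : ℕ) : ℝ :=
  (ascPochhammer ℝ n).eval (c - 3) * x ^ (c - 1 + n) / (Real.Gamma (c + n) * n.factorial)

lemma factorial_le_Gamma_add {c : ℝ} (hc : 1 ≤ c) {n : ℕ} (hn : 1 ≤ n) :
    (n.factorial : ℝ) ≤ Real.Gamma (c + n) := by
  have hn' : (1 : ℝ) ≤ n := by exact_mod_cast hn
  rw [← Real.Gamma_nat_eq_factorial]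
  exact Real.Gamma_strictMonoOn_Ici.monotoneOn (by simp; linarith) (by simp; linarith) (by linarith)

lemma abs_ascPochhammer_eval_le {y : ℝ} (hy : |y| ≤ 2) (n : ℕ) :
    |(ascPochhammer ℝ n).eval y| ≤ (n + 1).factorial := by
  induction n with
  | zero => simp
  | succ n ih =>
    rw [ascPochhammer_succ_eval, abs_mul, Nat.factorial_succ, mul_comm]
    push_cast
    gcongr
    calc |y + n| ≤ |y| + |(n:ℝ)| := abs_add_le _ _
      _ ≤ 2 + n := by gcongr; simp
      _ = n + 1 + 1 := by ring

lemma summable_kummerTerm {c x : ℝ} (hc : 1 ≤ c) (hc' : c ≤ 5) (hx : 0 < x) :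
    Summable fun n => |kummerTerm c x n| := by
  rw [← summable_nat_add_iff 1]
  have hs := (((Real.summable_pow_div_factorial (2 * x)).mul_left (x ^ (c - 1)))).comp_injective
    (add_left_injective 1)
  refine Summable.of_nonneg_of_le (fun _ => abs_nonneg _) (fun n => ?_) hs
  have hg := factorial_le_Gamma_add hc (n := n + 1) (by omega)
  have hg0 : 0 < Real.Gamma (c + (n + 1 : ℕ)) := Real.Gamma_pos_of_pos (by positivity)
  have hP := abs_ascPochhammer_eval_le (y := c - 3) (abs_le.2 ⟨by linarith, by linarith⟩) (n + 1)
  have h2 : ((n + 1 + 1 : ℕ) : ℝ) ≤ 2 ^ (n + 1) := by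
    exact_mod_cast Nat.lt_two_pow_self
  simp only [Function.comp, kummerTerm]
  rw [abs_div, abs_mul, abs_of_pos (by positivity : 0 < x ^ (c - 1 + (n + 1 : ℕ))),
    abs_of_pos (by positivity : 0 < Real.Gamma (c + (n + 1 : ℕ)) * ((n + 1).factorial : ℝ)),
    div_le_iff₀ (by positivity), Real.rpow_add_natCast hx.ne', mul_pow]
  calc _ ≤ ((n + 1 + 1).factorial : ℝ) * (x ^ (c - 1) * x ^ (n + 1)) := by gcongr
    _ = ((n + 1 + 1 : ℕ) : ℝ) * (n + 1).factorial * (x ^ (c - 1) * x ^ (n + 1)) := by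
      rw [Nat.factorial_succ (n + 1)]; push_cast; ring
    _ ≤ 2 ^ (n + 1) * Real.Gamma (c + (n + 1 : ℕ)) * (x ^ (c - 1) * x ^ (n + 1)) := by gcongr
    _ = _ := by field_simp

lemma kummerTerm_succ {c x : ℝ} (hc : 0 < c) (hx : 0 < x) (n : ℕ) :
    kummerTerm c x (n + 1) = kummerTerm c x n * ((c - 3 + n) * x / ((c + n) * (n + 1))) := by
  have h : c - 1 + ((n + 1 : ℕ) : ℝ) = c - 1 + n + 1 := by push_cast; ring
  have h' : c + ((n + 1 : ℕ) : ℝ) = c + n + 1 := by push_cast; ring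
  have hg : Real.Gamma (c + n) ≠ 0 := (Real.Gamma_pos_of_pos (by positivity)).ne'
  unfold kummerTerm
  rw [ascPochhammer_succ_eval, h, h', Real.rpow_add_one hx.ne', Real.Gamma_add_one (by positivity),
    Nat.factorial_succ]
  push_cast
  field_simp

lemma kummerTerm_zero (c x : ℝ) : kummerTerm c x 0 = x ^ (c - 1) / Real.Gamma c := by
  simp [kummerTerm]

lemma kummerTerm_tail_nonneg {b x : ℝ} (hb : 0 < b) (hb' : b ≤ 1 / 5) (hx : 0 < x) (n : ℕ) :
    0 ≤ kummerTerm (1 + b) x (n + 3) := by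
  induction n with
  | zero =>
    rw [kummerTerm_succ (by positivity) hx, kummerTerm_succ (by positivity) hx,
      kummerTerm_succ (by positivity) hx, kummerTerm_zero]
    have : 0 < Real.Gamma (1 + b) := Real.Gamma_pos_of_pos (by positivity)
    have h1 : 0 ≤ (1 + b - 3 + (0 : ℕ)) * (1 + b - 3 + (0 + 1 : ℕ)) := by
      push_cast; nlinarith
    have h2 : 0 ≤ (1 + b - 3 + (0 + 2 : ℕ)) := by push_cast; linarith
    calc (0 : ℝ) ≤ x ^ (1 + b - 1) / Real.Gamma (1 + b) *
        (((1 + b - 3 + (0 : ℕ)) * (1 + b - 3 + (0 + 1 : ℕ))) * x * x /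
            ((1 + b + (0 : ℕ)) * ((0 : ℕ) + 1) *
          ((1 + b + (0 + 1 : ℕ)) * ((0 + 1 : ℕ) + 1)))) * ((1 + b - 3 + (0 + 2 : ℕ)) * x /
          ((1 + b + (0 + 2 : ℕ)) * ((0 + 2 : ℕ) + 1))) := by positivity
      _ = _ := by field_simp
  | succ n ih =>
    rw [kummerTerm_succ (by positivity) hx]
    have : 0 ≤ 1 + b - 3 + (n + 3 : ℕ) := by push_cast; linarith [(n.cast_nonneg : (0:ℝ) ≤ n)]
    positivity

lemma kummerTerm_tail_nonpos {b x : ℝ} (hb : 0 < b) (hb' : b ≤ 1 / 5) (hx : 0 < x) (n : ℕ) :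
    kummerTerm (2 + 2 * b) x (n + 1) ≤ 0 := by
  induction n with
  | zero =>
    rw [kummerTerm_succ (by positivity) hx, kummerTerm_zero]
    have : 0 < Real.Gamma (2 + 2 * b) := Real.Gamma_pos_of_pos (by positivity)
    refine mul_nonpos_of_nonneg_of_nonpos (by positivity)
      (div_nonpos_of_nonpos_of_nonneg (mul_nonpos_of_nonpos_of_nonneg ?_ hx.le) (by positivity))
    push_cast; linarith
  | succ n ih =>
    rw [kummerTerm_succ (by positivity) hx]
    have : 0 ≤ 2 + 2 * b - 3 + (n + 1 : ℕ) := by push_cast; linarith [(n.cast_nonneg : (0:ℝ) ≤ n)]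
    exact mul_nonpos_of_nonpos_of_nonneg ih (by positivity)

lemma two_mul_kummerTerm_add_nonpos {b x : ℝ} (hb : 0 < b) (hb' : b ≤ 1 / 5) (hx : 3 / 2 ≤ x)
    (n : ℕ) : 2 * kummerTerm (1 + b) x (n + 3) + kummerTerm (2 + 2 * b) x (n + 2) ≤ 0 := by
  have hx0 : 0 < x := by linarith
  induction n with
  | zero =>
    have hG : 0 < Real.Gamma (4 + b) := Real.Gamma_pos_of_pos (by positivity)
    have hG2 : 0 < Real.Gamma (4 + 2 * b) := Real.Gamma_pos_of_pos (by positivity)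
    have h1 : Real.Gamma (4 + 2 * b) ≤ Real.Gamma (4 + b) * (4 + b) ^ b := by
      convert Real.Gamma_add_le_mul_rpow (s := 4 + b) (by positivity) hb (by linarith) using 2
      ring
    have h2 : (14 / 5 : ℝ) ^ b ≤ 5 / 4 := calc
      (14 / 5 : ℝ) ^ b ≤ (14 / 5) ^ (1 / 5 : ℝ) := Real.rpow_le_rpow_of_exponent_le (by norm_num)
          hb'
      _ ≤ ((5 / 4) ^ (5 : ℝ)) ^ (1 / 5 : ℝ) := by
        apply Real.rpow_le_rpow <;> norm_num
      _ = 5 / 4 := by rw [← Real.rpow_mul (by norm_num)]; norm_num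
    have h3 : (4 + b) ^ b ≤ 5 / 4 * x ^ b := calc
      (4 + b) ^ b ≤ (14 / 5 * x) ^ b := Real.rpow_le_rpow (by positivity) (by linarith) hb.le
      _ = (14 / 5) ^ b * x ^ b := Real.mul_rpow (by norm_num) hx0.le
      _ ≤ _ := by gcongr
    have hX : 0 < x ^ b := by positivity
    have h4 : (2 - b) * (1 - b) * Real.Gamma (4 + 2 * b) ≤
        3 * (1 - 2 * b) * x ^ b * Real.Gamma (4 + b) := by
      have h5 : 0 ≤ (2 - b) * (1 - b) := mul_nonneg (by linarith) (by linarith)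
      calc _ ≤ (2 - b) * (1 - b) * (Real.Gamma (4 + b) * (5 / 4 * x ^ b)) :=
            mul_le_mul_of_nonneg_left (h1.trans (by gcongr)) h5
        _ = ((2 - b) * (1 - b) * (5 / 4)) * (x ^ b * Real.Gamma (4 + b)) := by ring
        _ ≤ (3 * (1 - 2 * b)) * (x ^ b * Real.Gamma (4 + b)) := by
          refine mul_le_mul_of_nonneg_right ?_ (by positivity)
          nlinarith
        _ = _ := by ring
    have e1 : kummerTerm (1 + b) x 3 =
        b * x ^ b * x ^ 3 * ((2 - b) * (1 - b) / (6 * Real.Gamma (4 + b))) := by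
      unfold kummerTerm
      rw [Real.rpow_add_natCast hx0.ne', show 1 + b + (3 : ℕ) = 4 + b by push_cast; ring,
        show 1 + b - 1 = b by ring]
      simp only [ascPochhammer_succ_eval, ascPochhammer_zero, Polynomial.eval_one, Nat.factorial]
      push_cast
      field_simp
      ring
    have e2 : kummerTerm (2 + 2 * b) x 2 =
        - (b * x ^ b * x ^ 3 * ((1 - 2 * b) * x ^ b / Real.Gamma (4 + 2 * b))) := by
      unfold kummerTerm
      rw [Real.rpow_add_natCast hx0.ne', show 2 + 2 * b + (2 : ℕ) = 4 + 2 * b by push_cast; ring,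
        show 2 + 2 * b - 1 = b + b + (1 : ℕ) by push_cast; ring, Real.rpow_add_natCast hx0.ne',
        Real.rpow_add hx0]
      simp only [ascPochhammer_succ_eval, ascPochhammer_zero, Polynomial.eval_one, Nat.factorial]
      push_cast
      field_simp
      ring
    rw [e1, e2]
    have h6 : 2 * ((2 - b) * (1 - b) / (6 * Real.Gamma (4 + b))) ≤
        (1 - 2 * b) * x ^ b / Real.Gamma (4 + 2 * b) := by
      rw [← mul_div_assoc, div_le_div_iff₀ (by positivity) hG2]
      linarith
    have := mul_le_mul_of_nonneg_left h6 (by positivity : 0 ≤ b * x ^ b * x ^ 3)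
    linarith
  | succ n ih =>
    have hn : (0 : ℝ) ≤ n := n.cast_nonneg
    have e1 := kummerTerm_succ (c := 1 + b) (by positivity) hx0 (n + 3)
    have e2 := kummerTerm_succ (c := 2 + 2 * b) (by positivity) hx0 (n + 2)
    rw [show n + 1 + 3 = n + 3 + 1 by ring, show n + 1 + 2 = n + 2 + 1 by ring, e1, e2]
    have hA := kummerTerm_tail_nonneg hb hb' hx0 n
    have hB := kummerTerm_tail_nonpos hb hb' hx0 (n + 1)
    have h : (1 + b - 3 + (n + 3 : ℕ)) * x / ((1 + b + (n + 3 : ℕ)) * ((n + 3 : ℕ) + 1)) ≤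
        (2 + 2 * b - 3 + (n + 2 : ℕ)) * x / ((2 + 2 * b + (n + 2 : ℕ)) * ((n + 2 : ℕ) + 1)) := by
      rw [mul_div_right_comm, mul_div_right_comm]
      refine mul_le_mul_of_nonneg_right ?_ hx0.le
      rw [div_le_div_iff₀ (by positivity) (by positivity)]
      push_cast
      nlinarith [mul_nonneg hn hb.le, mul_nonneg (mul_nonneg hn hn) hb.le,
        mul_nonneg (mul_nonneg hn hb.le) hb.le, mul_nonneg hb.le hb.le]
    have h0 : 0 ≤ (1 + b - 3 + (n + 3 : ℕ)) * x / ((1 + b + (n + 3 : ℕ)) * ((n + 3 : ℕ) + 1)) := by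
      have : 0 ≤ 1 + b - 3 + (n + 3 : ℕ) := by push_cast; linarith
      positivity
    nlinarith [mul_le_mul_of_nonneg_right ih h0, mul_le_mul_of_nonpos_left h hB]

lemma kummerTerm_le_geometric {b x : ℝ} (hb : 0 < b) (hb' : b ≤ 1 / 5) (hx : 0 < x)
    (hx' : x ≤ 3 / 2) (n : ℕ) :
    kummerTerm (1 + b) x (n + 3) ≤ 11 / 180 * b * x ^ 3 * (1 / 7) ^ n := by
  induction n with
  | zero =>
    have h6 : (6 : ℝ) ≤ Real.Gamma (1 + b + (3 : ℕ)) := by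
      simpa [Nat.factorial] using factorial_le_Gamma_add (c := 1 + b) (by linarith) (n := 3)
        (by norm_num)
    have hX : x ^ b ≤ 11 / 10 := calc
      x ^ b ≤ (1 + 1 / 2) ^ b := Real.rpow_le_rpow hx.le (by linarith) hb.le
      _ ≤ 1 + b * (1 / 2) :=
        rpow_one_add_le_one_add_mul_self (by norm_num) hb.le (by linarith)
      _ ≤ 11 / 10 := by linarith
    have e1 : kummerTerm (1 + b) x 3 =
        ((2 - b) * (1 - b)) * (b * x ^ 3) * x ^ b / (Real.Gamma (1 + b + (3 : ℕ)) * 6) := by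
      unfold kummerTerm
      rw [Real.rpow_add_natCast hx.ne', show 1 + b - 1 = b by ring]
      simp only [ascPochhammer_succ_eval, ascPochhammer_zero, Polynomial.eval_one, Nat.factorial]
      push_cast
      ring
    have h2 : (2 - b) * (1 - b) ≤ 2 := by nlinarith
    have h0 : 0 ≤ (2 - b) * (1 - b) := mul_nonneg (by linarith) (by linarith)
    rw [zero_add, e1, pow_zero, mul_one]
    calc _ ≤ 2 * (b * x ^ 3) * (11 / 10) / (6 * 6) := by gcongr
      _ = _ := by ring
  | succ n ih =>
    have hn : (0 : ℝ) ≤ n := n.cast_nonneg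
    have e1 := kummerTerm_succ (c := 1 + b) (by positivity) hx (n + 3)
    rw [show n + 1 + 3 = n + 3 + 1 by ring, e1,
      pow_succ (1 / 7 : ℝ), ← mul_assoc]
    have h0 : 0 ≤ 1 + b - 3 + (n + 3 : ℕ) := by push_cast; linarith
    refine mul_le_mul ih ?_ (by positivity) (by positivity)
    rw [div_le_div_iff₀ (by positivity) (by norm_num), one_mul]
    calc _ ≤ (1 + b - 3 + (n + 3 : ℕ)) * (3 / 2) * 7 := by gcongr
      _ ≤ _ := by
        push_cast
        nlinarith [sq_nonneg ((n : ℝ) - 5 / 4), mul_nonneg hn hb.le]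

lemma kummer_combination_nonneg {b x : ℝ} (hb : 0 < b) (hb' : b ≤ 1 / 5) (hx : 0 < x) :
    0 ≤ 3 - 3 * x + x ^ 2 / 2 - 2 * ∑' n, kummerTerm (1 + b) x n
      - ∑' n, kummerTerm (2 + 2 * b) x n := by
  have hs1 := (summable_kummerTerm (c := 1 + b) (by linarith) (by linarith) hx).of_abs
  have hs2 := (summable_kummerTerm (c := 2 + 2 * b) (by linarith) (by linarith) hx).of_abs
  have ht1 := (summable_nat_add_iff 3).2 hs1
  have ht2 := (summable_nat_add_iff 2).2 hs2
  have hG1 : 0 < Real.Gamma (1 + b) := Real.Gamma_pos_of_pos (by positivity)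
  have hG2 : 0 < Real.Gamma (1 + 2 * b) := Real.Gamma_pos_of_pos (by positivity)
  have hX : 0 < x ^ b := by positivity
  set U := x ^ b / Real.Gamma (1 + b) with hU
  set V := (x ^ b) ^ 2 / Real.Gamma (1 + 2 * b) with hV
  have eD : lowOrder b x U V = (2 * (1 + b) * (2 + b) * (1 + 2 * b)) *
      (3 - 3 * x + x ^ 2 / 2 - 2 * ∑ n ∈ Finset.range 3, kummerTerm (1 + b) x n
      - ∑ n ∈ Finset.range 2, kummerTerm (2 + 2 * b) x n) := by
    have h0 : kummerTerm (1 + b) x 0 = U := by rw [kummerTerm_zero, add_sub_cancel_left]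
    have h0' : kummerTerm (2 + 2 * b) x 0 = x * V / (1 + 2 * b) := by
      rw [kummerTerm_zero, hV, show 2 + 2 * b - 1 = b + b + 1 by ring, Real.rpow_add_one hx.ne',
        Real.rpow_add hx, show 2 + 2 * b = 1 + 2 * b + 1 by ring, Real.Gamma_add_one
            (by positivity)]
      field_simp
    simp only [Finset.sum_range_succ, Finset.sum_range_zero, zero_add]
    rw [kummerTerm_succ (n := 1) (by positivity) hx, kummerTerm_succ (n := 0) (by positivity) hx,
      h0]
    have h1' : kummerTerm (2 + 2 * b) x 1 = _ := kummerTerm_succ (n := 0) (by positivity) hx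
    rw [h1', h0']
    unfold lowOrder
    push_cast
    field_simp
    ring
  have hle := le_lowOrder (b := b) (x := x) (U := U) (V := V) hb.le hb' hx.le (by positivity)
    (by
      rw [hU, hV, div_pow]
      exact div_le_div_of_nonneg_left (by positivity) (by positivity)
        (Real.Gamma_one_add_sq_le hb.le))
    (by
      rw [hU, hV, div_pow, ← mul_div_assoc, ← mul_div_assoc, div_le_div_iff₀ (by positivity) hG2]
      have := mul_le_mul_of_nonneg_right (Real.Gamma_one_add_two_mul_le hb.le)
        (sq_nonneg (x ^ b))
      linarith)
    (fun h => by
      rw [hU, div_le_iff₀ hG1]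
      exact (Real.rpow_le_one hx.le h hb.le).trans (Real.one_le_mul_Gamma_one_add hb))
    (fun h => by
      rw [hU, le_div_iff₀ hG1, one_mul]
      exact (Real.Gamma_one_add_le_one hb.le (by linarith)).trans (Real.one_le_rpow h hb.le))
    (fun h => by
      rw [hU, div_le_iff₀ hG1]
      have h1 : x ^ b ≤ 1 + b * (x - 1) := by
        have := rpow_one_add_le_one_add_mul_self (s := x - 1) (p := b) (by linarith) hb.le
          (by linarith)
        rwa [add_sub_cancel] at this
      have h2 := Real.one_le_mul_Gamma_one_add hb
      have h3 : 0 ≤ b * (x - 1) := mul_nonneg hb.le (by linarith)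
      calc x ^ b ≤ (1 + b * (x - 1)) * 1 := by linarith
        _ ≤ (1 + b * (x - 1)) * ((1 + 41 / 50 * b) * Real.Gamma (1 + b)) := by gcongr
        _ = ((1 + b * (x - 1)) * (1 + 41 / 50 * b)) * Real.Gamma (1 + b) := by ring
        _ ≤ _ := by gcongr; nlinarith)
  rw [← hs1.sum_add_tsum_nat_add 3, ← hs2.sum_add_tsum_nat_add 2]
  have hD : 0 < 2 * (1 + b) * (2 + b) * (1 + 2 * b) := by positivity
  rcases le_total x (3 / 2) with h | h
  · have h1 := hle.1 h
    rw [eD, mul_comm, mul_le_mul_iff_right₀ hD] at h1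
    have hgeo := (hasSum_geometric_of_lt_one (r := (1 / 7 : ℝ)) (by norm_num)
        (by norm_num)).mul_left
      (11 / 180 * b * x ^ 3)
    have h4 : ∑' n, kummerTerm (1 + b) x (n + 3) ≤ 11 / 180 * b * x ^ 3 * (1 - 1 / 7)⁻¹ := by
      rw [← hgeo.tsum_eq]
      exact ht1.tsum_le_tsum (kummerTerm_le_geometric hb hb' hx h) hgeo.summable
    have h5 : ∑' n, kummerTerm (2 + 2 * b) x (n + 2) ≤ 0 :=
      tsum_nonpos fun n => kummerTerm_tail_nonpos hb hb' hx (n + 1)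
    have : 0 < b * x ^ 3 := by positivity
    norm_num at h4
    linarith
  · have h1 := hle.2 h
    rw [eD] at h1
    have h1 := nonneg_of_mul_nonneg_right h1 hD
    have h2 : ∑' n, (2 * kummerTerm (1 + b) x (n + 3) + kummerTerm (2 + 2 * b) x (n + 2)) ≤ 0 :=
      tsum_nonpos (two_mul_kummerTerm_add_nonpos hb hb' h)
    rw [(ht1.mul_left 2).tsum_add ht2, tsum_mul_left] at h2
    linarith

/-- The Riemann–Liouville kernel `x ^ (c - 1) / Γ c` of fractional integration of order `c`. -/
noncomputable def rlKernel (c x : ℝ) : ℝ := x ^ (c - 1) / Real.Gamma c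

/-- The coefficients of `(1 + X) ^ (-3)`. -/
noncomputable def altTriangular (j : ℕ) : ℝ := (-1) ^ j * ((j + 1) * (j + 2) / 2)

lemma ascPochhammer_succ_eval_left (n : ℕ) (y : ℝ) :
    (ascPochhammer ℝ (n + 1)).eval y = y * (ascPochhammer ℝ n).eval (y + 1) := by
  simp [ascPochhammer_succ_left, Polynomial.eval_comp]

lemma sum_antidiagonal_choose_mul_ascPochhammer (b : ℝ) (j : ℕ) (c : ℝ) :
    ∑ p ∈ Finset.HasAntidiagonal.antidiagonal j, (j.choose p.1 : ℝ) *
        ((-1) ^ p.1 * (ascPochhammer ℝ p.1).eval b *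
      (ascPochhammer ℝ p.2).eval (c + p.1)) = (ascPochhammer ℝ j).eval (c - b) := by
  induction j generalizing c with
  | zero => simp
  | succ j ih =>
    rw [Finset.sum_antidiagonal_choose_succ_mul
      (fun n m => (-1 : ℝ) ^ n * (ascPochhammer ℝ n).eval b * (ascPochhammer ℝ m).eval (c + n)) j,
      ascPochhammer_succ_eval_left, sub_add_eq_add_sub, ← ih (c + 1), Finset.mul_sum,
      ← Finset.sum_add_distrib]
    refine Finset.sum_congr rfl fun p hp => ?_
    have hc : (j.choose p.2 : ℝ) = j.choose p.1 := by
      rw [← Finset.HasAntidiagonal.mem_antidiagonal.1 hp, Nat.choose_symm_add]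
    rw [hc, ascPochhammer_succ_eval_left, ascPochhammer_succ_eval]
    have h1 : c + 1 + (p.1 : ℝ) = c + p.1 + 1 := by ring
    have h2 : c + ((p.1 + 1 : ℕ) : ℝ) = c + p.1 + 1 := by push_cast; ring
    rw [h1, h2]
    ring

lemma Real.Gamma_add_natCast {c : ℝ} (hc : 0 < c) (m : ℕ) :
    Real.Gamma (c + m) = Real.Gamma c * (ascPochhammer ℝ m).eval c := by
  induction m with
  | zero => simp
  | succ m ih =>
    rw [Nat.cast_succ, ← add_assoc, Real.Gamma_add_one (by positivity), ih, ascPochhammer_succ_eval]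
    ring

lemma ascPochhammer_eval_three (j : ℕ) :
    (ascPochhammer ℝ j).eval 3 = j.factorial * ((j + 1) * (j + 2) / 2) := by
  have h := factorial_mul_ascPochhammer ℝ 2 j
  rw [show (2 + j).factorial = (j + 2) * ((j + 1) * j.factorial) by
    rw [add_comm, Nat.factorial_succ, Nat.factorial_succ]] at h
  norm_num at h
  linarith

lemma sum_antidiagonal_kummerTerm {c x : ℝ} (hc : 0 < c) (hx : 0 < x) (j : ℕ) :
    ∑ p ∈ Finset.HasAntidiagonal.antidiagonal j, kummerTerm c x p.1 * ((-x) ^ p.2 / p.2.factorial) =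
      altTriangular j * rlKernel (c + j) x := by
  have h := sum_antidiagonal_choose_mul_ascPochhammer (c - 3) j c
  rw [sub_sub_cancel, ascPochhammer_eval_three] at h
  have hG : 0 < Real.Gamma (c + j) := Real.Gamma_pos_of_pos (by positivity)
  have e : altTriangular j * rlKernel (c + j) x = (-1) ^ j * x ^ (c - 1) * x ^ j /
      (Real.Gamma (c + j) * j.factorial) * (j.factorial * ((j + 1) * (j + 2) / 2)) := by
    unfold altTriangular rlKernel
    rw [show c + j - 1 = c - 1 + j by ring, Real.rpow_add_natCast hx.ne']
    field_simp
  rw [e, ← h, Finset.mul_sum]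
  refine Finset.sum_congr rfl fun p hp => ?_
  have hp' := Finset.HasAntidiagonal.mem_antidiagonal.1 hp
  have hG' : 0 < Real.Gamma (c + p.1) := Real.Gamma_pos_of_pos (by positivity)
  have hGG : Real.Gamma (c + j) = Real.Gamma (c + p.1) * (ascPochhammer ℝ p.2).eval (c + p.1) := by
    rw [← Real.Gamma_add_natCast (by positivity), ← hp', Nat.cast_add, add_assoc]
  have hP : 0 < (ascPochhammer ℝ p.2).eval (c + p.1) := ascPochhammer_pos _ _ (by positivity)
  have hch : (j.choose p.1 : ℝ) * (p.1.factorial * p.2.factorial) = j.factorial := by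
    rw [← hp', ← mul_assoc, Nat.choose_symm_add]
    exact_mod_cast Nat.add_choose_mul_factorial_mul_factorial p.1 p.2
  have hj : (j.factorial : ℝ) ≠ 0 := by positivity
  have hch0 : (j.choose p.1 : ℝ) ≠ 0 := left_ne_zero_of_mul (hch ▸ hj)
  have hsgn : (-1 : ℝ) ^ p.2 = (-1) ^ j * (-1) ^ p.1 := by
    rw [← hp', ← pow_add, show p.1 + p.2 + p.1 = p.2 + 2 * p.1 by ring, pow_add, pow_mul]
    simp
  have hxj : x ^ j = x ^ p.1 * x ^ p.2 := by rw [← hp', pow_add]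
  unfold kummerTerm
  rw [Real.rpow_add_natCast hx.ne', hGG, neg_pow, hsgn, hxj, ← hch]
  field_simp

lemma hasSum_pow_div_factorial (x : ℝ) :
    HasSum (fun n : ℕ => x ^ n / (n.factorial : ℝ)) (Real.exp x) := by
  rw [Real.exp_eq_exp_ℝ]
  exact NormedSpace.expSeries_div_hasSum_exp x

lemma tsum_altTriangular_mul_rlKernel {c x : ℝ} (hc : 1 ≤ c) (hc' : c ≤ 5) (hx : 0 < x) :
    ∑' j : ℕ, altTriangular j * rlKernel (c + j) x = Real.exp (-x) * ∑' n, kummerTerm c x n := by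
  have hs : Summable fun n => ‖kummerTerm c x n‖ := summable_kummerTerm hc hc' hx
  rw [mul_comm, ← (hasSum_pow_div_factorial (-x)).tsum_eq,
    tsum_mul_tsum_eq_tsum_sum_antidiagonal_of_summable_norm hs
      (Real.summable_pow_div_factorial (-x)).norm]
  exact tsum_congr fun j => (sum_antidiagonal_kummerTerm (by linarith) hx j).symm

lemma tsum_altTriangular_mul_rlKernel_pos {c x : ℝ} (hc : 3 ≤ c) (hc' : c ≤ 5) (hx : 0 < x) :
    0 < ∑' j : ℕ, altTriangular j * rlKernel (c + j) x := by
  rw [tsum_altTriangular_mul_rlKernel (by linarith) hc' hx]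
  refine mul_pos (Real.exp_pos _) ?_
  have hs := (summable_kummerTerm (c := c) (by linarith) hc' hx).of_abs
  have hn : ∀ n, 0 ≤ kummerTerm c x n := fun n => by
    induction n with
    | zero =>
      rw [kummerTerm_zero]
      have : 0 < Real.Gamma c := Real.Gamma_pos_of_pos (by linarith)
      positivity
    | succ n ih =>
      rw [kummerTerm_succ (by linarith) hx]
      have : 0 ≤ c - 3 + n := by linarith [(n.cast_nonneg : (0:ℝ) ≤ n)]
      have : 0 < c + n := by linarith [(n.cast_nonneg : (0:ℝ) ≤ n)]
      positivity
  refine hs.tsum_pos hn 0 ?_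
  rw [kummerTerm_zero]
  have : 0 < Real.Gamma c := Real.Gamma_pos_of_pos (by linarith)
  positivity

lemma tsum_altTriangular_succ_mul_rlKernel (x : ℝ) :
    ∑' j : ℕ, altTriangular (j + 1) * rlKernel (1 + j) x =
      -(Real.exp (-x) * (3 - 3 * x + x ^ 2 / 2)) := by
  have h0 := hasSum_pow_div_factorial (-x)
  have shift (f : ℕ → ℝ) (s : ℝ) (h : HasSum (fun n => f n) s) :
      HasSum (fun n : ℕ => (-x) * (match n with | 0 => 0 | n + 1 => f n)) (-x * s) := by
    refine HasSum.mul_left _ ?_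
    rw [← hasSum_nat_add_iff' 1]
    simpa using h
  have h1 := shift _ _ h0
  have h2 := shift _ _ h1
  rw [← neg_eq_iff_eq_neg, ← tsum_neg]
  have h := ((h0.mul_left 3).add (h1.mul_left 3)).add (h2.mul_left (1 / 2))
  convert h.tsum_eq using 1
  · refine tsum_congr fun j => ?_
    unfold altTriangular rlKernel
    rw [add_sub_cancel_left, Real.rpow_natCast, add_comm (1 : ℝ), Real.Gamma_nat_eq_factorial]
    rcases j with _ | _ | j
    · norm_num
    · norm_num; ring
    · simp only [Nat.factorial_succ]
      rw [show (-x) ^ (j + 1 + 1) = (-1) ^ j * x ^ j * x ^ 2 by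
          rw [pow_add, pow_add, neg_pow]; ring,
        show (-x) ^ (j + 1) = - ((-1) ^ j * x ^ j * x) by rw [pow_add, neg_pow]; ring,
        show (-x) ^ j = (-1) ^ j * x ^ j by rw [neg_pow]]
      push_cast
      field_simp
      ring
  · ring

lemma factorial_le_Gamma_of_add_two_le {y : ℝ} {k : ℕ} (h : (k : ℝ) + 2 ≤ y) :
    (k.factorial : ℝ) ≤ Real.Gamma y := calc
  (k.factorial : ℝ) ≤ (k + 1).factorial := by exact_mod_cast Nat.factorial_le (Nat.le_succ k)
  _ = Real.Gamma (k + 2) := by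
    rw [← Real.Gamma_nat_eq_factorial]; push_cast; ring_nf
  _ ≤ Real.Gamma y := Real.Gamma_strictMonoOn_Ici.monotoneOn
    (by simp) (by simp; linarith [(k.cast_nonneg : (0 : ℝ) ≤ k)]) h

lemma rlKernel_nonneg {c x : ℝ} (hc : 0 ≤ c) (hx : 0 ≤ x) : 0 ≤ rlKernel c x :=
  div_nonneg (Real.rpow_nonneg hx _) (Real.Gamma_nonneg_of_nonneg hc)

lemma summable_mul_rlKernel {f : ℕ → ℝ} (hf : ∀ j, |f j| ≤ 4 ^ (j + 1)) {c x : ℝ} (hc : 1 ≤ c)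
    (hx : 0 < x) : Summable fun j : ℕ => ‖f j * rlKernel (c + j) x‖ := by
  rw [← summable_nat_add_iff 1]
  have hs := ((Real.summable_pow_div_factorial (4 * x)).comp_injective
    (add_left_injective 1)).mul_left (4 * x ^ (c - 1))
  refine Summable.of_nonneg_of_le (fun _ => norm_nonneg _) (fun j => ?_) hs
  rw [norm_mul, Real.norm_of_nonneg (rlKernel_nonneg (by positivity) hx.le), Real.norm_eq_abs]
  have hG := factorial_le_Gamma_add hc (n := j + 1) (by omega)
  unfold rlKernel
  rw [show c + (j + 1 : ℕ) - 1 = c - 1 + (j + 1 : ℕ) by ring, Real.rpow_add_natCast hx.ne']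
  calc _ ≤ 4 ^ (j + 1 + 1) * (x ^ (c - 1) * x ^ (j + 1) / ((j + 1).factorial : ℝ)) := by
        gcongr; exact hf _
    _ = _ := by simp only [Function.comp]; ring

lemma summable_prod_mul_rlKernel {f g : ℕ → ℝ} (hf : ∀ j, |f j| ≤ 4 ^ (j + 1))
    (hg : ∀ j, |g j| ≤ 4 ^ (j + 1)) {c α x : ℝ} (hc : 0 ≤ c) (hα : 1 ≤ α) (hx : 0 < x) :
    Summable fun p : ℕ × ℕ => ‖g p.1 * (f p.2 * rlKernel (c + p.2 + (2 + α + α * p.1)) x)‖ := by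
  have hs := ((Real.summable_pow_div_factorial (4 * x ^ α)).mul_of_nonneg
    (Real.summable_pow_div_factorial (4 * x)) (fun _ => by positivity)
    (fun _ => by positivity)).mul_left (16 * x ^ (c + 1 + α))
  refine Summable.of_nonneg_of_le (fun _ => norm_nonneg _) (fun p => ?_) hs
  rw [norm_mul, norm_mul, Real.norm_of_nonneg (rlKernel_nonneg (by positivity) hx.le),
    Real.norm_eq_abs, Real.norm_eq_abs]
  have hG : (p.1.factorial * p.2.factorial : ℝ) ≤
      Real.Gamma (c + p.2 + (2 + α + α * p.1)) := calc
    (p.1.factorial * p.2.factorial : ℝ) ≤ (p.1 + p.2).factorial := by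
      exact_mod_cast Nat.le_of_dvd (Nat.factorial_pos _)
        (Nat.factorial_mul_factorial_dvd_factorial_add _ _)
    _ ≤ _ := factorial_le_Gamma_of_add_two_le (by
      have : (p.1 : ℝ) ≤ α * p.1 := le_mul_of_one_le_left (Nat.cast_nonneg _) hα
      push_cast
      linarith)
  unfold rlKernel
  rw [show c + p.2 + (2 + α + α * p.1) - 1 = c + 1 + α + α * p.1 + p.2 by ring,
    Real.rpow_add_natCast hx.ne', Real.rpow_add hx, Real.rpow_mul hx.le, Real.rpow_natCast]
  calc _ ≤ 4 ^ (p.1 + 1) * (4 ^ (p.2 + 1) * (x ^ (c + 1 + α) * (x ^ α) ^ p.1 * x ^ p.2 /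
        (p.1.factorial * p.2.factorial : ℝ))) := by
        gcongr
        · exact hg _
        · exact hf _
    _ = _ := by
      field_simp
      ring

lemma summable_mul_rlKernel_mul {g : ℕ → ℝ} (hg : ∀ j, |g j| ≤ 4 ^ (j + 1)) {α x : ℝ}
    (hα : 1 ≤ α) (hx : 0 < x) :
    Summable fun n : ℕ => ‖g n * rlKernel (2 + α + α * n) x‖ := by
  have h := summable_prod_mul_rlKernel (f := fun _ => 1)
    (fun j => by rw [abs_one]; exact one_le_pow₀ (by norm_num)) hg le_rfl hα hx
  simpa [Function.comp_def] using h.comp_injective (Prod.mk_left_injective (β := ℕ) (0 : ℕ))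

lemma integrableOn_rlKernel_mul {a b x : ℝ} (ha : 1 ≤ a) (hb : 1 ≤ b) :
    IntegrableOn (fun s => rlKernel a (x - s) * rlKernel b s) (Set.Ioo 0 x) := by
  have h : Continuous fun s => rlKernel a (x - s) * rlKernel b s := by
    unfold rlKernel
    refine Continuous.mul (Continuous.div_const ?_ _) (Continuous.div_const ?_ _)
    · exact (continuous_const.sub continuous_id).rpow_const fun _ => Or.inr (by linarith)
    · exact continuous_id.rpow_const fun _ => Or.inr (by linarith)
  exact (h.continuousOn.integrableOn_Icc).mono_set Set.Ioo_subset_Icc_self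

lemma integral_rlKernel_mul {a b x : ℝ} (ha : 0 < a) (hb : 0 < b) (hx : 0 < x) :
    ∫ s in Set.Ioo 0 x, rlKernel a (x - s) * rlKernel b s = rlKernel (a + b) x := by
  have hGa := Real.Gamma_pos_of_pos ha
  have hGb := Real.Gamma_pos_of_pos hb
  have hGab := Real.Gamma_pos_of_pos (add_pos ha hb)
  have h1 := Complex.betaIntegral_scaled b a hx
  rw [Complex.betaIntegral_eq_Gamma_mul_div b a (by simpa) (by simpa), ← Complex.ofReal_add,
    Complex.Gamma_ofReal, Complex.Gamma_ofReal, Complex.Gamma_ofReal,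
    intervalIntegral.integral_of_le hx.le, integral_Ioc_eq_integral_Ioo,
    setIntegral_congr_fun (g := fun s : ℝ => ((s ^ (b - 1) * (x - s) ^ (a - 1) : ℝ) : ℂ))
      measurableSet_Ioo, integral_complex_ofReal] at h1
  · have h2 : ∫ s in Set.Ioo 0 x, s ^ (b - 1) * (x - s) ^ (a - 1) = x ^ (b + a - 1) *
        (Real.Gamma b * Real.Gamma a / Real.Gamma (b + a)) := by
      apply Complex.ofReal_injective
      rw [h1]
      push_cast
      rw [Complex.ofReal_cpow hx.le]
      push_cast
      rfl
    have h3 : (fun s => rlKernel a (x - s) * rlKernel b s) = fun s =>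
        (Real.Gamma a * Real.Gamma b)⁻¹ * (s ^ (b - 1) * (x - s) ^ (a - 1)) := by
      funext s
      unfold rlKernel
      field_simp
    rw [h3, integral_const_mul, h2, rlKernel, add_comm b a]
    field_simp
  · intro s hs
    have h4 : 0 ≤ x - s := by linarith [hs.2]
    simp only
    push_cast
    rw [Complex.ofReal_cpow hs.1.le, Complex.ofReal_cpow h4]
    push_cast
    rfl

lemma abs_altTriangular_le (j : ℕ) : |altTriangular j| ≤ 4 ^ j := by
  unfold altTriangular
  rw [abs_mul, abs_pow, abs_neg, abs_one, one_pow, one_mul, abs_of_nonneg (by positivity)]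
  induction j with
  | zero => norm_num
  | succ j ih =>
    rw [pow_succ]
    push_cast
    nlinarith [(j.cast_nonneg : (0 : ℝ) ≤ j)]

lemma abs_altTriangular_le' (j : ℕ) : |altTriangular j| ≤ 4 ^ (j + 1) :=
  (abs_altTriangular_le j).trans (pow_le_pow_right₀ (by norm_num) j.le_succ)

lemma abs_neg_one_pow_mul_le {n : ℕ} {y : ℝ} (hy : |y| ≤ n + 1) :
    |(-1) ^ n * y| ≤ (4 : ℝ) ^ (n + 1) := by
  rw [abs_mul, abs_pow, abs_neg, abs_one, one_pow, one_mul]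
  refine hy.trans ?_
  exact_mod_cast (Nat.lt_pow_self (n := n + 1) (by norm_num : 1 < 4)).le

/-- The `j`-th term of the kernel of the renewal equation. -/
noncomputable def renewalTerm (α : ℝ) (j : ℕ) (y : ℝ) : ℝ :=
  -(altTriangular (j + 1) * rlKernel (1 + j) y) - 2 * (altTriangular j * rlKernel (α + j) y)
    - altTriangular j * rlKernel (2 * α + j) y

lemma summable_renewalTerm {α y : ℝ} (hα : 1 ≤ α) (hy : 0 < y) :
    Summable fun j => ‖renewalTerm α j y‖ := by
  have h1 := summable_mul_rlKernel (fun j => abs_altTriangular_le (j + 1)) le_rfl hy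
  have h2 := summable_mul_rlKernel abs_altTriangular_le' hα hy
  have h3 := summable_mul_rlKernel abs_altTriangular_le' (by linarith : 1 ≤ 2 * α) hy
  refine Summable.of_nonneg_of_le (fun _ => norm_nonneg _) (fun j => ?_)
    ((h1.add (h2.mul_left 2)).add h3)
  unfold renewalTerm
  refine (norm_sub_le _ _).trans (add_le_add_left ((norm_sub_le _ _).trans ?_) _)
  rw [norm_neg, norm_mul (2 : ℝ), Real.norm_two]

lemma tsum_renewalTerm {α y : ℝ} (hα : 1 ≤ α) (hy : 0 < y) :
    ∑' j, renewalTerm α j y = -∑' j : ℕ, altTriangular (j + 1) * rlKernel (1 + j) y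
      - 2 * ∑' j : ℕ, altTriangular j * rlKernel (α + j) y
      - ∑' j : ℕ, altTriangular j * rlKernel (2 * α + j) y := by
  have h1 := (summable_mul_rlKernel (fun j => abs_altTriangular_le (j + 1)) le_rfl hy).of_norm
  have h2 := (summable_mul_rlKernel abs_altTriangular_le' hα hy).of_norm
  have h3 := (summable_mul_rlKernel abs_altTriangular_le' (by linarith : 1 ≤ 2 * α) hy).of_norm
  unfold renewalTerm
  rw [(h1.neg.sub (h2.mul_left 2)).tsum_sub h3, h1.neg.tsum_sub (h2.mul_left 2), tsum_neg,
    tsum_mul_left]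

lemma tsum_renewalTerm_nonneg {α y : ℝ} (hα : 1 < α) (hα' : α ≤ 6 / 5) (hy : 0 < y) :
    0 ≤ ∑' j, renewalTerm α j y := by
  have h := kummer_combination_nonneg (b := α - 1) (by linarith) (by linarith) hy
  rw [add_sub_cancel, show 2 + 2 * (α - 1) = 2 * α by ring] at h
  rw [tsum_renewalTerm hα.le hy, tsum_altTriangular_succ_mul_rlKernel,
    tsum_altTriangular_mul_rlKernel hα.le (by linarith) hy,
    tsum_altTriangular_mul_rlKernel (by linarith) (by linarith) hy]
  have := mul_nonneg (Real.exp_pos (-y)).le h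
  linarith

/-- The function `x ^ (1 + α) * E (-x ^ α)`, expanded in Riemann–Liouville kernels. -/
noncomputable def renewalSolution (α x : ℝ) : ℝ :=
  ∑' n : ℕ, (-1) ^ n * (n + 1) * rlKernel (2 + α + α * n) x

lemma summable_norm_renewalSolution {α x : ℝ} (hα : 1 ≤ α) (hx : 0 < x) :
    Summable fun n : ℕ => ‖(-1) ^ n * (n + 1) * rlKernel (2 + α + α * n) x‖ :=
  summable_mul_rlKernel_mul (g := fun n => (-1) ^ n * (n + 1)) (fun n => abs_neg_one_pow_mul_le
    (by rw [abs_of_nonneg (by positivity)])) hα hx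

lemma integrableOn_renewalTerm_mul {α b x : ℝ} (hα : 1 ≤ α) (hb : 1 ≤ b) (j : ℕ) :
    IntegrableOn (fun s => renewalTerm α j (x - s) * rlKernel b s) (Set.Ioo 0 x) := by
  have hj : (0 : ℝ) ≤ j := j.cast_nonneg
  have h1 := (integrableOn_rlKernel_mul (a := 1 + j) (x := x) (by linarith) hb).const_mul
    (-altTriangular (j + 1))
  have h2 := (integrableOn_rlKernel_mul (a := α + j) (x := x) (by linarith) hb).const_mul
    (2 * altTriangular j)
  have h3 := (integrableOn_rlKernel_mul (a := 2 * α + j) (x := x) (by linarith) hb).const_mul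
    (altTriangular j)
  refine ((h1.sub h2).sub h3).congr (Eventually.of_forall fun s => ?_)
  simp only [renewalTerm, Pi.sub_apply]
  ring

lemma integral_renewalTerm_mul {α b x : ℝ} (hα : 1 ≤ α) (hb : 1 ≤ b) (hx : 0 < x) (j : ℕ) :
    ∫ s in Set.Ioo 0 x, renewalTerm α j (x - s) * rlKernel b s =
      -(altTriangular (j + 1) * rlKernel (1 + j + b) x)
        - 2 * (altTriangular j * rlKernel (α + j + b) x)
        - altTriangular j * rlKernel (2 * α + j + b) x := by
  have hj : (0 : ℝ) ≤ j := j.cast_nonneg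
  have h1 := (integrableOn_rlKernel_mul (a := 1 + j) (x := x) (by linarith) hb).const_mul
    (-altTriangular (j + 1))
  have h2 := (integrableOn_rlKernel_mul (a := α + j) (x := x) (by linarith) hb).const_mul
    (2 * altTriangular j)
  have h3 := (integrableOn_rlKernel_mul (a := 2 * α + j) (x := x) (by linarith) hb).const_mul
    (altTriangular j)
  have e : (fun s => renewalTerm α j (x - s) * rlKernel b s) = fun s =>
      (-altTriangular (j + 1) * (rlKernel (1 + j) (x - s) * rlKernel b s) -
      2 * altTriangular j * (rlKernel (α + j) (x - s) * rlKernel b s)) -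
      altTriangular j * (rlKernel (2 * α + j) (x - s) * rlKernel b s) := by
    funext s
    unfold renewalTerm
    ring
  rw [e, integral_sub (by exact h1.sub h2) h3, integral_sub h1 h2, integral_const_mul,
      integral_const_mul,
    integral_const_mul, integral_rlKernel_mul (by linarith) (by linarith) hx,
    integral_rlKernel_mul (by linarith) (by linarith) hx,
    integral_rlKernel_mul (by linarith) (by linarith) hx]
  ring

lemma integral_norm_renewalTerm_mul_le {α b x : ℝ} (hα : 1 ≤ α) (hb : 1 ≤ b) (hx : 0 < x) (j : ℕ) :
    ∫ s in Set.Ioo 0 x, ‖renewalTerm α j (x - s) * rlKernel b s‖ ≤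
      |altTriangular (j + 1)| * rlKernel (1 + j + b) x
        + 2 * (|altTriangular j| * rlKernel (α + j + b) x)
        + |altTriangular j| * rlKernel (2 * α + j + b) x := by
  have hj : (0 : ℝ) ≤ j := j.cast_nonneg
  have h1 := (integrableOn_rlKernel_mul (a := 1 + j) (x := x) (by linarith) hb).const_mul
    (|altTriangular (j + 1)|)
  have h2 := (integrableOn_rlKernel_mul (a := α + j) (x := x) (by linarith) hb).const_mul
    (2 * |altTriangular j|)
  have h3 := (integrableOn_rlKernel_mul (a := 2 * α + j) (x := x) (by linarith) hb).const_mul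
    (|altTriangular j|)
  have hle : ∫ s in Set.Ioo 0 x, ‖renewalTerm α j (x - s) * rlKernel b s‖ ≤
      ∫ s in Set.Ioo 0 x, ((|altTriangular (j + 1)| * (rlKernel (1 + j) (x - s) * rlKernel b s) +
      2 * |altTriangular j| * (rlKernel (α + j) (x - s) * rlKernel b s)) +
      |altTriangular j| * (rlKernel (2 * α + j) (x - s) * rlKernel b s)) := by
    refine setIntegral_mono_on (integrableOn_renewalTerm_mul hα hb j).norm ((h1.add h2).add h3)
      measurableSet_Ioo fun s hs => ?_
    have hs' : 0 ≤ x - s := by linarith [hs.2]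
    have k0 := rlKernel_nonneg (c := b) (by linarith) hs.1.le
    have k1 := rlKernel_nonneg (c := 1 + j) (by linarith) hs'
    have k2 := rlKernel_nonneg (c := α + j) (by linarith) hs'
    have k3 := rlKernel_nonneg (c := 2 * α + j) (by linarith) hs'
    rw [norm_mul, Real.norm_of_nonneg k0]
    have : ‖renewalTerm α j (x - s)‖ ≤ |altTriangular (j + 1)| * rlKernel (1 + j) (x - s)
        + 2 * (|altTriangular j| * rlKernel (α + j) (x - s))
        + |altTriangular j| * rlKernel (2 * α + j) (x - s) := by
      unfold renewalTerm
      refine (norm_sub_le _ _).trans (add_le_add ((norm_sub_le _ _).trans (add_le_add ?_ ?_)) ?_)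
      · rw [norm_neg, norm_mul, Real.norm_of_nonneg k1, Real.norm_eq_abs]
      · rw [norm_mul, norm_mul, Real.norm_two, Real.norm_of_nonneg k2, Real.norm_eq_abs]
      · rw [norm_mul, Real.norm_of_nonneg k3, Real.norm_eq_abs]
    linarith [mul_le_mul_of_nonneg_right this k0]
  refine hle.trans_eq ?_
  rw [integral_add (by exact h1.add h2) h3, integral_add h1 h2, integral_const_mul,
      integral_const_mul,
    integral_const_mul, integral_rlKernel_mul (by linarith) (by linarith) hx,
    integral_rlKernel_mul (by linarith) (by linarith) hx,
    integral_rlKernel_mul (by linarith) (by linarith) hx]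
  ring

/-- The sum `∑ j, altTriangular j * rlKernel (2 + α + α * n + j) x`. -/
noncomputable def resolventTerm (α x : ℝ) (n : ℕ) : ℝ :=
  ∑' j : ℕ, altTriangular j * rlKernel (2 + α + α * n + j) x

lemma summable_mul_resolventTerm {g : ℕ → ℝ} (hg : ∀ n, |g n| ≤ 4 ^ (n + 1)) {α x : ℝ}
    (hα : 1 ≤ α) (hx : 0 < x) : Summable fun n => g n * resolventTerm α x n := by
  have h := (summable_prod_mul_rlKernel abs_altTriangular_le' hg le_rfl hα hx).of_norm.prod
  refine h.congr fun n => ?_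
  simp only [tsum_mul_left, resolventTerm]
  congr 1
  refine tsum_congr fun j => ?_
  congr 2
  ring

lemma tsum_telescope_resolventTerm {α x : ℝ} (hα : 1 ≤ α) (hx : 0 < x) :
    HasSum (fun n : ℕ => (-1) ^ n * (n + 1) * (resolventTerm α x n +
      2 * resolventTerm α x (n + 1) + resolventTerm α x (n + 2))) (resolventTerm α x 0) := by
  have h1 := summable_mul_resolventTerm (g := fun n => (-1) ^ n * (n + 1))
    (fun n => abs_neg_one_pow_mul_le (by rw [abs_of_nonneg (by positivity)])) hα hx
  have h2 := (summable_nat_add_iff 1).2 (summable_mul_resolventTerm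
    (g := fun n => (-1) ^ n * (1 - n)) (fun n => abs_neg_one_pow_mul_le (by
      have : (0 : ℝ) ≤ n := n.cast_nonneg
      rw [abs_le]; constructor <;> linarith)) hα hx)
  have hT := h1.add h2
  have hT1 := (summable_nat_add_iff 1).2 hT
  have h3 := (hT.sub hT1).hasSum
  rw [hT.tsum_sub hT1, hT.tsum_eq_zero_add] at h3
  have e : resolventTerm α x 0 = (-1) ^ 0 * ((0 : ℕ) + 1) * resolventTerm α x 0 +
      (-1) ^ (0 + 1) * (1 - (0 + 1 : ℕ)) * resolventTerm α x (0 + 1) := by simp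
  rw [add_sub_cancel_right, ← e] at h3
  refine h3.congr_fun fun n => ?_
  push_cast
  ring

lemma tsum_integral_renewalTerm_mul {α x : ℝ} (hα : 1 ≤ α) (hx : 0 < x) (n : ℕ) :
    ∑' j, ∫ s in Set.Ioo 0 x, renewalTerm α j (x - s) * rlKernel (2 + α + α * n) s =
      rlKernel (2 + α + α * n) x - (resolventTerm α x n + 2 * resolventTerm α x (n + 1)
        + resolventTerm α x (n + 2)) := by
  have hn : (0 : ℝ) ≤ α * n := by positivity
  have hs (m : ℕ) : Summable fun j : ℕ => altTriangular j * rlKernel (2 + α + α * m + j) x :=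
    (summable_mul_rlKernel abs_altTriangular_le'
      (by have : (0 : ℝ) ≤ α * m := by positivity
          linarith) hx).of_norm
  have hs0 := (summable_nat_add_iff 1).2 (hs n)
  have h0 : resolventTerm α x n = rlKernel (2 + α + α * n) x +
      ∑' j : ℕ, altTriangular (j + 1) * rlKernel (2 + α + α * n + (j + 1 : ℕ)) x := by
    rw [resolventTerm, (hs n).tsum_eq_zero_add]
    simp [altTriangular]
  have key (j : ℕ) : ∫ s in Set.Ioo 0 x, renewalTerm α j (x - s) * rlKernel (2 + α + α * n) s =
      -(altTriangular (j + 1) * rlKernel (2 + α + α * n + (j + 1 : ℕ)) x)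
      - 2 * (altTriangular j * rlKernel (2 + α + α * (n + 1 : ℕ) + j) x)
      - altTriangular j * rlKernel (2 + α + α * (n + 2 : ℕ) + j) x := by
    have e1 : 1 + (j : ℝ) + (2 + α + α * n) = 2 + α + α * n + (j + 1 : ℕ) := by push_cast; ring
    have e2 : α + j + (2 + α + α * n) = 2 + α + α * (n + 1 : ℕ) + j := by push_cast; ring
    have e3 : 2 * α + j + (2 + α + α * n) = 2 + α + α * (n + 2 : ℕ) + j := by push_cast; ring
    rw [integral_renewalTerm_mul hα (by linarith) hx, e1, e2, e3]
  simp_rw [key]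
  rw [(hs0.neg.sub ((hs (n + 1)).mul_left 2)).tsum_sub (hs (n + 2)),
    hs0.neg.tsum_sub ((hs (n + 1)).mul_left 2), tsum_neg, tsum_mul_left, h0, resolventTerm,
    resolventTerm]
  ring

lemma summable_integral_norm_renewalTerm_mul {g : ℕ → ℝ} (hg : ∀ n, |g n| ≤ 4 ^ (n + 1))
    {α x : ℝ} (hα : 1 ≤ α) (hx : 0 < x) :
    Summable fun p : ℕ × ℕ => ∫ s in Set.Ioo 0 x,
      ‖g p.1 * (renewalTerm α p.2 (x - s) * rlKernel (2 + α + α * p.1) s)‖ := by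
  have k1 := summable_prod_mul_rlKernel (fun j => abs_altTriangular_le (j + 1)) hg
    zero_le_one hα hx
  have k2 := summable_prod_mul_rlKernel abs_altTriangular_le' hg (c := α) (by linarith) hα hx
  have k3 := summable_prod_mul_rlKernel abs_altTriangular_le' hg (c := 2 * α) (by linarith) hα hx
  refine Summable.of_nonneg_of_le (fun p => by positivity) (fun p => ?_)
    ((k1.add (k2.mul_left 2)).add k3)
  have hp : (0 : ℝ) ≤ α * p.1 := by positivity
  simp_rw [norm_mul (g p.1)]
  rw [integral_const_mul]
  refine (mul_le_mul_of_nonneg_left (integral_norm_renewalTerm_mul_le hα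
    (b := 2 + α + α * p.1) (by linarith) hx p.2) (norm_nonneg _)).trans_eq ?_
  rw [norm_mul (altTriangular _), norm_mul (altTriangular _), norm_mul (altTriangular _),
    Real.norm_of_nonneg (rlKernel_nonneg (by positivity) hx.le),
    Real.norm_of_nonneg (rlKernel_nonneg (by positivity) hx.le),
    Real.norm_of_nonneg (rlKernel_nonneg (by positivity) hx.le),
    Real.norm_eq_abs (altTriangular _), Real.norm_eq_abs (altTriangular _)]
  ring

/-- The renewal equation satisfied by `renewalSolution`. -/
lemma integral_tsum_renewalTerm_mul_renewalSolution {α x : ℝ} (hα : 1 ≤ α) (hx : 0 < x) :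
    ∫ s in Set.Ioo 0 x, (∑' j, renewalTerm α j (x - s)) * renewalSolution α s =
      renewalSolution α x - ∑' j : ℕ, altTriangular j * rlKernel (2 + α + j) x := by
  set g : ℕ → ℝ := fun n => (-1) ^ n * (n + 1) with hg_def
  have hg (n : ℕ) : |g n| ≤ 4 ^ (n + 1) :=
    abs_neg_one_pow_mul_le (by rw [abs_of_nonneg (by positivity)])
  have hsum := summable_integral_norm_renewalTerm_mul hg hα hx
  have hint (p : ℕ × ℕ) : Integrable (fun s => g p.1 * (renewalTerm α p.2 (x - s) *
      rlKernel (2 + α + α * p.1) s)) (volume.restrict (Set.Ioo 0 x)) := by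
    have hp : (0 : ℝ) ≤ α * p.1 := by positivity
    exact (integrableOn_renewalTerm_mul hα (by linarith) p.2).const_mul _
  have h := hasSum_integral_of_summable_integral_norm hint hsum
  have e : ∫ s in Set.Ioo 0 x, (∑' j, renewalTerm α j (x - s)) * renewalSolution α s =
      ∫ s in Set.Ioo 0 x, ∑' p : ℕ × ℕ, g p.1 * (renewalTerm α p.2 (x - s) *
        rlKernel (2 + α + α * p.1) s) := by
    refine setIntegral_congr_fun measurableSet_Ioo fun s hs => ?_
    rw [mul_comm, renewalSolution, tsum_mul_tsum_of_summable_norm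
      (summable_norm_renewalSolution hα hs.1) (summable_renewalTerm hα (sub_pos.2 hs.2))]
    refine tsum_congr fun p => ?_
    ring
  rw [e, ← h.tsum_eq, h.summable.tsum_prod]
  simp_rw [integral_const_mul, tsum_mul_left, tsum_integral_renewalTerm_mul hα hx, mul_sub]
  have ht := tsum_telescope_resolventTerm hα hx
  rw [(summable_norm_renewalSolution hα hx).of_norm.tsum_sub ht.summable, ht.tsum_eq]
  simp [renewalSolution, resolventTerm]

lemma mittagLeffler3_two_eq_tsum (ρ μ z : ℝ) :
    mittagLeffler3 ρ μ 2 z = ∑' n : ℕ, (n + 1) / Real.Gamma (μ + ρ * n) * z ^ n := by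
  refine tsum_congr fun n => ?_
  have h1 : Real.Gamma (1 + n) ≠ 0 := (Real.Gamma_pos_of_pos (by positivity)).ne'
  rw [show (2 : ℝ) + n = (1 + n) + 1 by ring, Real.Gamma_add_one (by positivity), Real.Gamma_two,
    one_mul, mul_comm (1 + (n : ℝ)), mul_div_mul_left _ _ h1, add_comm 1 (n : ℝ)]

lemma continuous_mittagLeffler3_two {α : ℝ} (hα : 1 ≤ α) :
    Continuous (mittagLeffler3 α (2 + α) 2) := by
  rw [funext (mittagLeffler3_two_eq_tsum α (2 + α)), continuous_iff_continuousAt]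
  intro z
  have hz : Metric.closedBall (0 : ℝ) (|z| + 1) ∈ 𝓝 z :=
    Metric.closedBall_mem_nhds_of_mem (by simp)
  have hs := Real.summable_pow_div_factorial (2 * (|z| + 1))
  have hc (n : ℕ) : ContinuousOn
      (fun y : ℝ => ((n : ℝ) + 1) / Real.Gamma (2 + α + α * n) * y ^ n)
      (Metric.closedBall (0 : ℝ) (|z| + 1)) :=
    (continuous_const.mul (continuous_pow n)).continuousOn
  refine (continuousOn_tsum hc hs fun n y hy => ?_).continuousAt hz
  have hG : (n.factorial : ℝ) ≤ Real.Gamma (2 + α + α * n) :=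
    factorial_le_Gamma_of_add_two_le (by
      have : (n : ℝ) ≤ α * n := le_mul_of_one_le_left (Nat.cast_nonneg _) hα
      linarith)
  have hG0 := Real.Gamma_pos_of_pos (show 0 < 2 + α + α * n by positivity)
  have hn : (n : ℝ) + 1 ≤ 2 ^ n := by exact_mod_cast Nat.lt_two_pow_self
  have hy' : ‖y‖ ≤ |z| + 1 := by simpa using hy
  rw [norm_mul, norm_pow, Real.norm_of_nonneg (by positivity), mul_pow, mul_div_right_comm]
  gcongr

lemma mittagLeffler3_zero_pos {α : ℝ} (hα : 0 ≤ α) : 0 < mittagLeffler3 α (2 + α) 2 0 := by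
  rw [mittagLeffler3_two_eq_tsum, tsum_eq_single 0 fun n hn => by simp [hn]]
  have := Real.Gamma_pos_of_pos (show 0 < 2 + α by positivity)
  simpa

lemma renewalSolution_eq {α x : ℝ} (hx : 0 < x) :
    renewalSolution α x = x ^ (1 + α) * mittagLeffler3 α (2 + α) 2 (-x ^ α) := by
  rw [mittagLeffler3_two_eq_tsum, renewalSolution, ← tsum_mul_left]
  refine tsum_congr fun n => ?_
  rw [rlKernel, show 2 + α + α * n - 1 = 1 + α + α * n by ring, Real.rpow_add hx (1 + α),
    Real.rpow_mul hx.le, Real.rpow_natCast, neg_pow]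
  ring

lemma renewalSolution_pos_of_forall_pos {α x : ℝ} (hα : 1 < α) (hα' : α ≤ 6 / 5) (hx : 0 < x)
    (h : ∀ s ∈ Set.Ioo 0 x, 0 < renewalSolution α s) : 0 < renewalSolution α x := by
  have h1 := integral_tsum_renewalTerm_mul_renewalSolution hα.le hx
  have h2 : 0 ≤ ∫ s in Set.Ioo 0 x, (∑' j, renewalTerm α j (x - s)) * renewalSolution α s :=
    setIntegral_nonneg measurableSet_Ioo fun s hs =>
      mul_nonneg (tsum_renewalTerm_nonneg hα hα' (sub_pos.2 hs.2)) (h s hs).le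
  have h3 := tsum_altTriangular_mul_rlKernel_pos (c := 2 + α) (by linarith) (by linarith) hx
  linarith

theorem mittagLeffler3_nonneg_of_le_six_fifths (α : ℝ) (hα : 1 < α) (hα' : α ≤ 6 / 5)
    (t : ℝ) (ht : 0 ≤ t) : 0 ≤ mittagLeffler3 α (2 + α) 2 (-t) := by
  have hα0 : 0 < α := by linarith
  by_contra! hneg
  have hcont : Continuous fun u => mittagLeffler3 α (2 + α) 2 (-u) :=
    (continuous_mittagLeffler3_two hα.le).comp continuous_neg
  have hK : IsCompact (Set.Icc 0 t ∩ {u | mittagLeffler3 α (2 + α) 2 (-u) ≤ 0}) :=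
    isCompact_Icc.inter_right (isClosed_le hcont continuous_const)
  obtain ⟨u, ⟨hu, hu'⟩, hmin⟩ := hK.exists_isLeast ⟨t, ⟨ht, le_rfl⟩, hneg.le⟩
  have hu0 : 0 < u := by
    refine hu.1.lt_of_ne ?_
    rintro rfl
    have := mittagLeffler3_zero_pos hα0.le
    rw [Set.mem_ofPred_eq, neg_zero] at hu'
    linarith
  have hx : 0 < u ^ α⁻¹ := Real.rpow_pos_of_pos hu0 _
  have hxα : (u ^ α⁻¹) ^ α = u := Real.rpow_inv_rpow hu0.le hα0.ne'
  have hpos := renewalSolution_pos_of_forall_pos hα hα' hx fun s hs => by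
    rw [renewalSolution_eq hs.1]
    refine mul_pos (Real.rpow_pos_of_pos hs.1 _) (not_le.1 fun hle => ?_)
    have hlt : s ^ α < u := hxα ▸ Real.rpow_lt_rpow hs.1.le hs.2 hα0
    exact hlt.not_ge (hmin ⟨⟨Real.rpow_nonneg hs.1.le _, hlt.le.trans hu.2⟩, hle⟩)
  rw [renewalSolution_eq hx, hxα] at hpos
  exact hpos.not_ge (mul_nonpos_of_nonneg_of_nonpos (Real.rpow_nonneg hx.le _) hu')
end

section
/- Let 0 < α ≤ 1 and let μ be a probability measure on ℝ whose characteristic function is x ↦ exp(−|x|^α) (the symmetric strictly α-stable law). Then the pushforward of μ under the map t ↦ |t| (the half symmetric α-stable distribution) is infinitely divisible. -/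
open MeasureTheory Real

/-- The `n`-fold convolution power of a measure on `ℝ`. -/
noncomputable def convPow (ν : Measure ℝ) : ℕ → Measure ℝ
  | 0 => Measure.dirac 0
  | n + 1 => (convPow ν n).conv ν

/-- A probability measure on `ℝ` is infinitely divisible if for every positive integer `n`
it is the `n`-fold convolution of some probability measure with itself. -/
def IsInfinitelyDivisible (μ : Measure ℝ) : Prop :=
  ∀ n : ℕ, 0 < n → ∃ ν : Measure ℝ, IsProbabilityMeasure ν ∧ μ = convPow ν n

section ZerosOfNumerator

open Polynomial ComplexConjugate

/-- The numerator of the rational function `1 + ∑ i, B i / (c i - X) ^ 2`. -/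
noncomputable def mixtureNumerator {ι : Type*} [Fintype ι] [DecidableEq ι] (c B : ι → ℝ) : ℂ[X] :=
  ∏ i, (X - C (c i : ℂ)) ^ 2 +
    ∑ i, C (B i : ℂ) * ∏ j ∈ Finset.univ.erase i, (X - C (c j : ℂ)) ^ 2

section Numerator

lemma natDegree_prod_sq {ι : Type*} (c : ι → ℝ) (s : Finset ι) :
    (∏ i ∈ s, (X - C (c i : ℂ)) ^ 2).natDegree = 2 * s.card := by
  rw [natDegree_prod_of_monic _ _ fun i _ => (monic_X_sub_C _).pow 2]
  simp [mul_comm]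

variable {ι : Type*} [Fintype ι] [DecidableEq ι] (c B : ι → ℝ)

lemma degree_numerator_tail_lt :
    (∑ i, C (B i : ℂ) * ∏ j ∈ Finset.univ.erase i, (X - C (c j : ℂ)) ^ 2).degree + 1 <
      (∏ i, (X - C (c i : ℂ)) ^ 2).degree := by
  have h0 : (∏ i, (X - C (c i : ℂ)) ^ 2).degree = ((2 * Fintype.card ι : ℕ) : WithBot ℕ) := by
    rw [degree_eq_natDegree (monic_prod_of_monic _ _ fun i _ => (monic_X_sub_C _).pow 2).ne_zero,
      natDegree_prod_sq, Finset.card_univ]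
  rcases isEmpty_or_nonempty ι with hι | hι
  · rw [h0]; simp
  have hpos : 0 < Fintype.card ι := Fintype.card_pos
  have h1 : (∑ i, C (B i : ℂ) * ∏ j ∈ Finset.univ.erase i, (X - C (c j : ℂ)) ^ 2).degree ≤
      ((2 * (Fintype.card ι - 1) : ℕ) : WithBot ℕ) := by
    refine (degree_sum_le _ _).trans (Finset.sup_le fun i _ => ?_)
    refine degree_le_of_natDegree_le ((natDegree_C_mul_le _ _).trans ?_)
    rw [natDegree_prod_sq, Finset.card_erase_of_mem (Finset.mem_univ i), Finset.card_univ]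
  rw [h0]
  calc _ ≤ ((2 * (Fintype.card ι - 1) : ℕ) : WithBot ℕ) + 1 := by gcongr
    _ = ((2 * (Fintype.card ι - 1) + 1 : ℕ) : WithBot ℕ) := by push_cast; rfl
    _ < _ := by
      rw [Nat.cast_lt]; omega

lemma degree_tail_lt :
    (∑ i, C (B i : ℂ) * ∏ j ∈ Finset.univ.erase i, (X - C (c j : ℂ)) ^ 2).degree <
      (∏ i, (X - C (c i : ℂ)) ^ 2).degree :=
  lt_of_le_of_lt (le_add_of_nonneg_right zero_le_one) (degree_numerator_tail_lt c B)

lemma monic_mixtureNumerator : (mixtureNumerator c B).Monic :=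
  (monic_prod_of_monic _ _ fun _ _ => (monic_X_sub_C _).pow 2).add_of_left (degree_tail_lt c B)

lemma natDegree_mixtureNumerator : (mixtureNumerator c B).natDegree = 2 * Fintype.card ι := by
  rw [mixtureNumerator, natDegree_add_eq_left_of_degree_lt (degree_tail_lt c B),
    natDegree_prod_sq, Finset.card_univ]

lemma nextCoeff_mixtureNumerator :
    (mixtureNumerator c B).nextCoeff = -(2 * ∑ i, (c i : ℂ)) := by
  have h : (∏ i, (X - C (c i : ℂ)) ^ 2).nextCoeff = -(2 * ∑ i, (c i : ℂ)) := by
    rw [Monic.nextCoeff_prod _ _ fun i _ => (monic_X_sub_C _).pow 2]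
    simp [(monic_X_sub_C _).nextCoeff_pow, Finset.mul_sum]
  rcases isEmpty_or_nonempty ι with hι | hι
  · rw [← h]; simp [mixtureNumerator]
  have hpos : 0 < Fintype.card ι := Fintype.card_pos
  rw [← h, nextCoeff_of_natDegree_pos (by rw [natDegree_mixtureNumerator]; omega),
    nextCoeff_of_natDegree_pos (by rw [natDegree_prod_sq, Finset.card_univ]; omega),
    natDegree_mixtureNumerator, natDegree_prod_sq, Finset.card_univ, mixtureNumerator, coeff_add]
  refine add_eq_left.2 (coeff_eq_zero_of_degree_lt ?_)
  have h2 := degree_numerator_tail_lt c B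
  rw [degree_eq_natDegree (monic_prod_of_monic Finset.univ (fun i => (X - C (c i : ℂ)) ^ 2)
    fun _ _ => (monic_X_sub_C _).pow 2).ne_zero, natDegree_prod_sq, Finset.card_univ] at h2
  have h3 : ((2 * Fintype.card ι : ℕ) : WithBot ℕ) = ((2 * Fintype.card ι - 1 : ℕ) : WithBot ℕ) + 1 := by
    rw [← Nat.cast_one (R := WithBot ℕ), ← Nat.cast_add]; congr 1; omega
  rw [h3] at h2
  exact lt_of_add_lt_add_right h2

lemma eval_mixtureNumerator {w : ℂ} (hw : ∀ i, w ≠ c i) :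
    (mixtureNumerator c B).eval w =
      (∏ i, (w - c i) ^ 2) * (1 + ∑ i, (B i : ℂ) / (c i - w) ^ 2) := by
  simp only [mixtureNumerator, eval_add, eval_prod, eval_pow, eval_sub, eval_X, eval_C,
    eval_finsetSum, eval_mul, mul_add, mul_one, Finset.mul_sum]
  congr 1
  refine Finset.sum_congr rfl fun i _ => ?_
  rw [← Finset.mul_prod_erase Finset.univ _ (Finset.mem_univ i)]
  have : (c i : ℂ) - w ≠ 0 := sub_ne_zero.2 (hw i).symm
  have h2 : (w - c i) ^ 2 = ((c i : ℂ) - w) ^ 2 := by ring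
  rw [h2]
  field_simp

lemma map_conj_mixtureNumerator :
    (mixtureNumerator c B).map (starRingEnd ℂ) = mixtureNumerator c B := by
  simp [mixtureNumerator, Polynomial.map_prod, Polynomial.map_sum]

/-- The zeros of `1 + ∑ i, B i / (c i - w) ^ 2`, indexed by the poles counted twice. -/
lemma exists_zeros : ∃ z : ι × Bool → ℂ,
    (∀ w : ℂ, (∀ i, w ≠ c i) →
      ∏ j, (w - z j) = (∏ i, (w - c i) ^ 2) * (1 + ∑ i, (B i : ℂ) / (c i - w) ^ 2)) ∧
    ∑ j, z j = 2 * ∑ i, (c i : ℂ) ∧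
    ∀ g : ℂ → ℂ, ∑ j, g (conj (z j)) = ∑ j, g (z j) := by
  have hs : (mixtureNumerator c B).Splits := IsAlgClosed.splits _
  have hm := monic_mixtureNumerator c B
  have hcard : (mixtureNumerator c B).roots.toList.length = Fintype.card (ι × Bool) := by
    rw [Multiset.length_toList, ← hs.natDegree_eq_card_roots, natDegree_mixtureNumerator]
    simp [mul_comm]
  let e : ι × Bool ≃ Fin (mixtureNumerator c B).roots.toList.length :=
    (Fintype.equivFin _).trans (finCongr hcard.symm)
  let z : ι × Bool → ℂ := fun j => (mixtureNumerator c B).roots.toList.get (e j)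
  have hz : (Finset.univ.val.map z : Multiset ℂ) = (mixtureNumerator c B).roots := by
    have h1 : (Finset.univ.val.map z : Multiset ℂ) = Finset.univ.val.map
        (fun k => (mixtureNumerator c B).roots.toList.get k) := by
      have h2 : (Finset.univ.val.map e : Multiset _) = Finset.univ.val := by
        rw [← Finset.map_univ_equiv e]; rfl
      rw [← h2, Multiset.map_map]; rfl
    rw [h1, Fin.univ_val_map, List.ofFn_get, Multiset.coe_toList]
  have hsum (g : ℂ → ℂ) : ∑ j, g (z j) = ((mixtureNumerator c B).roots.map g).sum := by
    rw [← hz, Multiset.map_map]; rfl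
  refine ⟨z, fun w hw => ?_, ?_, fun g => ?_⟩
  · rw [← eval_mixtureNumerator c B hw, hs.eval_eq_prod_roots_of_monic hm, ← hz,
      Multiset.map_map]
    rfl
  · have h1 := hs.nextCoeff_eq_neg_sum_roots_of_monic hm
    rw [nextCoeff_mixtureNumerator, neg_inj] at h1
    rw [h1, hsum (fun z => z)]; simp
  · have h2 := hs.roots_map (starRingEnd ℂ)
    rw [map_conj_mixtureNumerator] at h2
    rw [hsum, hsum (fun z => g (conj z))]
    conv_rhs => rw [h2, Multiset.map_map]
    rfl

end Numerator

end ZerosOfNumerator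

section HalfPlane

open Filter Topology Bornology Asymptotics

variable {ι : Type*} [Fintype ι]

lemma norm_add_le_mul_norm_add (a b z : ℂ) (hb : 0 < b.re) (hz : 0 ≤ z.re) :
    ‖z + a‖ ≤ (1 + ‖a - b‖ / b.re) * ‖z + b‖ := by
  have h1 : b.re ≤ ‖z + b‖ := by
    refine le_trans ?_ (Complex.re_le_norm _)
    simp [hz]
  calc ‖z + a‖ = ‖(z + b) + (a - b)‖ := by congr 1; ring
    _ ≤ ‖z + b‖ + ‖a - b‖ / b.re * b.re := by
      rw [div_mul_cancel₀ _ hb.ne']; exact norm_add_le _ _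
    _ ≤ ‖z + b‖ + ‖a - b‖ / b.re * ‖z + b‖ := by gcongr
    _ = _ := by ring

/-- A comparison of two products on the imaginary axis extends to the right half-plane. -/
lemma prod_norm_add_le_of_imaginary (a b : ι → ℂ) (hb : ∀ j, 0 < (b j).re)
    (h : ∀ y : ℝ, ∏ j, ‖y * Complex.I + a j‖ ≤ ∏ j, ‖y * Complex.I + b j‖) {z : ℂ}
    (hz : 0 ≤ z.re) : ∏ j, ‖z + a j‖ ≤ ∏ j, ‖z + b j‖ := by
  have hne (w : ℂ) (hw : 0 ≤ w.re) (j : ι) : w + b j ≠ 0 := by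
    intro h0
    have := congrArg Complex.re h0
    simp only [Complex.add_re, Complex.zero_re] at this
    linarith [hb j]
  set f : ℂ → ℂ := fun w => ∏ j, (w + a j) / (w + b j) with hf
  have hfn (w : ℂ) : ‖f w‖ = (∏ j, ‖w + a j‖) / ∏ j, ‖w + b j‖ := by
    simp [hf, norm_prod, Finset.prod_div_distrib]
  have hpos (w : ℂ) (hw : 0 ≤ w.re) : 0 < ∏ j, ‖w + b j‖ :=
    Finset.prod_pos fun j _ => norm_pos_iff.2 (hne w hw j)
  have hbdd (w : ℂ) (hw : 0 ≤ w.re) : ‖f w‖ ≤ ∏ j, (1 + ‖a j - b j‖ / (b j).re) := by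
    rw [hfn, div_le_iff₀ (hpos w hw), ← Finset.prod_mul_distrib]
    exact Finset.prod_le_prod (fun _ _ => norm_nonneg _)
      fun j _ => norm_add_le_mul_norm_add _ _ _ (hb j) hw
  have hd : DiffContOnCl ℂ f {z | 0 < z.re} := by
    have : DifferentiableOn ℂ f {z | 0 ≤ z.re} := by
      refine DifferentiableOn.fun_finsetProd fun j _ => ?_
      exact DifferentiableOn.div (by fun_prop) (by fun_prop) fun w hw => hne w hw j
    refine ⟨this.mono fun w (hw : 0 < w.re) => (hw.le : 0 ≤ w.re), ?_⟩
    rw [Complex.closure_setOfPred_lt_re]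
    exact this.continuousOn
  have key : ‖f z‖ ≤ 1 := by
    refine PhragmenLindelof.right_half_plane_of_bounded_on_real hd ⟨1, by norm_num, 0, ?_⟩ ?_ ?_ hz
    · refine IsBigO.of_bound (∏ j, (1 + ‖a j - b j‖ / (b j).re)) ?_
      refine eventually_inf_principal.2 (Eventually.of_forall fun w hw => ?_)
      simpa using hbdd w (le_of_lt hw)
    · exact isBoundedUnder_of_eventually_le (a := ∏ j, (1 + ‖a j - b j‖ / (b j).re))
        ((eventually_ge_atTop 0).mono fun x hx => hbdd x (by simpa using hx))
    · intro y
      rw [hfn, div_le_one (hpos _ (by simp))]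
      exact h y
  rwa [hfn, div_le_one (hpos _ hz)] at key

lemma hasDerivAt_prod_normSq (a : ι → ℂ) :
    HasDerivAt (fun t : ℝ => ∏ j, ‖1 + t * a j‖ ^ 2) (2 * ∑ j, (a j).re) 0 := by
  classical
  have h (j : ι) : HasDerivAt (fun t : ℝ => ‖1 + t * a j‖ ^ 2) (2 * (a j).re) 0 := by
    have h1 : (fun t : ℝ => ‖1 + t * a j‖ ^ 2) =
        fun t : ℝ => 1 + t * (2 * (a j).re) + t ^ 2 * ‖a j‖ ^ 2 := by
      ext t
      rw [← Complex.normSq_eq_norm_sq, ← Complex.normSq_eq_norm_sq, Complex.normSq_apply,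
        Complex.normSq_apply]
      simp
      ring
    rw [h1]
    have := (((hasDerivAt_id (0 : ℝ)).mul_const (2 * (a j).re)).const_add 1).add
      (((hasDerivAt_id (0 : ℝ)).pow 2).mul_const (‖a j‖ ^ 2))
    convert! this using 1
    simp
  have := HasDerivAt.fun_finsetProd (u := Finset.univ) fun j _ => h j
  have h0 : 2 * ∑ j, (a j).re = ∑ i, (∏ j ∈ Finset.univ.erase i,
      ‖1 + ((0 : ℝ) : ℂ) * a j‖ ^ 2) • (2 * (a i).re) := by simp [Finset.mul_sum]
  rw [h0]
  exact this

/-- Comparing the products on the imaginary axis compares the sums of the real parts. -/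
lemma sum_re_le_of_prod_norm_le (a b : ι → ℂ) (hb : ∀ j, 0 < (b j).re)
    (h : ∀ y : ℝ, ∏ j, ‖y * Complex.I + a j‖ ≤ ∏ j, ‖y * Complex.I + b j‖) :
    ∑ j, (a j).re ≤ ∑ j, (b j).re := by
  have hd := (hasDerivAt_prod_normSq b).sub (hasDerivAt_prod_normSq a)
  have h1 := hd.tendsto_slope_zero_right
  have h2 : 0 ≤ 2 * ∑ j, (b j).re - 2 * ∑ j, (a j).re := by
    refine ge_of_tendsto h1 ?_
    filter_upwards [self_mem_nhdsWithin] with t (ht : 0 < t)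
    have h3 (a : ι → ℂ) : ∏ j, ‖1 + ((0 + t : ℝ) : ℂ) * a j‖ ^ 2 =
        (∏ j, ‖(t⁻¹ : ℝ) + a j‖) ^ 2 * (∏ _j : ι, t) ^ 2 := by
      rw [← mul_pow, ← Finset.prod_mul_distrib, ← Finset.prod_pow]
      refine Finset.prod_congr rfl fun j _ => ?_
      have : (1 : ℂ) + ((0 + t : ℝ) : ℂ) * a j = ((t⁻¹ : ℝ) + a j) * (t : ℂ) := by
        have : (t : ℂ) ≠ 0 := by exact_mod_cast ht.ne'
        push_cast
        field_simp
        ring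
      rw [this, norm_mul, Complex.norm_real, Real.norm_of_nonneg ht.le]
    have h4 := prod_norm_add_le_of_imaginary a b hb h (z := (t⁻¹ : ℝ)) (by simp [ht.le])
    have h5 : (0 : ℝ) ≤ ∏ j, ‖((t⁻¹ : ℝ) : ℂ) + a j‖ := by positivity
    simp only [Pi.sub_apply, h3, smul_eq_mul]
    simp only [Complex.ofReal_zero, zero_mul, add_zero, norm_one, one_pow, Finset.prod_const_one,
      sub_self, sub_zero]
    rw [← sub_mul]
    have := pow_le_pow_left₀ h5 h4 2
    have h6 := sub_nonneg.2 this
    positivity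
  linarith

/-- Reflecting all zeros to one side does not change the products on the imaginary axis. -/
lemma sum_abs_re_le_of_prod_norm_le (e f : ι → ℂ) (hf : ∀ j, 0 < (f j).re)
    (h : ∀ y : ℝ, ∏ j, ‖y * Complex.I - e j‖ ≤ ∏ j, ‖y * Complex.I - f j‖) :
    ∑ j, |(e j).re| ≤ ∑ j, (f j).re := by
  have hr (y r i : ℝ) : ‖y * Complex.I + ⟨|r|, -i⟩‖ = ‖y * Complex.I - ⟨r, i⟩‖ := by
    rw [Complex.norm_def, Complex.norm_def, Complex.normSq_apply, Complex.normSq_apply]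
    simp
    ring_nf
  refine sum_re_le_of_prod_norm_le (fun j => ⟨|(e j).re|, -(e j).im⟩)
    (fun j => ⟨(f j).re, -(f j).im⟩) hf fun y => ?_
  refine ((Finset.prod_congr rfl fun j _ => hr y (e j).re (e j).im).le.trans (h y)).trans
    (Finset.prod_congr rfl fun j _ => ?_).le
  have := hr y (f j).re (f j).im
  rw [abs_of_pos (hf j)] at this
  exact this.symm

end HalfPlane

section ZeroLocation

variable {ι : Type*} [Fintype ι]

lemma re_div_sub_sq (B d : ℝ) (w : ℂ) : ((B : ℂ) / (d - w) ^ 2).re =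
    B * ((d - w.re) ^ 2 - w.im ^ 2) / ((d - w.re) ^ 2 + w.im ^ 2) ^ 2 := by
  have h : Complex.normSq ((d - w) ^ 2) = ((d - w.re) ^ 2 + w.im ^ 2) ^ 2 := by
    rw [map_pow, Complex.normSq_apply]; simp; ring
  rw [Complex.div_re, h]
  simp [pow_two]

lemma im_div_sub_sq (B d : ℝ) (w : ℂ) : ((B : ℂ) / (d - w) ^ 2).im =
    w.im * (2 * (B * (d - w.re) / ((d - w.re) ^ 2 + w.im ^ 2) ^ 2)) := by
  have h : Complex.normSq ((d - w) ^ 2) = ((d - w.re) ^ 2 + w.im ^ 2) ^ 2 := by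
    rw [map_pow, Complex.normSq_apply]; simp; ring
  rw [Complex.div_im, h]
  simp [pow_two]
  ring

lemma one_add_sum_ne_zero {c B : ι → ℝ} (hc : ∀ i, 0 < c i) (hB : ∀ i, 0 ≤ B i) {w : ℂ}
    (hw : w.re ≤ 0) : 1 + ∑ i, (B i : ℂ) / (c i - w) ^ 2 ≠ 0 := by
  intro h
  have him := congrArg Complex.im h
  have hre := congrArg Complex.re h
  simp only [Complex.add_re, Complex.add_im, Complex.re_sum, Complex.im_sum, re_div_sub_sq,
    im_div_sub_sq, Complex.one_re, Complex.one_im, Complex.zero_re, Complex.zero_im,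
    ← Finset.mul_sum, zero_add, mul_eq_zero] at him hre
  have hp (i : ι) : 0 < c i - w.re := by linarith [hc i]
  rcases him with h0 | h0
  · have : 0 ≤ ∑ i, B i * ((c i - w.re) ^ 2 - w.im ^ 2) / ((c i - w.re) ^ 2 + w.im ^ 2) ^ 2 := by
      refine Finset.sum_nonneg fun i _ => ?_
      have := hB i
      rw [h0, zero_pow two_ne_zero, sub_zero]
      positivity
    linarith
  · rcases h0 with h0 | h0
    · norm_num at h0
    rw [Finset.sum_eq_zero_iff_of_nonneg] at h0
    · have hB0 (i : ι) : B i = 0 := by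
        have h1 := h0 i (Finset.mem_univ i)
        have h2 : 0 < ((c i - w.re) ^ 2 + w.im ^ 2) ^ 2 := by
          have := hp i; positivity
        rcases div_eq_zero_iff.1 h1 with h3 | h3
        · rcases mul_eq_zero.1 h3 with h4 | h4
          · exact h4
          · exact absurd h4 (hp i).ne'
        · exact absurd h3 h2.ne'
      simp [hB0] at hre
    · intro i _
      have := hp i
      have := hB i
      positivity

/-- The zeros of `1 + ∑ i, B i / (c i - w) ^ 2`, listed with multiplicity. -/
def IsZeroList (c B : ι → ℝ) (z : ι × Bool → ℂ) : Prop :=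
  ∀ w : ℂ, (∀ i, w ≠ c i) →
    ∏ j, (w - z j) = (∏ i, (w - c i) ^ 2) * (1 + ∑ i, (B i : ℂ) / (c i - w) ^ 2)

lemma IsZeroList.re_pos {c B : ι → ℝ} {z : ι × Bool → ℂ} (h : IsZeroList c B z)
    (hc : ∀ i, 0 < c i) (hB : ∀ i, 0 ≤ B i) (j : ι × Bool) : 0 < (z j).re := by
  by_contra! hj
  have hne (i : ι) : z j ≠ c i := by
    intro h0
    rw [h0, Complex.ofReal_re] at hj
    exact absurd (hc i) hj.not_gt
  have h1 := h (z j) hne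
  rw [Finset.prod_eq_zero (Finset.mem_univ j) (sub_self _), eq_comm, mul_eq_zero,
    Finset.prod_eq_zero_iff] at h1
  rcases h1 with ⟨i, _, h2⟩ | h2
  · exact hne i (sub_eq_zero.1 (pow_eq_zero_iff two_ne_zero |>.1 h2))
  · exact one_add_sum_ne_zero hc hB hj h2

lemma norm_one_add_sum_le {d B : ι → ℝ} (hB : ∀ i, 0 ≤ B i) (y : ℝ) :
    ‖1 + ∑ i, (B i : ℂ) / (d i - y * Complex.I) ^ 2‖ ≤
      ‖1 + ∑ i, (B i : ℂ) / ((|d i| : ℝ) - y * Complex.I) ^ 2‖ := by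
  rw [Complex.norm_def, Complex.norm_def]
  refine Real.sqrt_le_sqrt ?_
  rw [Complex.normSq_apply, Complex.normSq_apply]
  simp only [Complex.add_re, Complex.add_im, Complex.re_sum, Complex.im_sum, re_div_sub_sq,
    im_div_sub_sq, Complex.one_re, Complex.one_im, zero_add, ← Finset.mul_sum]
  simp only [Complex.mul_re, Complex.mul_im, Complex.ofReal_re, Complex.ofReal_im, Complex.I_re,
    Complex.I_im, mul_zero, mul_one, sub_zero, add_zero, sq_abs]
  refine add_le_add le_rfl ?_
  rw [← pow_two, ← pow_two]
  refine sq_le_sq.2 ?_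
  rw [abs_mul, abs_mul, abs_mul, abs_mul]
  refine mul_le_mul_of_nonneg_left (mul_le_mul_of_nonneg_left ?_ (abs_nonneg _)) (abs_nonneg _)
  refine (Finset.abs_sum_le_sum_abs _ _).trans ((Finset.sum_le_sum fun i _ => ?_).trans
    (le_abs_self _))
  rw [abs_div, abs_mul, abs_of_nonneg (hB i), abs_of_nonneg (sq_nonneg (d i ^ 2 + y ^ 2))]

variable [DecidableEq ι]

lemma sum_abs_re_sub_le {c B : ι → ℝ} {z : ι × Bool → ℂ} (h : IsZeroList c B z)
    (hB : ∀ i, 0 ≤ B i) {a : ℝ} (ha : ∀ i, a ≠ c i) :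
    ∑ j, |(z j).re - a| ≤ 2 * ∑ i, |c i - a| := by
  obtain ⟨f, hf, hfs, -⟩ := exists_zeros (fun i => |c i - a|) B
  have hd (i : ι) : 0 < |c i - a| := abs_pos.2 (sub_ne_zero.2 (ha i).symm)
  have hfp (j : ι × Bool) : 0 < (f j).re := IsZeroList.re_pos hf hd hB j
  have hre : ∑ j, (f j).re = 2 * ∑ i, |c i - a| := by
    have := congrArg Complex.re hfs
    simpa only [Complex.re_sum, Complex.mul_re, Complex.re_ofNat, Complex.im_ofNat, zero_mul,
      sub_zero, Complex.ofReal_re] using this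
  rw [← hre]
  have h1 := sum_abs_re_le_of_prod_norm_le (fun j => z j - a) f hfp fun y => ?_
  · simpa using h1
  have hya (i : ι) : (a + y * Complex.I : ℂ) ≠ c i := by
    intro h0
    have := congrArg Complex.re h0
    exact ha i (by simpa using this)
  have hyd (i : ι) : (y * Complex.I : ℂ) ≠ (|c i - a| : ℝ) := by
    intro h0
    have := congrArg Complex.re h0
    exact (hd i).ne (by simpa using this)
  have hl : ∏ j, ‖y * Complex.I - (z j - a)‖ = ‖∏ j, ((a + y * Complex.I) - z j)‖ := by
    rw [norm_prod]
    refine Finset.prod_congr rfl fun j _ => ?_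
    congr 1; ring
  have hr : ∏ j, ‖y * Complex.I - f j‖ = ‖∏ j, (y * Complex.I - f j)‖ := (norm_prod _ _).symm
  rw [hl, hr, h _ hya, hf _ hyd, norm_mul, norm_mul, norm_prod, norm_prod]
  have hsq (i : ι) : ‖((a : ℂ) + y * Complex.I - c i) ^ 2‖ =
      ‖((y : ℂ) * Complex.I - (|c i - a| : ℝ)) ^ 2‖ := by
    rw [norm_pow, norm_pow, ← Complex.normSq_eq_norm_sq, ← Complex.normSq_eq_norm_sq,
      Complex.normSq_apply, Complex.normSq_apply]
    simp
    ring
  rw [Finset.prod_congr rfl fun i _ => hsq i]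
  gcongr
  have := norm_one_add_sum_le (d := fun i => c i - a) hB y
  refine le_trans (le_of_eq ?_) this
  congr 2
  refine Finset.sum_congr rfl fun i _ => ?_
  congr 2
  push_cast
  ring

lemma sum_max_sub_re_le {c B : ι → ℝ} {z : ι × Bool → ℂ} (h : IsZeroList c B z)
    (hB : ∀ i, 0 ≤ B i) (hs : ∑ j, z j = 2 * ∑ i, (c i : ℂ)) {a : ℝ} (ha : ∀ i, a ≠ c i) :
    ∑ j, max (a - (z j).re) 0 ≤ 2 * ∑ i, max (a - c i) 0 := by
  have h1 := sum_abs_re_sub_le h hB ha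
  have h2 : ∑ j, (z j).re = 2 * ∑ i, c i := by
    have := congrArg Complex.re hs
    simpa only [Complex.re_sum, Complex.mul_re, Complex.re_ofNat, Complex.im_ofNat, zero_mul,
      sub_zero, Complex.ofReal_re] using this
  have h3 (t : ℝ) : max (a - t) 0 = (|t - a| + a - t) / 2 := by
    rcases le_total t a with h | h
    · rw [max_eq_left (by linarith), abs_of_nonpos (by linarith)]; ring
    · rw [max_eq_right (by linarith), abs_of_nonneg (by linarith)]; ring
  simp only [h3, ← Finset.sum_div, Finset.sum_sub_distrib, Finset.sum_add_distrib, h2,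
    Finset.sum_const, Finset.card_univ, Fintype.card_prod, Fintype.card_bool, nsmul_eq_mul]
  push_cast
  linarith

lemma sum_exp_neg_re_le {c B : ι → ℝ} {z : ι × Bool → ℂ} (h : IsZeroList c B z)
    (hB : ∀ i, 0 ≤ B i) (hs : ∑ j, z j = 2 * ∑ i, (c i : ℂ)) {x : ℝ} (hx : 0 < x) :
    ∑ j, exp (-(x * (z j).re)) ≤ 2 * ∑ i, exp (-(x * c i)) := by
  set F : ℝ → ℝ := fun u => (Set.Ioi (0 : ℝ)).indicator (fun u => u * exp (-(x * u))) u with hF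
  have hFm (u : ℝ) : F u = max u 0 * exp (-(x * u)) := by
    rcases lt_or_ge 0 u with hu | hu
    · simp [hF, hu, hu.le]
    · simp [hF, hu, hu.not_gt]
  have hFi : IntegrableOn (fun u : ℝ => u * exp (-(x * u))) (Set.Ioi 0) := by
    have := integrableOn_rpow_mul_exp_neg_mul_rpow (p := 1) (s := 1) (b := x) (by norm_num)
      one_pos hx
    simpa using this
  have hFint : Integrable F := hFi.integrable_indicator measurableSet_Ioi
  have hκ : 0 < ∫ u, F u := by
    have h1 : ∫ u, F u = ∫ u in Set.Ioi (0 : ℝ), u * exp (-(x * u)) :=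
      integral_indicator measurableSet_Ioi
    have h2 := Real.integral_rpow_mul_exp_neg_mul_Ioi (a := 2) (r := x) (by norm_num) hx
    have h3 : ∫ u in Set.Ioi (0 : ℝ), u * exp (-(x * u)) = (1 / x) ^ (2 : ℝ) * Gamma 2 := by
      rw [← h2]; norm_num
    rw [h1, h3]
    have := Real.Gamma_pos_of_pos (s := 2) (by norm_num)
    positivity
  have hshift (t a : ℝ) : max (a - t) 0 * exp (-(x * a)) = exp (-(x * t)) * F (a - t) := by
    rw [hFm, mul_left_comm, ← exp_add]
    congr 2
    ring
  have hfint (t : ℝ) : Integrable fun a => max (a - t) 0 * exp (-(x * a)) := by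
    simp only [hshift]
    exact (hFint.comp_sub_right t).const_mul _
  have hval (t : ℝ) : ∫ a, max (a - t) 0 * exp (-(x * a)) = exp (-(x * t)) * ∫ u, F u := by
    simp only [hshift]
    rw [integral_const_mul, integral_sub_right_eq_self F t]
  have hae : ∀ᵐ a : ℝ, ∀ i, a ≠ c i := by
    rw [ae_all_iff]
    exact fun i => Measure.ae_ne volume (c i)
  have key : ∫ a, ∑ j, max (a - (z j).re) 0 * exp (-(x * a)) ≤
      ∫ a, 2 * ∑ i, max (a - c i) 0 * exp (-(x * a)) := by
    refine integral_mono_ae (integrable_finsetSum _ fun j _ => hfint _)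
      ((integrable_finsetSum _ fun j _ => hfint _).const_mul _) ?_
    filter_upwards [hae] with a ha
    rw [← Finset.sum_mul, ← Finset.sum_mul, ← mul_assoc]
    gcongr
    exact sum_max_sub_re_le h hB hs ha
  rw [integral_finsetSum _ fun j _ => hfint _, integral_const_mul,
    integral_finsetSum _ fun j _ => hfint _] at key
  simp only [hval, ← Finset.sum_mul, ← mul_assoc] at key
  exact le_of_mul_le_mul_right key hκ

end ZeroLocation

section Frullani

variable {p q : ℂ}

lemma re_segment_ge (p q : ℂ) {θ : ℝ} (h0 : 0 ≤ θ) (h1 : θ ≤ 1) :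
    min p.re q.re ≤ (p + θ * (q - p)).re := by
  simp only [Complex.add_re, Complex.mul_re, Complex.ofReal_re, Complex.ofReal_im, zero_mul,
    sub_zero, Complex.sub_re]
  nlinarith [min_le_left p.re q.re, min_le_right p.re q.re]

lemma integrable_frullani_kernel (hp : 0 < p.re) (hq : 0 < q.re) :
    Integrable (fun y : ℝ × ℝ => (q - p) * Complex.exp (-(p + y.1 * (q - p)) * y.2))
      ((volume.restrict (Set.Ioc 0 1)).prod (volume.restrict (Set.Ioi 0))) := by
  have hm : 0 < min p.re q.re := lt_min hp hq
  have h1 : Integrable (fun _ : ℝ => ‖q - p‖) (volume.restrict (Set.Ioc (0 : ℝ) 1)) :=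
    integrable_const _
  have h2 : Integrable (fun x : ℝ => exp (-min p.re q.re * x)) (volume.restrict (Set.Ioi 0)) :=
    integrableOn_exp_mul_Ioi (by linarith) 0
  refine (h1.mul_prod h2).mono' (by fun_prop) ?_
  rw [Measure.prod_restrict]
  refine (ae_restrict_iff' (measurableSet_Ioc.prod measurableSet_Ioi)).2
    (Filter.Eventually.of_forall fun y hy => ?_)
  rw [norm_mul, Complex.norm_exp]
  gcongr
  have h3 := re_segment_ge p q hy.1.1.le hy.1.2
  have h4 : (0 : ℝ) < y.2 := hy.2
  rw [Complex.re_mul_ofReal, Complex.neg_re]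
  nlinarith

lemma intervalIntegral_frullani_kernel (p q : ℂ) {x : ℝ} (hx : 0 < x) :
    ∫ θ in Set.Ioc (0 : ℝ) 1, (q - p) * Complex.exp (-(p + θ * (q - p)) * x) =
      (Complex.exp (-p * x) - Complex.exp (-q * x)) / x := by
  have hx' : (x : ℂ) ≠ 0 := by exact_mod_cast hx.ne'
  rw [← intervalIntegral.integral_of_le zero_le_one]
  have hd (θ : ℝ) : HasDerivAt (fun θ : ℝ => -Complex.exp (-(p + θ * (q - p)) * x) / x)
      ((q - p) * Complex.exp (-(p + θ * (q - p)) * x)) θ := by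
    have h1 : HasDerivAt (fun θ : ℝ => -(p + θ * (q - p)) * x) (-(1 * (q - p)) * x) θ :=
      ((((Complex.ofRealCLM.hasDerivAt (x := θ)).mul_const (q - p)).const_add p).neg).mul_const _
    have h2 := h1.cexp.neg.div_const (x : ℂ)
    convert! h2 using 1
    field_simp
  rw [intervalIntegral.integral_eq_sub_of_hasDerivAt (fun θ _ => hd θ)
    (Continuous.intervalIntegrable (by fun_prop) _ _)]
  simp
  ring_nf

lemma integral_segment_div (hp : 0 < p.re) (hq : 0 < q.re) :
    ∫ θ in Set.Ioc (0 : ℝ) 1, (q - p) / (p + θ * (q - p)) = Complex.log q - Complex.log p := by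
  rw [← intervalIntegral.integral_of_le zero_le_one]
  have hpos {θ : ℝ} (hθ : θ ∈ Set.uIcc (0 : ℝ) 1) : 0 < (p + θ * (q - p)).re := by
    rw [Set.uIcc_of_le zero_le_one] at hθ
    exact (lt_min hp hq).trans_le (re_segment_ge p q hθ.1 hθ.2)
  have hd (θ : ℝ) (hθ : θ ∈ Set.uIcc (0 : ℝ) 1) :
      HasDerivAt (fun θ : ℝ => Complex.log (p + θ * (q - p)))
        ((q - p) / (p + θ * (q - p))) θ := by
    have h1 : HasDerivAt (fun θ : ℝ => p + θ * (q - p)) (1 * (q - p)) θ :=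
      ((Complex.ofRealCLM.hasDerivAt (x := θ)).mul_const (q - p)).const_add p
    rw [one_mul] at h1
    exact h1.clog_real (Or.inl (hpos hθ))
  rw [intervalIntegral.integral_eq_sub_of_hasDerivAt hd]
  · simp
  · refine ContinuousOn.intervalIntegrable (ContinuousOn.div (by fun_prop) (by fun_prop) ?_)
    intro θ hθ h0
    have := hpos hθ
    rw [h0] at this
    exact lt_irrefl _ this

lemma integrableOn_frullani (hp : 0 < p.re) (hq : 0 < q.re) :
    IntegrableOn (fun x : ℝ => (Complex.exp (-p * x) - Complex.exp (-q * x)) / x)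
      (Set.Ioi 0) := by
  refine (integrable_frullani_kernel hp hq).integral_prod_right.congr ?_
  refine (ae_restrict_iff' measurableSet_Ioi).2 (Filter.Eventually.of_forall fun x hx => ?_)
  exact intervalIntegral_frullani_kernel p q hx

lemma integral_frullani (hp : 0 < p.re) (hq : 0 < q.re) :
    ∫ x in Set.Ioi (0 : ℝ), (Complex.exp (-p * x) - Complex.exp (-q * x)) / x =
      Complex.log q - Complex.log p := by
  rw [← integral_segment_div hp hq]
  have h := integral_integral_swap (f := fun θ x : ℝ => (q - p) * Complex.exp (-(p + θ * (q - p)) * x))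
    (integrable_frullani_kernel hp hq)
  calc _ = ∫ x in Set.Ioi (0 : ℝ), ∫ θ in Set.Ioc (0 : ℝ) 1,
        (q - p) * Complex.exp (-(p + θ * (q - p)) * x) :=
        setIntegral_congr_fun measurableSet_Ioi fun x hx =>
          (intervalIntegral_frullani_kernel p q hx).symm
    _ = _ := h.symm
    _ = _ := setIntegral_congr_fun measurableSet_Ioc fun θ hθ => ?_
  have hpos : 0 < (p + θ * (q - p)).re :=
    (lt_min hp hq).trans_le (re_segment_ge p q hθ.1.le hθ.2)
  change ∫ x in Set.Ioi (0 : ℝ), (q - p) * Complex.exp (-(p + θ * (q - p)) * x) = _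
  rw [integral_const_mul,
    integral_exp_mul_complex_Ioi (by simpa only [Complex.neg_re, neg_lt_zero])]
  simp only [Complex.ofReal_zero, mul_zero, Complex.exp_zero, neg_div_neg_eq]
  rw [mul_one_div]

lemma exp_integral_frullani (hp : 0 < p.re) (hq : 0 < q.re) :
    Complex.exp (∫ x in Set.Ioi (0 : ℝ), (Complex.exp (-p * x) - Complex.exp (-q * x)) / x) =
      q / p := by
  have hne {z : ℂ} (hz : 0 < z.re) : z ≠ 0 := by
    rintro rfl
    exact lt_irrefl _ hz
  rw [integral_frullani hp hq, Complex.exp_sub, Complex.exp_log (hne hp), Complex.exp_log (hne hq)]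

end Frullani

section LevyMeasure

variable {ι : Type*} [Fintype ι]

/-- The density, up to the factor `1 / x`, of the Lévy measure with atoms at the points `c i`
and zeros `z`. -/
noncomputable def levyDensity (c : ι → ℝ) (z : ι × Bool → ℂ) (x : ℝ) : ℝ :=
  ∑ j, (exp (-(x * c j.1)) - (Complex.exp (-z j * x)).re)

lemma ofReal_levyDensity (c : ι → ℝ) {z : ι × Bool → ℂ}
    (hconj : ∀ g : ℂ → ℂ, ∑ j, g (starRingEnd ℂ (z j)) = ∑ j, g (z j)) (x : ℝ) :
    (levyDensity c z x : ℂ) = ∑ j, (Complex.exp (-(c j.1 : ℂ) * x) - Complex.exp (-z j * x)) := by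
  have h1 : starRingEnd ℂ (∑ j, Complex.exp (-z j * x)) = ∑ j, Complex.exp (-z j * x) := by
    rw [map_sum, ← hconj fun w => Complex.exp (-w * x)]
    refine Finset.sum_congr rfl fun j _ => ?_
    rw [← Complex.exp_conj]
    simp
  have h2 := Complex.conj_eq_iff_re.1 h1
  rw [Complex.re_sum] at h2
  rw [levyDensity, Finset.sum_sub_distrib, Finset.sum_sub_distrib, Complex.ofReal_sub, h2]
  push_cast
  congr 1
  refine Finset.sum_congr rfl fun j _ => ?_
  congr 1
  ring

lemma levyDensity_nonneg [DecidableEq ι] {c B : ι → ℝ} {z : ι × Bool → ℂ} (h : IsZeroList c B z)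
    (hB : ∀ i, 0 ≤ B i) (hs : ∑ j, z j = 2 * ∑ i, (c i : ℂ)) {x : ℝ} (hx : 0 < x) :
    0 ≤ levyDensity c z x := by
  rw [levyDensity, Finset.sum_sub_distrib, sub_nonneg]
  calc ∑ j, (Complex.exp (-z j * x)).re ≤ ∑ j, exp (-(x * (z j).re)) := by
        refine Finset.sum_le_sum fun j _ => (Complex.re_le_norm _).trans ?_
        rw [Complex.norm_exp, Complex.re_mul_ofReal, Complex.neg_re, neg_mul, mul_comm]
    _ ≤ 2 * ∑ i, exp (-(x * c i)) := sum_exp_neg_re_le h hB hs hx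
    _ = _ := by simp [Fintype.sum_prod_type, Finset.mul_sum]

lemma integrableOn_frullani_shift {p q w : ℂ} (hp : 0 < p.re) (hq : 0 < q.re) (hw : w.re ≤ 0) :
    IntegrableOn (fun x : ℝ => (Complex.exp (-p * x) - Complex.exp (-q * x)) / x *
      Complex.exp (w * x)) (Set.Ioi 0) := by
  refine (integrableOn_frullani (p := p - w) (q := q - w) (by simp; linarith)
    (by simp; linarith)).congr_fun (fun x _ => ?_) measurableSet_Ioi
  simp only
  rw [div_mul_eq_mul_div, sub_mul, ← Complex.exp_add, ← Complex.exp_add]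
  ring_nf

lemma exp_integral_frullani_shift {p q w : ℂ} (hp : 0 < p.re) (hq : 0 < q.re) (hw : w.re ≤ 0) :
    Complex.exp (∫ x in Set.Ioi (0 : ℝ), (Complex.exp (-p * x) - Complex.exp (-q * x)) / x *
      Complex.exp (w * x)) = (q - w) / (p - w) := by
  rw [← exp_integral_frullani (p := p - w) (q := q - w) (by simp; linarith) (by simp; linarith)]
  congr 1
  refine integral_congr_ae (Filter.Eventually.of_forall fun x => ?_)
  simp only
  rw [div_mul_eq_mul_div, sub_mul, ← Complex.exp_add, ← Complex.exp_add]
  ring_nf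

/-- The function `1 + ∑ i, B i / (c i - w) ^ 2` is the exponential of the Laplace transform of a
finite positive measure on the half-line. -/
lemma exists_levyMeasure {c B : ι → ℝ} (hc : ∀ i, 0 < c i) (hB : ∀ i, 0 ≤ B i) :
    ∃ ν : Measure ℝ, IsFiniteMeasure ν ∧ (∀ᵐ x ∂ν, 0 ≤ x) ∧ ∀ w : ℂ, w.re ≤ 0 →
      Complex.exp (∫ x : ℝ, Complex.exp (w * x) ∂ν) = 1 + ∑ i, (B i : ℂ) / (c i - w) ^ 2 := by
  classical
  obtain ⟨z, hz, hs, hconj⟩ := exists_zeros c B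
  have hzp (j : ι × Bool) : 0 < (z j).re := IsZeroList.re_pos hz hc hB j
  have hcp (i : ι) : 0 < ((c i : ℝ) : ℂ).re := hc i
  have hsum {w : ℂ} (x : ℝ) : ((levyDensity c z x / x : ℝ) : ℂ) * Complex.exp (w * x) =
      ∑ j, (Complex.exp (-(c j.1 : ℂ) * x) - Complex.exp (-z j * x)) / x *
        Complex.exp (w * x) := by
    rw [Complex.ofReal_div, ofReal_levyDensity c hconj, Finset.sum_div, Finset.sum_mul]
  have hfint : IntegrableOn (fun x : ℝ => levyDensity c z x / x) (Set.Ioi 0) := by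
    have h1 : IntegrableOn (fun x : ℝ => ((levyDensity c z x / x : ℝ) : ℂ) *
        Complex.exp ((0 : ℂ) * x)) (Set.Ioi 0) := by
      simp only [hsum]
      exact integrable_finsetSum _ fun j _ =>
        integrableOn_frullani_shift (hcp j.1) (hzp j) le_rfl
    have h2 := h1.re
    simpa [IntegrableOn] using h2
  have hmeas : Measurable (levyDensity c z) := by
    unfold levyDensity
    fun_prop
  refine ⟨(volume.restrict (Set.Ioi 0)).withDensity
    fun x => ENNReal.ofReal (levyDensity c z x / x), isFiniteMeasure_withDensity_ofReal hfint.2,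
    ?_, fun w hw => ?_⟩
  · exact (withDensity_absolutelyContinuous _ _).ae_le <|
      (ae_restrict_iff' measurableSet_Ioi).2 <| Filter.Eventually.of_forall fun x hx => le_of_lt hx
  have hwne (i : ι) : w ≠ c i := by
    rintro rfl
    rw [Complex.ofReal_re] at hw
    linarith [hc i]
  rw [integral_withDensity_eq_integral_toReal_smul (by fun_prop) (by simp)]
  have h1 : ∫ x in Set.Ioi (0 : ℝ), (ENNReal.ofReal (levyDensity c z x / x)).toReal •
      Complex.exp (w * x) = ∫ x in Set.Ioi (0 : ℝ),
        ∑ j, (Complex.exp (-(c j.1 : ℂ) * x) - Complex.exp (-z j * x)) / x *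
          Complex.exp (w * x) := by
    refine setIntegral_congr_fun measurableSet_Ioi fun x (hx : 0 < x) => ?_
    rw [← hsum, ENNReal.toReal_ofReal (div_nonneg (levyDensity_nonneg hz hB hs hx) hx.le)]
    rfl
  rw [h1, integral_finsetSum _ fun j _ => integrableOn_frullani_shift (hcp j.1) (hzp j) hw,
    Complex.exp_sum]
  simp only [exp_integral_frullani_shift (hcp _) (hzp _) hw]
  have h2 := hz w hwne
  have h3 : ∏ j : ι × Bool, (w - c j.1) = ∏ i, (w - c i) ^ 2 := by
    simp [Fintype.prod_prod_type, pow_two]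
  have h4 : ∏ i, (w - c i) ^ 2 ≠ 0 :=
    Finset.prod_ne_zero_iff.2 fun i _ => pow_ne_zero _ (sub_ne_zero.2 (hwne i))
  rw [← h3] at h2 h4
  rw [Finset.prod_congr rfl fun j _ => (neg_div_neg_eq (z j - w) (c j.1 - w)).symm]
  simp only [neg_sub]
  rw [Finset.prod_div_distrib, h2, mul_div_cancel_left₀ _ h4]

end LevyMeasure

section CompoundPoisson

instance isFiniteMeasure_convPow (ν : Measure ℝ) [IsFiniteMeasure ν] (n : ℕ) :
    IsFiniteMeasure (convPow ν n) := by
  induction n with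
  | zero => unfold convPow; infer_instance
  | succ n ih => unfold convPow; infer_instance

instance isProbabilityMeasure_convPow (ν : Measure ℝ) [IsProbabilityMeasure ν] (n : ℕ) :
    IsProbabilityMeasure (convPow ν n) := by
  induction n with
  | zero => unfold convPow; infer_instance
  | succ n ih => unfold convPow; infer_instance

lemma ae_nonneg_conv {μ ν : Measure ℝ} [SFinite μ] [SFinite ν] (hμ : ∀ᵐ x ∂μ, 0 ≤ x)
    (hν : ∀ᵐ x ∂ν, 0 ≤ x) : ∀ᵐ x ∂(μ.conv ν), 0 ≤ x := by
  rw [Measure.conv, ae_map_iff (by fun_prop) (measurableSet_le measurable_const measurable_id')]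
  filter_upwards [Measure.quasiMeasurePreserving_fst.ae hμ,
    Measure.quasiMeasurePreserving_snd.ae hν] with x h1 h2
  exact add_nonneg h1 h2

lemma ae_nonneg_convPow {ν : Measure ℝ} [IsFiniteMeasure ν] (hν : ∀ᵐ x ∂ν, 0 ≤ x) (n : ℕ) :
    ∀ᵐ x ∂(convPow ν n), 0 ≤ x := by
  induction n with
  | zero =>
    unfold convPow
    rw [ae_dirac_iff (measurableSet_le measurable_const measurable_id')]
  | succ n ih => exact ae_nonneg_conv ih hν

lemma integrable_cexp_mul {μ : Measure ℝ} [IsFiniteMeasure μ] (hμ : ∀ᵐ x ∂μ, 0 ≤ x) {w : ℂ}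
    (hw : w.re ≤ 0) : Integrable (fun x : ℝ => Complex.exp (w * x)) μ := by
  refine Integrable.of_bound (by fun_prop) 1 ?_
  filter_upwards [hμ] with x hx
  rw [Complex.norm_exp, Complex.re_mul_ofReal, Real.exp_le_one_iff]
  exact mul_nonpos_of_nonpos_of_nonneg hw hx

lemma integral_cexp_conv {μ ν : Measure ℝ} [IsFiniteMeasure μ] [IsFiniteMeasure ν]
    (hμ : ∀ᵐ x ∂μ, 0 ≤ x) (hν : ∀ᵐ x ∂ν, 0 ≤ x) {w : ℂ} (hw : w.re ≤ 0) :
    ∫ x : ℝ, Complex.exp (w * x) ∂(μ.conv ν) =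
      (∫ x : ℝ, Complex.exp (w * x) ∂μ) * ∫ x : ℝ, Complex.exp (w * x) ∂ν := by
  rw [integral_conv (integrable_cexp_mul (ae_nonneg_conv hμ hν) hw)]
  simp [mul_add, Complex.exp_add, integral_const_mul, integral_mul_const]

lemma integral_cexp_convPow {ν : Measure ℝ} [IsFiniteMeasure ν] (hν : ∀ᵐ x ∂ν, 0 ≤ x) {w : ℂ}
    (hw : w.re ≤ 0) (n : ℕ) :
    ∫ x : ℝ, Complex.exp (w * x) ∂(convPow ν n) = (∫ x : ℝ, Complex.exp (w * x) ∂ν) ^ n := by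
  induction n with
  | zero => simp [convPow]
  | succ n ih => rw [convPow, integral_cexp_conv (ae_nonneg_convPow hν n) hν hw, ih, pow_succ]

lemma charFun_convPow (ν : Measure ℝ) [IsFiniteMeasure ν] (n : ℕ) (t : ℝ) :
    charFun (convPow ν n) t = charFun ν t ^ n := by
  induction n with
  | zero => simp [convPow, charFun_apply]
  | succ n ih => rw [convPow, charFun_conv, ih, pow_succ]

lemma convPow_univ (ν : Measure ℝ) [IsFiniteMeasure ν] (n : ℕ) :
    convPow ν n Set.univ = ν Set.univ ^ n := by
  induction n with
  | zero => simp [convPow]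
  | succ n ih =>
    rw [convPow, Measure.conv, Measure.map_apply measurable_add MeasurableSet.univ,
      Set.preimage_univ, ← Set.univ_prod_univ, Measure.prod_prod, ih, pow_succ]

/-- The compound Poisson law with Lévy measure `ν`. -/
noncomputable def compoundPoisson (ν : Measure ℝ) : Measure ℝ :=
  Measure.sum fun n : ℕ =>
    ENNReal.ofReal (exp (-ν.real Set.univ) / n.factorial) • convPow ν n

instance isProbabilityMeasure_compoundPoisson (ν : Measure ℝ) [IsFiniteMeasure ν] :
    IsProbabilityMeasure (compoundPoisson ν) := by
  constructor
  have h := ProbabilityTheory.hasSum_one_poissonMeasure (ν.real Set.univ).toNNReal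
  rw [Real.coe_toNNReal _ measureReal_nonneg] at h
  rw [compoundPoisson, Measure.sum_apply _ MeasurableSet.univ]
  have h1 (n : ℕ) : (ENNReal.ofReal (exp (-ν.real Set.univ) / n.factorial) • convPow ν n) Set.univ =
      ENNReal.ofReal (exp (-ν.real Set.univ) * ν.real Set.univ ^ n / n.factorial) := by
    rw [Measure.smul_apply, convPow_univ, smul_eq_mul, mul_div_right_comm,
      ENNReal.ofReal_mul (by positivity), ENNReal.ofReal_pow measureReal_nonneg,
      ofReal_measureReal]
  simp only [h1]
  rw [← ENNReal.ofReal_tsum_of_nonneg (fun n => by positivity) h.summable, h.tsum_eq,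
    ENNReal.ofReal_one]

lemma ae_nonneg_compoundPoisson {ν : Measure ℝ} [IsFiniteMeasure ν] (hν : ∀ᵐ x ∂ν, 0 ≤ x) :
    ∀ᵐ x ∂(compoundPoisson ν), 0 ≤ x := by
  rw [compoundPoisson, Measure.ae_sum_iff]
  exact fun n => Measure.ae_smul_measure (ae_nonneg_convPow hν n) _

lemma integral_cexp_compoundPoisson {ν : Measure ℝ} [IsFiniteMeasure ν] (hν : ∀ᵐ x ∂ν, 0 ≤ x)
    {w : ℂ} (hw : w.re ≤ 0) :
    ∫ x : ℝ, Complex.exp (w * x) ∂(compoundPoisson ν) =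
      Complex.exp ((∫ x : ℝ, Complex.exp (w * x) ∂ν) - ν.real Set.univ) := by
  have h := hasSum_integral_measure (integrable_cexp_mul (ae_nonneg_compoundPoisson hν) hw)
  refine h.unique ?_
  have h1 := (NormedSpace.expSeries_div_hasSum_exp (∫ x : ℝ, Complex.exp (w * x) ∂ν)).mul_left
    (Complex.exp (-ν.real Set.univ))
  rw [← Complex.exp_eq_exp_ℂ, ← Complex.exp_add, neg_add_eq_sub] at h1
  refine Eq.subst (motive := fun f => HasSum f _) (funext fun n => ?_) h1
  rw [integral_smul_measure, integral_cexp_convPow hν hw,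
    ENNReal.toReal_ofReal (by positivity), Complex.real_smul]
  push_cast
  ring

/-- A law on the half-line all of whose convolution roots exist on the half-line. -/
def NonnegInfDiv (μ : Measure ℝ) : Prop :=
  ∀ n : ℕ, 0 < n → ∃ ν : Measure ℝ, IsProbabilityMeasure ν ∧ (∀ᵐ x ∂ν, 0 ≤ x) ∧ convPow ν n = μ

lemma charFun_eq_integral_cexp (μ : Measure ℝ) (t : ℝ) :
    charFun μ t = ∫ x : ℝ, Complex.exp ((t * Complex.I) * x) ∂μ := by
  rw [charFun_apply_real]
  congr with x
  ring_nf

lemma nonnegInfDiv_compoundPoisson {ν : Measure ℝ} [IsFiniteMeasure ν] (hν : ∀ᵐ x ∂ν, 0 ≤ x) :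
    NonnegInfDiv (compoundPoisson ν) := by
  intro n hn
  have hn' : (n : ℝ) ≠ 0 := by positivity
  set ν' : Measure ℝ := ENNReal.ofReal (n : ℝ)⁻¹ • ν with hν'
  have : IsFiniteMeasure ν' := Measure.smul_finite ν ENNReal.ofReal_ne_top
  have hν'0 : ∀ᵐ x ∂ν', 0 ≤ x := Measure.ae_smul_measure hν _
  refine ⟨compoundPoisson ν', inferInstance, ae_nonneg_compoundPoisson hν'0, ?_⟩
  refine Measure.ext_of_charFun (funext fun t => ?_)
  have hw : (t * Complex.I : ℂ).re ≤ 0 := by simp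
  rw [charFun_convPow, charFun_eq_integral_cexp, charFun_eq_integral_cexp,
    integral_cexp_compoundPoisson hν'0 hw, integral_cexp_compoundPoisson hν hw, ← Complex.exp_nat_mul,
    hν', integral_smul_measure, measureReal_ennreal_smul_apply,
    ENNReal.toReal_ofReal (by positivity), Complex.real_smul]
  congr 1
  have : (n : ℂ) ≠ 0 := by exact_mod_cast hn'
  push_cast
  field_simp

/-- The functions `1 + ∑ i, B i / (c i - w) ^ 2` normalised at `0` are Laplace transforms of
infinitely divisible laws. -/
lemma exists_nonnegInfDiv_of_finite_mixture {ι : Type*} [Fintype ι] {c B : ι → ℝ}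
    (hc : ∀ i, 0 < c i) (hB : ∀ i, 0 ≤ B i) :
    ∃ μ : Measure ℝ, IsProbabilityMeasure μ ∧ NonnegInfDiv μ ∧ ∀ t : ℝ,
      charFun μ t = (1 + ∑ i, (B i : ℂ) / (c i - t * Complex.I) ^ 2) /
        (1 + ∑ i, (B i : ℂ) / c i ^ 2) := by
  obtain ⟨ν, hfin, hν, h⟩ := exists_levyMeasure hc hB
  refine ⟨compoundPoisson ν, inferInstance, nonnegInfDiv_compoundPoisson hν, fun t => ?_⟩
  have hw : (t * Complex.I : ℂ).re ≤ 0 := by simp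
  have h0 := h 0 le_rfl
  simp only [zero_mul, Complex.exp_zero, integral_const, sub_zero, Complex.real_smul,
    mul_one] at h0
  rw [charFun_eq_integral_cexp, integral_cexp_compoundPoisson hν hw, Complex.exp_sub, h _ hw, h0]

end CompoundPoisson

section Closure

open Filter Topology

lemma measure_Ioi_le_convPow {ν : Measure ℝ} [IsProbabilityMeasure ν] (hν : ∀ᵐ x ∂ν, 0 ≤ x)
    {n : ℕ} (hn : 0 < n) (R : ℝ) : ν (Set.Ioi R) ≤ convPow ν n (Set.Ioi R) := by
  obtain ⟨m, rfl⟩ := Nat.exists_eq_succ_of_ne_zero hn.ne'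
  rw [convPow, Measure.conv, Measure.map_apply measurable_add measurableSet_Ioi]
  calc ν (Set.Ioi R) = ((convPow ν m).prod ν) (Set.univ ×ˢ Set.Ioi R) := by
        rw [Measure.prod_prod, measure_univ, one_mul]
    _ ≤ _ := by
      refine measure_mono_ae ?_
      filter_upwards [Measure.quasiMeasurePreserving_fst.ae (ae_nonneg_convPow hν m)] with x hx hxR
      have h1 : R < x.2 := hxR.2
      change R < x.1 + x.2
      linarith

/-- Infinite divisibility on the half-line is preserved by pointwise limits of characteristic
functions. -/
lemma NonnegInfDiv.of_tendsto_charFun {μs : ℕ → Measure ℝ} [∀ k, IsProbabilityMeasure (μs k)]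
    (hμs : ∀ k, NonnegInfDiv (μs k)) {μ : Measure ℝ} [IsProbabilityMeasure μ]
    (h : ∀ t, Tendsto (fun k => charFun (μs k) t) atTop (𝓝 (charFun μ t))) : NonnegInfDiv μ := by
  intro n hn
  choose νs hprob hpos hconv using fun k => hμs k n hn
  have htight : IsTightMeasureSet (Set.range μs) :=
    isTightMeasureSet_of_tendsto_charFun (by fun_prop) h
  set νp : ℕ → ProbabilityMeasure ℝ := fun k => ⟨νs k, hprob k⟩ with hνp
  have htight' : IsTightMeasureSet {((ρ : ProbabilityMeasure ℝ) : Measure ℝ) | ρ ∈ Set.range νp} := by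
    rw [isTightMeasureSet_iff_exists_isCompact_measure_compl_le] at htight ⊢
    intro ε hε
    obtain ⟨K, hK, hKle⟩ := htight ε hε
    obtain ⟨R, hR⟩ := hK.isBounded.subset_closedBall 0
    refine ⟨Set.Icc 0 R, isCompact_Icc, ?_⟩
    rintro _ ⟨_, ⟨k, rfl⟩, rfl⟩
    calc νs k (Set.Icc 0 R)ᶜ ≤ νs k (Set.Ioi R) := by
          refine measure_mono_ae ?_
          filter_upwards [hpos k] with x hx hxR
          by_contra hxR'
          exact hxR ⟨hx, not_lt.1 hxR'⟩
      _ ≤ μs k (Set.Ioi R) := by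
          rw [← hconv k]
          exact measure_Ioi_le_convPow (hpos k) hn R
      _ ≤ μs k Kᶜ := by
          refine measure_mono fun x (hx : R < x) hxK => ?_
          have := hR hxK
          rw [mem_closedBall_zero_iff, Real.norm_eq_abs] at this
          linarith [le_abs_self x]
      _ ≤ ε := hKle _ ⟨k, rfl⟩
  obtain ⟨ν, -, φ, hφ, hlim⟩ := (isCompact_closure_of_isTightMeasureSet htight').tendsto_subseq
    (x := νp) fun k => subset_closure ⟨k, rfl⟩
  refine ⟨ν, inferInstance, ?_, ?_⟩
  · have h1 := ProbabilityMeasure.le_liminf_measure_open_of_tendsto hlim (isOpen_Iio (a := (0 : ℝ)))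
    have h2 (k : ℕ) : ((νp ∘ φ) k : Measure ℝ) (Set.Iio 0) = 0 := by
      have : {x : ℝ | ¬ 0 ≤ x} = Set.Iio 0 := by ext; simp
      rw [← this]
      exact hpos (φ k)
    simp only [h2, liminf_const, nonpos_iff_eq_zero] at h1
    rw [ae_iff]
    convert! h1 using 2
    ext
    simp
  · refine Measure.ext_of_charFun (funext fun t => ?_)
    rw [charFun_convPow]
    have h1 := (ProbabilityMeasure.tendsto_iff_tendsto_charFun.1 hlim t).pow n
    refine tendsto_nhds_unique h1 (((h t).comp hφ.tendsto_atTop).congr fun k => ?_)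
    change charFun (μs (φ k)) t = charFun (νs (φ k)) t ^ n
    rw [← hconv, charFun_convPow]

end Closure

section GammaMixture

open Filter Topology

/-- The characteristic function of the Gamma law with shape `2` and scale `y`, at `t`. -/
noncomputable def gammaTwoChar (y t : ℝ) : ℂ := 1 / (1 - t * y * Complex.I) ^ 2

lemma one_sub_mul_I_ne_zero (a : ℝ) : (1 : ℂ) - a * Complex.I ≠ 0 := by
  intro h
  have := congrArg Complex.re h
  simp at this

lemma norm_gammaTwoChar_le (y t : ℝ) : ‖gammaTwoChar y t‖ ≤ 1 := by
  have h : 1 ≤ ‖(1 : ℂ) - t * y * Complex.I‖ := by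
    refine le_trans ?_ (Complex.abs_re_le_norm _)
    simp
  rw [gammaTwoChar, norm_div, norm_one, norm_pow]
  exact div_le_one_of_le₀ (one_le_pow₀ h) (by positivity)

lemma continuous_gammaTwoChar (t : ℝ) : Continuous fun y => gammaTwoChar y t := by
  unfold gammaTwoChar
  refine Continuous.div (by fun_prop) (by fun_prop) fun y => pow_ne_zero _ ?_
  exact_mod_cast one_sub_mul_I_ne_zero (t * y)

lemma integrable_gammaTwoChar {Ω : Type*} [MeasurableSpace Ω] (ρ : Measure Ω) [IsFiniteMeasure ρ]
    {f : Ω → ℝ} (hf : Measurable f) (t : ℝ) : Integrable (fun x => gammaTwoChar (f x) t) ρ :=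
  Integrable.of_bound ((continuous_gammaTwoChar t).measurable.comp hf).aestronglyMeasurable 1
    (Eventually.of_forall fun _ => norm_gammaTwoChar_le _ _)

lemma exists_nonnegInfDiv_of_finite_gamma_mixture {ι : Type*} [Fintype ι] {p v : ι → ℝ} {p₀ : ℝ}
    (hp₀ : 0 < p₀) (hp : ∀ i, 0 ≤ p i) (hv : ∀ i, 0 < v i) (hsum : p₀ + ∑ i, p i = 1) :
    ∃ μ : Measure ℝ, IsProbabilityMeasure μ ∧ NonnegInfDiv μ ∧ ∀ t : ℝ,
      charFun μ t = p₀ + ∑ i, p i * gammaTwoChar (v i) t := by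
  obtain ⟨μ, hμ, hdiv, h⟩ := exists_nonnegInfDiv_of_finite_mixture
    (c := fun i => (v i)⁻¹) (B := fun i => p i * (v i)⁻¹ ^ 2 / p₀) (fun i => inv_pos.2 (hv i))
    (fun i => by have := hp i; positivity)
  refine ⟨μ, hμ, hdiv, fun t => ?_⟩
  have hp₀' : (p₀ : ℂ) ≠ 0 := by exact_mod_cast hp₀.ne'
  have hv' (i : ι) : (v i : ℂ) ≠ 0 := by exact_mod_cast (hv i).ne'
  have h1 (t : ℝ) (i : ι) : ((p i * (v i)⁻¹ ^ 2 / p₀ : ℝ) : ℂ) /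
      (((v i)⁻¹ : ℝ) - t * Complex.I) ^ 2 = (p i * gammaTwoChar (v i) t) / p₀ := by
    have h2 : ((v i)⁻¹ : ℂ) - t * Complex.I = (v i : ℂ)⁻¹ * (1 - t * v i * Complex.I) := by
      have := hv' i
      field_simp
    have h3 : (1 : ℂ) - t * v i * Complex.I ≠ 0 := by
      exact_mod_cast one_sub_mul_I_ne_zero (t * v i)
    have h4 := hv' i
    push_cast
    rw [h2, gammaTwoChar]
    field_simp
  have h5 (t : ℝ) : (1 : ℂ) + ∑ i, ((p i * (v i)⁻¹ ^ 2 / p₀ : ℝ) : ℂ) /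
      (((v i)⁻¹ : ℝ) - t * Complex.I) ^ 2 =
      (p₀ + ∑ i, p i * gammaTwoChar (v i) t) / p₀ := by
    simp only [h1]
    rw [← Finset.sum_div, add_div, div_self hp₀']
  have h6 := h5 0
  have h7 : (p₀ : ℂ) + ∑ i, (p i : ℂ) = 1 := by exact_mod_cast hsum
  simp only [gammaTwoChar, Complex.ofReal_zero, zero_mul, sub_zero, one_pow, div_one, mul_one,
    h7] at h6
  rw [h t, h5, h6]
  field_simp

lemma integral_comp_simpleFunc {Ω : Type*} [MeasurableSpace Ω] (ρ : Measure Ω) [IsFiniteMeasure ρ]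
    (f : SimpleFunc Ω ℝ) (G : ℝ → ℂ) :
    ∫ x, G (f x) ∂ρ = ∑ v : f.range, (ρ.real (f ⁻¹' {(v : ℝ)}) : ℂ) * G v := by
  have h (x : Ω) : G (f x) = ∑ v ∈ f.range, (f ⁻¹' {v}).indicator (fun _ => G v) x := by
    rw [Finset.sum_eq_single (f x)]
    · simp
    · intro v _ hv
      simp [Set.indicator, hv.symm]
    · intro h
      exact absurd (f.mem_range_self x) h
  simp only [h]
  rw [integral_finsetSum _ fun v _ => (integrable_const _).indicator (f.measurableSet_fiber v),
    Finset.sum_coe_sort f.range fun v => (ρ.real (f ⁻¹' {v}) : ℂ) * G v]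
  refine Finset.sum_congr rfl fun v _ => ?_
  rw [integral_indicator_const _ (f.measurableSet_fiber v), Complex.real_smul]

lemma exists_nonnegInfDiv_of_simpleFunc (ρ : Measure ℝ) [IsProbabilityMeasure ρ]
    {f : SimpleFunc ℝ ℝ} (hf : ∀ x, 0 ≤ f x) {ε p₀ : ℝ} (hε : 0 < ε) (hp₀ : 0 < p₀)
    (hp₁ : p₀ ≤ 1) :
    ∃ μ : Measure ℝ, IsProbabilityMeasure μ ∧ NonnegInfDiv μ ∧ ∀ t : ℝ,
      charFun μ t = p₀ + (1 - p₀) * ∫ x, gammaTwoChar (f x + ε) t ∂ρ := by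
  have hv (v : f.range) : 0 < (v : ℝ) + ε := by
    obtain ⟨x, hx⟩ := SimpleFunc.mem_range.1 v.2
    have := hf x
    rw [← hx]
    positivity
  have hsum : p₀ + ∑ v : f.range, (1 - p₀) * ρ.real (f ⁻¹' {(v : ℝ)}) = 1 := by
    have h1 := integral_comp_simpleFunc ρ f fun _ => 1
    simp only [integral_const, probReal_univ, one_smul, mul_one] at h1
    have h2 : (1 : ℝ) = ∑ v : f.range, ρ.real (f ⁻¹' {(v : ℝ)}) := by exact_mod_cast h1
    rw [← Finset.mul_sum, ← h2]
    ring
  obtain ⟨μ, hμ, hdiv, h⟩ := exists_nonnegInfDiv_of_finite_gamma_mixture hp₀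
    (fun v : f.range => mul_nonneg (by linarith) measureReal_nonneg) hv hsum
  refine ⟨μ, hμ, hdiv, fun t => ?_⟩
  rw [h, integral_comp_simpleFunc ρ f fun y => gammaTwoChar (y + ε) t, Finset.mul_sum]
  push_cast
  simp only [mul_assoc]

/-- Mixtures of Gamma laws with shape `2` are infinitely divisible. -/
lemma NonnegInfDiv.of_charFun_eq_integral {ρ : Measure ℝ} [IsProbabilityMeasure ρ]
    (hρ : ∀ᵐ z ∂ρ, 0 ≤ z) {μ : Measure ℝ} [IsProbabilityMeasure μ]
    (h : ∀ t, charFun μ t = ∫ z, gammaTwoChar z t ∂ρ) : NonnegInfDiv μ := by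
  set f : ℕ → SimpleFunc ℝ ℝ :=
    SimpleFunc.approxOn id measurable_id (Set.Ici 0) 0 Set.self_mem_Ici with hf
  have hf0 (k : ℕ) (x : ℝ) : 0 ≤ f k x :=
    SimpleFunc.approxOn_mem measurable_id Set.self_mem_Ici k x
  have hlim : Tendsto (fun k : ℕ => 1 / ((k : ℝ) + 1)) atTop (𝓝 0) :=
    tendsto_one_div_add_atTop_nhds_zero_nat
  choose μs hprob hdiv hchar using fun k : ℕ =>
    exists_nonnegInfDiv_of_simpleFunc ρ (hf0 k) (ε := 1 / ((k : ℝ) + 1)) (p₀ := 1 / ((k : ℝ) + 1))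
      (by positivity) (by positivity) (by
        rw [div_le_one (by positivity)]
        linarith [(Nat.cast_nonneg k : (0 : ℝ) ≤ k)])
  refine NonnegInfDiv.of_tendsto_charFun hdiv fun t => ?_
  simp only [hchar, h]
  have hI : Tendsto (fun k : ℕ => ∫ x, gammaTwoChar (f k x + 1 / ((k : ℝ) + 1)) t ∂ρ) atTop
      (𝓝 (∫ z, gammaTwoChar z t ∂ρ)) := by
    refine tendsto_integral_of_dominated_convergence (fun _ => 1) (fun k => ?_)
      (integrable_const _) (fun k => Eventually.of_forall fun x => norm_gammaTwoChar_le _ _) ?_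
    · exact (integrable_gammaTwoChar ρ ((f k).measurable.add_const _) t).1
    · filter_upwards [hρ] with x hx
      have h1 : Tendsto (fun k => f k x) atTop (𝓝 x) :=
        SimpleFunc.tendsto_approxOn measurable_id Set.self_mem_Ici (subset_closure hx)
      have h2 := h1.add hlim
      rw [add_zero] at h2
      exact ((continuous_gammaTwoChar t).tendsto x).comp h2
  have hlim' : Tendsto (fun k : ℕ => ((1 / ((k : ℝ) + 1) : ℝ) : ℂ)) atTop (𝓝 0) := by
    have := (Complex.continuous_ofReal.tendsto 0).comp hlim
    rwa [Complex.ofReal_zero] at this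
  have h3 := hlim'.add (((tendsto_const_nhds (x := (1 : ℂ))).sub hlim').mul hI)
  simpa using h3

end GammaMixture

section Cauchy

open ProbabilityTheory Set FourierTransform

lemma integral_cauchyMeasure (f : ℝ → ℂ) :
    ∫ x, f x ∂cauchyMeasure 0 1 = ∫ x : ℝ, ((π⁻¹ * (1 + x ^ 2)⁻¹ : ℝ) : ℂ) * f x := by
  rw [cauchyMeasure_of_scale_ne_zero 0 one_ne_zero,
    integral_withDensity_eq_integral_toReal_smul (by fun_prop) (by simp [cauchyPDF])]
  refine integral_congr_ae (.of_forall fun x => ?_)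
  dsimp only
  rw [cauchyPDF, ENNReal.toReal_ofReal (cauchyPDF_pos 0 one_ne_zero x).le, cauchyPDFReal_def',
    Complex.real_smul]
  simp

lemma integral_eq_integral_Ioi_add_neg {f : ℝ → ℂ} (hf : Integrable f) :
    ∫ x, f x = (∫ x in Ioi 0, f x) + ∫ x in Ioi 0, f (-x) := by
  rw [integral_comp_neg_Ioi, neg_zero, add_comm,
    intervalIntegral.integral_Iic_add_Ioi hf.integrableOn hf.integrableOn]

lemma integrable_exp_neg_mul_abs {b : ℝ} (hb : 0 < b) :
    Integrable fun x : ℝ => ((rexp (-(b * |x|)) : ℝ) : ℂ) := by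
  suffices h : Integrable fun x : ℝ => rexp (-(b * |x|)) from h.ofReal
  rw [← integrableOn_univ, ← Iic_union_Ioi (a := (0 : ℝ))]
  refine IntegrableOn.union ?_ ?_
  · refine (integrableOn_exp_mul_Iic hb 0).congr_fun (fun x hx => ?_) measurableSet_Iic
    simp [abs_of_nonpos (mem_Iic.1 hx)]
  · refine (integrableOn_exp_mul_Ioi (neg_neg_of_pos hb) 0).congr_fun (fun x hx => ?_)
      measurableSet_Ioi
    simp [abs_of_pos (mem_Ioi.1 hx)]

lemma fourier_exp_neg_abs (w : ℝ) :
    𝓕 (fun x : ℝ => ((rexp (-(2 * π * |x|)) : ℝ) : ℂ)) w = ((π⁻¹ * (1 + w ^ 2)⁻¹ : ℝ) : ℂ) := by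
  have hf := integrable_exp_neg_mul_abs (b := 2 * π) (by positivity)
  have h1 (s : ℝ) : ∫ x in Ioi (0 : ℝ), Complex.exp ((-2 * π * (1 + s * Complex.I)) * x) =
      1 / (2 * π * (1 + s * Complex.I)) := by
    rw [integral_exp_mul_complex_Ioi (by simp [pi_pos])]
    simp
  have hπ : (π : ℂ) ≠ 0 := by exact_mod_cast pi_ne_zero
  have hp : (1 : ℂ) + w * Complex.I ≠ 0 := by simpa using one_sub_mul_I_ne_zero (-w)
  have hm := one_sub_mul_I_ne_zero w
  have hq : (1 : ℂ) + w ^ 2 ≠ 0 := by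
    have : (1 : ℂ) + w ^ 2 = (1 + w * Complex.I) * (1 - w * Complex.I) := by
      ring_nf
      simp
    rw [this]
    exact mul_ne_zero hp hm
  rw [fourier_real_eq_integral_exp_smul, integral_eq_integral_Ioi_add_neg]
  · have e1 := h1 w
    have e2 := h1 (-w)
    push_cast at e2
    trans 1 / (2 * π * (1 + w * Complex.I)) + 1 / (2 * π * (1 + -w * Complex.I))
    · rw [← e1, ← e2]
      congr 1 <;>
      · refine setIntegral_congr_fun measurableSet_Ioi fun x hx => ?_
        rw [smul_eq_mul, Complex.ofReal_exp, ← Complex.exp_add]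
        try rw [abs_neg]
        rw [abs_of_pos hx]
        congr 1
        push_cast
        ring
    · push_cast
      rw [show (1 : ℂ) + -w * Complex.I = 1 - w * Complex.I by ring]
      field_simp
      ring_nf
      simp
  · refine (integrable_exp_neg_mul_abs (b := 2 * π) (by positivity)).bdd_mul (c := 1)
      (by fun_prop) (.of_forall fun x => ?_)
    rw [Complex.norm_exp_ofReal_mul_I]

lemma charFun_cauchyMeasure (t : ℝ) : charFun (cauchyMeasure 0 1) t = (rexp (-|t|) : ℝ) := by
  have hf := integrable_exp_neg_mul_abs (b := 2 * π) (by positivity)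
  have hF : 𝓕 (fun x : ℝ => ((rexp (-(2 * π * |x|)) : ℝ) : ℂ)) =
      fun w : ℝ => ((π⁻¹ * (1 + w ^ 2)⁻¹ : ℝ) : ℂ) := funext fourier_exp_neg_abs
  have h := Continuous.fourierInv_fourier_eq (by fun_prop) hf (by
    rw [hF]
    exact (integrable_inv_one_add_sq.const_mul _).ofReal)
  have h1 := congrFun h (t / (2 * π))
  rw [hF, fourierInv_eq'] at h1
  rw [charFun_apply_real, integral_cauchyMeasure]
  have h2 : 2 * π * |t / (2 * π)| = |t| := by
    rw [abs_div, abs_of_pos (two_pi_pos)]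
    field_simp
  rw [h2] at h1
  rw [← h1]
  refine integral_congr_ae (.of_forall fun x => ?_)
  dsimp only
  rw [smul_eq_mul, mul_comm]
  congr 2
  simp
  field_simp

lemma integrableOn_mul_cexp {z : ℂ} (hz : 0 < z.re) :
    IntegrableOn (fun x : ℝ => x * Complex.exp (-z * x)) (Ioi 0) := by
  have h := integrableOn_rpow_mul_exp_neg_mul_rpow (p := 1) (s := 1) (by norm_num) one_pos hz
  refine Integrable.mono' h (by fun_prop) ?_
  filter_upwards [ae_restrict_mem measurableSet_Ioi] with x hx
  rw [norm_mul, Complex.norm_exp, Complex.norm_real, norm_of_nonneg (le_of_lt hx), rpow_one]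
  simp

lemma integral_mul_cexp {z : ℂ} (hz : 0 < z.re) :
    ∫ x : ℝ in Ioi 0, x * Complex.exp (-z * x) = 1 / z ^ 2 := by
  have hz0 : z ≠ 0 := by
    rintro rfl
    simp at hz
  have hd (x : ℝ) : HasDerivAt (fun x : ℝ => -(x / z + 1 / z ^ 2) * Complex.exp (-z * x))
      (x * Complex.exp (-z * x)) x := by
    have h1 : HasDerivAt (fun x : ℝ => (x : ℂ)) 1 x := Complex.ofRealCLM.hasDerivAt
    convert! ((h1.div_const z).add_const (1 / z ^ 2)).neg.mul (h1.const_mul (-z)).cexp using 1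
    simp
    field_simp
    ring
  have hlim : Filter.Tendsto (fun x : ℝ => -(x / z + 1 / z ^ 2) * Complex.exp (-z * x))
      Filter.atTop (nhds 0) := by
    have hl (n : ℕ) : Filter.Tendsto (fun x : ℝ => (x : ℂ) ^ n * Complex.exp (-z * x))
        Filter.atTop (nhds 0) := by
      rw [tendsto_zero_iff_norm_tendsto_zero]
      refine (tendsto_rpow_mul_exp_neg_mul_atTop_nhds_zero n z.re hz).congr' ?_
      filter_upwards [Filter.eventually_ge_atTop 0] with x hx
      rw [norm_mul, norm_pow, Complex.norm_exp, Complex.norm_real, norm_of_nonneg hx, rpow_natCast]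
      simp
    have := ((hl 1).const_mul (-1 / z)).add ((hl 0).const_mul (-1 / z ^ 2))
    simp only [mul_zero, add_zero] at this
    refine this.congr fun x => ?_
    ring
  rw [integral_Ioi_of_hasDerivAt_of_tendsto (hd 0).continuousAt.continuousWithinAt
    (fun x _ => hd x) (integrableOn_mul_cexp hz) hlim]
  simp

lemma integral_mul_exp_mul_one_sub_cos {x : ℝ} (hx : 0 < x) :
    IntegrableOn (fun c => x * rexp (-c * x) * (1 - cos c)) (Ioi 0) ∧
    ∫ c in Ioi 0, x * rexp (-c * x) * (1 - cos c) = (1 + x ^ 2)⁻¹ := by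
  have hre (s : ℝ) : (-x + s * Complex.I).re < 0 := by simpa
  have hI (s : ℝ) := integrableOn_exp_mul_complex_Ioi (hre s) 0
  have hV (s : ℝ) := integral_exp_mul_complex_Ioi (hre s) 0
  have hne (s : ℝ) : -(x : ℂ) + s * Complex.I ≠ 0 := fun h => by
    have := hre s
    rw [h] at this
    simp at this
  have key (c : ℝ) : ((x * rexp (-c * x) * (1 - cos c) : ℝ) : ℂ) =
      x * (Complex.exp ((-x + (0 : ℝ) * Complex.I) * c) -
        (Complex.exp ((-x + (1 : ℝ) * Complex.I) * c) +
          Complex.exp ((-x + (-1 : ℝ) * Complex.I) * c)) / 2) := by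
    have e1 : (-x + (1 : ℝ) * Complex.I) * c = -c * x + c * Complex.I := by push_cast; ring
    have e2 : (-x + (-1 : ℝ) * Complex.I) * c = -c * x + -c * Complex.I := by push_cast; ring
    have e3 : (-x + (0 : ℝ) * Complex.I) * c = -c * x := by push_cast; ring
    rw [e1, e2, e3, Complex.exp_add, Complex.exp_add]
    push_cast
    rw [Complex.cos]
    ring
  have h4 : IntegrableOn (fun c : ℝ => (Complex.exp ((-x + (1 : ℝ) * Complex.I) * c) +
      Complex.exp ((-x + (-1 : ℝ) * Complex.I) * c)) / 2) (Ioi 0) :=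
    ((hI 1).add (hI (-1))).div_const 2
  have hfint : IntegrableOn (fun c => ((x * rexp (-c * x) * (1 - cos c) : ℝ) : ℂ)) (Ioi 0) := by
    simp only [key]
    exact ((hI 0).sub h4).const_mul _
  refine ⟨hfint.re, ?_⟩
  have h : ((∫ c in Ioi 0, x * rexp (-c * x) * (1 - cos c) : ℝ) : ℂ) =
      (((1 + x ^ 2)⁻¹ : ℝ) : ℂ) := by
    rw [← integral_complex_ofReal]
    simp only [key]
    rw [integral_const_mul, integral_sub (hI 0) h4,
      integral_div, integral_add (hI 1) (hI (-1)), hV, hV, hV]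
    have h0 := hne 0
    have h1 := hne 1
    have h2 := hne (-1)
    have h3 : (1 : ℂ) + x ^ 2 ≠ 0 := by
      exact_mod_cast (by positivity : (1 : ℝ) + x ^ 2 ≠ 0)
    push_cast at h0 h1 h2 ⊢
    simp only [zero_mul, add_zero, mul_zero, Complex.exp_zero] at h0 ⊢
    have hx' : (x : ℂ) ≠ 0 := by exact_mod_cast hx.ne'
    have hA : -1 / (-(x : ℂ) + 1 * Complex.I) = (x + Complex.I) / (1 + x ^ 2) := by
      rw [div_eq_div_iff h1 h3]
      linear_combination -Complex.I_sq
    have hB : -1 / (-(x : ℂ) + -1 * Complex.I) = (x - Complex.I) / (1 + x ^ 2) := by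
      rw [div_eq_div_iff h2 h3]
      linear_combination -Complex.I_sq
    rw [hA, hB]
    field_simp
    ring
  exact_mod_cast h

end Cauchy

section HalfCauchy

open ProbabilityTheory Set

lemma integrable_halfCauchy_kernel (t : ℝ) :
    Integrable (fun p : ℝ × ℝ => Complex.exp (t * p.1 * Complex.I) *
      ((p.1 * rexp (-p.2 * p.1) * (1 - cos p.2) : ℝ) : ℂ))
      ((volume.restrict (Ioi 0)).prod (volume.restrict (Ioi 0))) := by
  have hn (x c : ℝ) (hx : 0 < x) : ‖Complex.exp (t * x * Complex.I) *
      ((x * rexp (-c * x) * (1 - cos c) : ℝ) : ℂ)‖ = x * rexp (-c * x) * (1 - cos c) := by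
    rw [← Complex.ofReal_mul, norm_mul, Complex.norm_exp_ofReal_mul_I, Complex.norm_real, one_mul,
      norm_of_nonneg]
    have := cos_le_one c
    exact mul_nonneg (by positivity) (by linarith)
  rw [integrable_prod_iff (Continuous.aestronglyMeasurable (by fun_prop))]
  constructor
  · filter_upwards [ae_restrict_mem measurableSet_Ioi] with x hx
    exact (integral_mul_exp_mul_one_sub_cos hx).1.ofReal.const_mul _
  · refine (integrable_inv_one_add_sq.integrableOn (s := Ioi 0)).congr ?_
    filter_upwards [ae_restrict_mem measurableSet_Ioi] with x hx
    simp only [hn x _ hx]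
    exact (integral_mul_exp_mul_one_sub_cos hx).2.symm

lemma integral_halfCauchy_kernel (t : ℝ) {c : ℝ} (hc : 0 < c) :
    ∫ x : ℝ in Ioi 0, Complex.exp (t * x * Complex.I) *
      ((x * rexp (-c * x) * (1 - cos c) : ℝ) : ℂ) =
      ((1 - cos c) / c ^ 2 : ℝ) * gammaTwoChar c⁻¹ t := by
  have h (x : ℝ) : Complex.exp (t * x * Complex.I) *
      ((x * rexp (-c * x) * (1 - cos c) : ℝ) : ℂ) =
      ((1 - cos c : ℝ) : ℂ) * (x * Complex.exp (-(c - t * Complex.I) * x)) := by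
    rw [show -(c - t * Complex.I) * x = t * x * Complex.I + -c * x by ring, Complex.exp_add]
    push_cast
    ring
  simp only [h]
  rw [integral_const_mul, integral_mul_cexp (by simpa), gammaTwoChar]
  have hc' : (c : ℂ) ≠ 0 := by exact_mod_cast hc.ne'
  have h2 : (c : ℂ) - t * Complex.I = c * (1 - t * (c⁻¹ : ℝ) * Complex.I) := by
    push_cast
    field_simp
  rw [h2]
  push_cast
  rw [mul_pow, div_mul_div_comm, mul_one_div, mul_one]

lemma integral_cexp_abs_cauchyMeasure (t : ℝ) :
    ∫ x : ℝ, Complex.exp (t * |x| * Complex.I) ∂cauchyMeasure 0 1 =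
      ∫ c in Ioi 0, (2 * π⁻¹ * ((1 - cos c) / c ^ 2) : ℝ) * gammaTwoChar c⁻¹ t := by
  have hswap := integral_integral_swap (f := fun x c : ℝ => Complex.exp (t * x * Complex.I) *
    ((x * rexp (-c * x) * (1 - cos c) : ℝ) : ℂ)) (integrable_halfCauchy_kernel t)
  have h1 : ∫ c in Ioi 0, (((1 - cos c) / c ^ 2 : ℝ) : ℂ) * gammaTwoChar c⁻¹ t =
      ∫ x : ℝ in Ioi 0, Complex.exp (t * x * Complex.I) * (((1 + x ^ 2)⁻¹ : ℝ) : ℂ) := by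
    rw [← setIntegral_congr_fun measurableSet_Ioi fun c hc => integral_halfCauchy_kernel t hc]
    refine hswap.symm.trans (setIntegral_congr_fun measurableSet_Ioi fun x hx => ?_)
    rw [integral_const_mul, integral_complex_ofReal, (integral_mul_exp_mul_one_sub_cos hx).2]
  have h2 : ∫ c in Ioi 0, (2 * π⁻¹ * ((1 - cos c) / c ^ 2) : ℝ) * gammaTwoChar c⁻¹ t =
      2 * π⁻¹ * ∫ c in Ioi 0, (((1 - cos c) / c ^ 2 : ℝ) : ℂ) * gammaTwoChar c⁻¹ t := by
    rw [← integral_const_mul]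
    congr! 2 with c
    push_cast
    ring
  rw [h2, h1, integral_cauchyMeasure, integral_eq_integral_Ioi_add_neg]
  · have h3 (x : ℝ) (hx : x ∈ Ioi 0) : ((π⁻¹ * (1 + x ^ 2)⁻¹ : ℝ) : ℂ) *
        Complex.exp (t * |x| * Complex.I) =
        π⁻¹ * (Complex.exp (t * x * Complex.I) * (((1 + x ^ 2)⁻¹ : ℝ) : ℂ)) := by
      rw [abs_of_pos hx]
      push_cast
      ring
    simp only [neg_sq, abs_neg]
    rw [setIntegral_congr_fun measurableSet_Ioi h3, integral_const_mul]
    push_cast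
    ring
  · refine (integrable_inv_one_add_sq.const_mul π⁻¹).ofReal.mul_bdd (c := 1) (by fun_prop)
      (.of_forall fun x => ?_)
    rw [← Complex.ofReal_mul, Complex.norm_exp_ofReal_mul_I]

/-- The law of the absolute value of a Cauchy variable is a mixture of Gamma laws with
shape `2`. -/
lemma exists_gamma_mixture_abs_cauchyMeasure :
    ∃ ρ : Measure ℝ, IsProbabilityMeasure ρ ∧ (∀ᵐ z ∂ρ, 0 ≤ z) ∧ ∀ t : ℝ,
      ∫ x : ℝ, Complex.exp (t * |x| * Complex.I) ∂cauchyMeasure 0 1 =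
        ∫ z, gammaTwoChar z t ∂ρ := by
  set g : ℝ → ℝ := fun c => 2 * π⁻¹ * ((1 - cos c) / c ^ 2) with hg
  have hgm : Measurable g := by fun_prop
  have hg0 (c : ℝ) : 0 ≤ g c := by
    have := cos_le_one c
    have := pi_pos
    exact mul_nonneg (by positivity) (div_nonneg (by linarith) (by positivity))
  have hgi : IntegrableOn g (Ioi 0) := by
    have h := (integrable_halfCauchy_kernel 0).integral_prod_right
    have h' : IntegrableOn (fun c => (1 - cos c) / c ^ 2) (Ioi 0) := by
      refine h.re.congr ?_
      filter_upwards [ae_restrict_mem measurableSet_Ioi] with c hc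
      rw [integral_halfCauchy_kernel 0 hc]
      simp [gammaTwoChar]
      norm_cast
    exact h'.const_mul _
  set σ := (volume.restrict (Ioi 0)).withDensity fun c => ENNReal.ofReal (g c) with hσ
  have hfint (f : ℝ → ℂ) : ∫ c, f c ∂σ = ∫ c in Ioi 0, g c * f c := by
    rw [hσ, integral_withDensity_eq_integral_toReal_smul (by fun_prop) (by simp)]
    refine integral_congr_ae (.of_forall fun c => ?_)
    dsimp only
    rw [ENNReal.toReal_ofReal (hg0 c), Complex.real_smul]
  have hfin : IsFiniteMeasure σ := isFiniteMeasure_withDensity_ofReal hgi.2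
  have hprob : IsProbabilityMeasure σ := by
    have h1 : ∫ c, gammaTwoChar c⁻¹ 0 ∂σ = 1 := by
      rw [hfint, ← integral_cexp_abs_cauchyMeasure]
      simp
    simp only [gammaTwoChar, Complex.ofReal_zero, zero_mul, sub_zero, one_pow, div_one,
      integral_const, Complex.real_smul, mul_one] at h1
    exact (isProbabilityMeasure_iff_real).2 (by exact_mod_cast h1)
  refine ⟨σ.map (·⁻¹), Measure.isProbabilityMeasure_map (by fun_prop), ?_, fun t => ?_⟩
  · rw [ae_map_iff (by fun_prop) (measurableSet_le measurable_const measurable_id')]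
    refine (withDensity_absolutelyContinuous _ _).ae_le ?_
    filter_upwards [ae_restrict_mem measurableSet_Ioi] with c hc
    exact inv_nonneg.2 (le_of_lt hc)
  · rw [integral_map (by fun_prop) (continuous_gammaTwoChar t).aestronglyMeasurable, hfint,
      integral_cexp_abs_cauchyMeasure]

end HalfCauchy

section Subordinator

open Set Filter Topology

lemma integrableOn_one_sub_exp_mul_rpow {α s : ℝ} (hα0 : 0 < α) (hα1 : α < 1) (hs : 0 ≤ s) :
    IntegrableOn (fun x => (1 - rexp (-s * x)) * x ^ (-1 - α)) (Ioi 0) := by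
  have hm : Measurable fun x : ℝ => (1 - rexp (-s * x)) * x ^ (-1 - α) := by fun_prop
  have hnn {x : ℝ} (hx : 0 < x) : 0 ≤ 1 - rexp (-s * x) := by
    have : rexp (-s * x) ≤ 1 := exp_le_one_iff.2 (by nlinarith)
    linarith
  rw [← Ioc_union_Ioi_eq_Ioi zero_le_one]
  refine IntegrableOn.union ?_ ?_
  · have h : IntegrableOn (fun x : ℝ => s * x ^ (-α)) (Ioc 0 1) :=
      ((intervalIntegrable_iff_integrableOn_Ioc_of_le zero_le_one).1
        (intervalIntegral.intervalIntegrable_rpow' (by linarith))).const_mul s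
    refine Integrable.mono' h hm.aestronglyMeasurable ?_
    filter_upwards [ae_restrict_mem measurableSet_Ioc] with x hx
    have hx0 : 0 < x := hx.1
    rw [norm_of_nonneg (mul_nonneg (hnn hx0) (by positivity)),
      show -α = 1 + (-1 - α) by ring, rpow_add hx0, rpow_one, ← mul_assoc]
    have := add_one_le_exp (-s * x)
    gcongr
    linarith
  · refine Integrable.mono' (integrableOn_Ioi_rpow_of_lt (by linarith : -1 - α < -1) one_pos)
      hm.aestronglyMeasurable ?_
    filter_upwards [ae_restrict_mem measurableSet_Ioi] with x hx
    have hx0 : 0 < x := one_pos.trans hx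
    rw [norm_of_nonneg (mul_nonneg (hnn hx0) (by positivity))]
    refine mul_le_of_le_one_left (by positivity) ?_
    have := exp_pos (-s * x)
    linarith

lemma integral_one_sub_exp_mul_rpow {α s : ℝ} (hα0 : 0 < α) (hs : 0 ≤ s) :
    ∫ x in Ioi 0, (1 - rexp (-s * x)) * x ^ (-1 - α) =
      s ^ α * ∫ x in Ioi 0, (1 - rexp (-x)) * x ^ (-1 - α) := by
  rcases hs.eq_or_lt with rfl | hs
  · simp [zero_rpow hα0.ne']
  have h := integral_comp_mul_left_Ioi (fun x => (1 - rexp (-x)) * x ^ (-1 - α)) 0 hs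
  rw [mul_zero, smul_eq_mul] at h
  have h2 (x : ℝ) (hx : x ∈ Ioi (0 : ℝ)) : (1 - rexp (-s * x)) * x ^ (-1 - α) =
      s ^ (1 + α) * ((1 - rexp (-(s * x))) * (s * x) ^ (-1 - α)) := by
    rw [mul_rpow hs.le (le_of_lt hx), neg_mul, show -1 - α = -(1 + α) by ring,
      rpow_neg hs.le (1 + α)]
    field_simp
  rw [setIntegral_congr_fun measurableSet_Ioi h2, integral_const_mul, h, rpow_add hs, rpow_one]
  field_simp

lemma integral_one_sub_exp_mul_rpow_pos {α : ℝ} (hα0 : 0 < α) (hα1 : α < 1) :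
    0 < ∫ x in Ioi 0, (1 - rexp (-x)) * x ^ (-1 - α) := by
  have hpos (x : ℝ) (hx : x ∈ Ioi 0) : 0 < (1 - rexp (-x)) * x ^ (-1 - α) :=
    mul_pos (by simpa using hx) (rpow_pos_of_pos hx _)
  have hi := integrableOn_one_sub_exp_mul_rpow hα0 hα1 zero_le_one
  simp only [neg_one_mul] at hi
  rw [setIntegral_pos_iff_support_of_nonneg_ae
    (by filter_upwards [ae_restrict_mem measurableSet_Ioi] with x hx using (hpos x hx).le) hi]
  have : Function.support (fun x => (1 - rexp (-x)) * x ^ (-1 - α)) ∩ Ioi 0 = Ioi 0 :=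
    inter_eq_right.2 fun x hx => (hpos x hx).ne'
  rw [this]
  simp

lemma exists_compoundPoisson_laplace {α a ε : ℝ} (hα0 : 0 < α) (ha : 0 < a) (hε : 0 < ε) :
    ∃ ρ : Measure ℝ, IsProbabilityMeasure ρ ∧ (∀ᵐ c ∂ρ, 0 ≤ c) ∧ ∀ s : ℝ, 0 ≤ s →
      ∫ x : ℝ, Complex.exp (((-s : ℝ) : ℂ) * x) ∂ρ =
        rexp (-(a * ∫ x in Ioi ε, (1 - rexp (-s * x)) * x ^ (-1 - α))) := by
  have hgi : IntegrableOn (fun x : ℝ => a * x ^ (-1 - α)) (Ioi ε) :=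
    (integrableOn_Ioi_rpow_of_lt (by linarith) hε).const_mul a
  set ν := (volume.restrict (Ioi ε)).withDensity fun x : ℝ => ENNReal.ofReal (a * x ^ (-1 - α))
    with hν
  have hfint (f : ℝ → ℝ) : ∫ x, f x ∂ν = ∫ x in Ioi ε, (a * x ^ (-1 - α)) * f x := by
    rw [hν, integral_withDensity_eq_integral_toReal_smul (by fun_prop) (by simp)]
    refine setIntegral_congr_fun measurableSet_Ioi fun x hx => ?_
    have : 0 < x := hε.trans hx
    rw [ENNReal.toReal_ofReal (by positivity), smul_eq_mul]
  have hfin : IsFiniteMeasure ν := isFiniteMeasure_withDensity_ofReal hgi.2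
  have hν0 : ∀ᵐ x ∂ν, 0 ≤ x := by
    refine (withDensity_absolutelyContinuous _ _).ae_le ?_
    filter_upwards [ae_restrict_mem measurableSet_Ioi] with x hx
    exact (hε.trans hx).le
  refine ⟨compoundPoisson ν, inferInstance, ae_nonneg_compoundPoisson hν0, fun s hs => ?_⟩
  rw [integral_cexp_compoundPoisson hν0 (by simpa), Complex.ofReal_exp]
  congr 1
  have h1 : ν.real univ = ∫ x in Ioi ε, a * x ^ (-1 - α) := by
    simpa using hfint fun _ => 1
  have h2 : ∫ x : ℝ, Complex.exp (((-s : ℝ) : ℂ) * x) ∂ν =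
      ((∫ x in Ioi ε, a * x ^ (-1 - α) * rexp (-s * x) : ℝ) : ℂ) := by
    rw [← hfint, ← integral_complex_ofReal]
    simp
  rw [h1, h2, ← Complex.ofReal_sub, ← integral_sub, ← integral_const_mul, ← integral_neg]
  · congr 2
    ext x
    ring
  · refine hgi.mul_bdd (c := 1) (by fun_prop) ?_
    filter_upwards [ae_restrict_mem measurableSet_Ioi] with x hx
    have : 0 < x := hε.trans hx
    rw [norm_of_nonneg (exp_nonneg _), exp_le_one_iff]
    nlinarith
  · exact hgi

lemma exists_seq_laplace_tendsto {α : ℝ} (hα0 : 0 < α) (hα1 : α ≤ 1) :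
    ∃ ρ : ℕ → Measure ℝ, (∀ k, IsProbabilityMeasure (ρ k)) ∧ (∀ k, ∀ᵐ c ∂ρ k, 0 ≤ c) ∧
      ∀ s : ℝ, 0 ≤ s → Tendsto (fun k => ∫ x : ℝ, Complex.exp (((-s : ℝ) : ℂ) * x) ∂ρ k) atTop
        (𝓝 ((rexp (-(s ^ α)) : ℝ) : ℂ)) := by
  rcases hα1.eq_or_lt with rfl | hα1
  · refine ⟨fun _ => Measure.dirac 1, fun _ => inferInstance, fun _ => ?_, fun s _ => ?_⟩
    · rw [ae_dirac_iff (measurableSet_le measurable_const measurable_id')]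
      exact zero_le_one
    · simp
  have hC := integral_one_sub_exp_mul_rpow_pos hα0 hα1
  set C := ∫ x in Ioi 0, (1 - rexp (-x)) * x ^ (-1 - α) with hCdef
  choose ρ hprob hnn hρ using fun k : ℕ => exists_compoundPoisson_laplace (α := α) hα0
    (inv_pos.2 hC) (by positivity : 0 < 1 / ((k : ℝ) + 1))
  refine ⟨ρ, hprob, hnn, fun s hs => ?_⟩
  simp only [hρ _ s hs]
  have hcov := aecover_Ioi_of_Ioi (μ := volume) (tendsto_one_div_add_atTop_nhds_zero_nat (𝕜 := ℝ))
  have h := hcov.integral_tendsto_of_countably_generated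
    (integrableOn_one_sub_exp_mul_rpow hα0 hα1 hs)
  rw [integral_one_sub_exp_mul_rpow hα0 hs] at h
  have h2 (k : ℕ) : (volume.restrict (Ioi (0 : ℝ))).restrict (Ioi (1 / ((k : ℝ) + 1))) =
      volume.restrict (Ioi (1 / ((k : ℝ) + 1))) := by
    rw [Measure.restrict_restrict measurableSet_Ioi, inter_eq_left.2]
    exact Ioi_subset_Ioi (by positivity)
  simp only [h2] at h
  have h3 := (((h.const_mul C⁻¹).neg).rexp)
  rw [show C⁻¹ * (s ^ α * C) = s ^ α by field_simp] at h3
  exact (Complex.continuous_ofReal.tendsto _).comp h3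

end Subordinator

section StableMixture

open ProbabilityTheory Set Filter Topology

/-- The law of the product of two independent variables with laws `ρ` and `σ`. -/
noncomputable def mulLaw (ρ σ : Measure ℝ) : Measure ℝ := (ρ.prod σ).map fun p => p.1 * p.2

instance isProbabilityMeasure_mulLaw (ρ σ : Measure ℝ) [IsProbabilityMeasure ρ]
    [IsProbabilityMeasure σ] : IsProbabilityMeasure (mulLaw ρ σ) :=
  Measure.isProbabilityMeasure_map (by fun_prop)

lemma integral_mulLaw (ρ σ : Measure ℝ) [IsProbabilityMeasure ρ] [IsProbabilityMeasure σ]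
    {f : ℝ → ℂ} (hf : Continuous f) (hb : ∀ x, ‖f x‖ ≤ 1) :
    ∫ x, f x ∂mulLaw ρ σ = ∫ c, ∫ x, f (c * x) ∂σ ∂ρ := by
  rw [mulLaw, integral_map (by fun_prop) hf.aestronglyMeasurable, integral_prod]
  exact Integrable.of_bound (Continuous.aestronglyMeasurable (by fun_prop)) 1
    (.of_forall fun p => hb _)

lemma ae_nonneg_mulLaw {ρ σ : Measure ℝ} [IsProbabilityMeasure ρ] [IsProbabilityMeasure σ]
    (hρ : ∀ᵐ x ∂ρ, 0 ≤ x) (hσ : ∀ᵐ x ∂σ, 0 ≤ x) : ∀ᵐ x ∂mulLaw ρ σ, 0 ≤ x := by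
  rw [mulLaw, ae_map_iff (by fun_prop) (measurableSet_le measurable_const measurable_id')]
  filter_upwards [Measure.quasiMeasurePreserving_fst.ae hρ,
    Measure.quasiMeasurePreserving_snd.ae hσ] with p h1 h2
  exact mul_nonneg h1 h2

lemma charFun_mulLaw_cauchyMeasure {ρ : Measure ℝ} [IsProbabilityMeasure ρ]
    (hρ : ∀ᵐ x ∂ρ, 0 ≤ x) (t : ℝ) : charFun (mulLaw ρ (cauchyMeasure 0 1)) t =
      ∫ c : ℝ, Complex.exp (((-|t| : ℝ) : ℂ) * c) ∂ρ := by
  rw [charFun_apply_real, integral_mulLaw _ _ (by fun_prop) fun x => by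
    rw [← Complex.ofReal_mul, Complex.norm_exp_ofReal_mul_I]]
  refine integral_congr_ae ?_
  filter_upwards [hρ] with c hc
  have h := charFun_cauchyMeasure (t * c)
  rw [charFun_apply_real] at h
  push_cast at h ⊢
  simp only [← mul_assoc]
  rw [h, abs_mul, abs_of_nonneg hc]
  push_cast
  ring_nf

lemma nonnegInfDiv_map_abs_mulLaw_cauchyMeasure {ρ : Measure ℝ} [IsProbabilityMeasure ρ]
    (hρ : ∀ᵐ x ∂ρ, 0 ≤ x) :
    NonnegInfDiv ((mulLaw ρ (cauchyMeasure 0 1)).map fun x => |x|) := by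
  obtain ⟨σ, hσ, hσ0, h⟩ := exists_gamma_mixture_abs_cauchyMeasure
  have : IsProbabilityMeasure ((mulLaw ρ (cauchyMeasure 0 1)).map fun x => |x|) :=
    Measure.isProbabilityMeasure_map (by fun_prop)
  refine NonnegInfDiv.of_charFun_eq_integral (ae_nonneg_mulLaw hρ hσ0) fun t => ?_
  rw [integral_mulLaw _ _ (continuous_gammaTwoChar t) fun z => norm_gammaTwoChar_le z t,
    charFun_apply_real, integral_map (by fun_prop) (Continuous.aestronglyMeasurable (by fun_prop)),
    integral_mulLaw _ _ (by fun_prop) fun x => by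
      rw [← Complex.ofReal_mul, Complex.norm_exp_ofReal_mul_I]]
  refine integral_congr_ae ?_
  filter_upwards [hρ] with c hc
  have h1 := h (t * c)
  have h2 (z : ℝ) : gammaTwoChar (c * z) t = gammaTwoChar z (t * c) := by
    simp [gammaTwoChar, mul_assoc]
  simp only [h2, ← h1, abs_mul, abs_of_nonneg hc]
  push_cast
  simp only [mul_assoc]

lemma tendsto_charFun_map_abs {μs : ℕ → Measure ℝ} [∀ k, IsProbabilityMeasure (μs k)]
    {μ : Measure ℝ} [IsProbabilityMeasure μ]
    (h : ∀ t, Tendsto (fun k => charFun (μs k) t) atTop (𝓝 (charFun μ t))) (t : ℝ) :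
    Tendsto (fun k => charFun ((μs k).map fun x => |x|) t) atTop
      (𝓝 (charFun (μ.map fun x => |x|) t)) := by
  let P (k : ℕ) : ProbabilityMeasure ℝ := ⟨μs k, inferInstance⟩
  let Q : ProbabilityMeasure ℝ := ⟨μ, inferInstance⟩
  have h1 : Tendsto P atTop (𝓝 Q) := ProbabilityMeasure.tendsto_iff_tendsto_charFun.2 h
  have h2 := ProbabilityMeasure.tendsto_map_of_tendsto_of_continuous _ _ h1 continuous_abs
  exact ProbabilityMeasure.tendsto_iff_tendsto_charFun.1 h2 t

end StableMixture

/-- If `μ` is the symmetric strictly `α`-stable law, with characteristic function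
`x ↦ exp(−|x|^α)`, `0 < α ≤ 1`, then the law of the absolute value (the half symmetric
`α`-stable distribution) is infinitely divisible. -/
theorem half_symmetric_stable_infinitelyDivisible (α : ℝ) (hα0 : 0 < α) (hα1 : α ≤ 1)
    (μ : Measure ℝ) [IsProbabilityMeasure μ]
    (hchar : ∀ x : ℝ, ∫ t, Complex.exp (Complex.I * (x * t : ℝ)) ∂μ =
      (Real.exp (-(|x| ^ α)) : ℝ)) :
    IsInfinitelyDivisible (Measure.map (fun t : ℝ => |t|) μ) := by
  obtain ⟨ρ, hρ, hρ0, hlim⟩ := exists_seq_laplace_tendsto hα0 hα1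
  have hμ (t : ℝ) : charFun μ t = (Real.exp (-(|t| ^ α)) : ℝ) := by
    rw [← hchar, charFun_apply_real]
    refine integral_congr_ae (.of_forall fun x => ?_)
    dsimp only
    rw [mul_comm Complex.I, Complex.ofReal_mul]
  have hprob : IsProbabilityMeasure (μ.map fun t : ℝ => |t|) :=
    Measure.isProbabilityMeasure_map (by fun_prop)
  have hprob' (k : ℕ) : IsProbabilityMeasure
      ((mulLaw (ρ k) (ProbabilityTheory.cauchyMeasure 0 1)).map fun t : ℝ => |t|) :=
    Measure.isProbabilityMeasure_map (by fun_prop)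
  have hdiv := NonnegInfDiv.of_tendsto_charFun
    (fun k => nonnegInfDiv_map_abs_mulLaw_cauchyMeasure (hρ0 k)) (tendsto_charFun_map_abs
      (μ := μ) fun t => by
        simp only [charFun_mulLaw_cauchyMeasure (hρ0 _), hμ]
        exact hlim |t| (abs_nonneg t))
  intro n hn
  obtain ⟨ν, hν, -, h⟩ := hdiv n hn
  exact ⟨ν, hν, h.symm⟩
end
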